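/- arXiv:1808.06523 — 8 statements merged into one kernel-verified Lean document; each statement's English description precedes it below -/
import Mathlib

section
/- In the Temperley–Lieb algebra 𝒯(d,n), for all integers i, j with i > j+1 ≥ 1 (so 2 ≤ i ≤ n−1 and 0 ≤ j ≤ i−2) and all k with 1 ≤ k ≤ d−1, the relation E_{i,1}E_0^kE^{1,j}E_i = E_{i−2,1}E_0^kE^{1,j}E_i holds. -/
/-- The defining relations of the Temperley–Lieb algebra `𝒯(d,n)` of the complex
reflection group `G(d,1,n)`, on the free associative `ℂ`-algebra on generators
`E_0, …, E_{n-1}`. -/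
inductive TLrel (d n : ℕ) (δ : ℂ) :
    FreeAlgebra ℂ (Fin n) → FreeAlgebra ℂ (Fin n) → Prop
  | idem (i : ℕ) (h1 : 1 ≤ i) (h2 : i < n) :
      TLrel d n δ (FreeAlgebra.ι ℂ (⟨i, h2⟩ : Fin n) * FreeAlgebra.ι ℂ (⟨i, h2⟩ : Fin n))
        (δ • FreeAlgebra.ι ℂ (⟨i, h2⟩ : Fin n))
  | powzero (h : 0 < n) :
      TLrel d n δ ((FreeAlgebra.ι ℂ (⟨0, h⟩ : Fin n)) ^ d)
        ((((d : ℂ) - 1) * δ) • FreeAlgebra.ι ℂ (⟨0, h⟩ : Fin n))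
  | comm (i j : ℕ) (hij : j + 1 < i) (hi : i < n) :
      TLrel d n δ
        (FreeAlgebra.ι ℂ (⟨i, hi⟩ : Fin n) * FreeAlgebra.ι ℂ (⟨j, by omega⟩ : Fin n))
        (FreeAlgebra.ι ℂ (⟨j, by omega⟩ : Fin n) * FreeAlgebra.ι ℂ (⟨i, hi⟩ : Fin n))
  | untwist_up (i : ℕ) (h1 : 1 ≤ i) (h2 : i + 1 < n) :
      TLrel d n δ
        (FreeAlgebra.ι ℂ (⟨i, by omega⟩ : Fin n) * FreeAlgebra.ι ℂ (⟨i + 1, h2⟩ : Fin n) *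
          FreeAlgebra.ι ℂ (⟨i, by omega⟩ : Fin n))
        (FreeAlgebra.ι ℂ (⟨i, by omega⟩ : Fin n))
  | untwist_down (i : ℕ) (h1 : 1 ≤ i) (h2 : i + 1 < n) :
      TLrel d n δ
        (FreeAlgebra.ι ℂ (⟨i + 1, h2⟩ : Fin n) * FreeAlgebra.ι ℂ (⟨i, by omega⟩ : Fin n) *
          FreeAlgebra.ι ℂ (⟨i + 1, h2⟩ : Fin n))
        (FreeAlgebra.ι ℂ (⟨i + 1, h2⟩ : Fin n))
  | rel01 (k : ℕ) (hk1 : 1 ≤ k) (hk2 : k < d) (hn : 1 < n) :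
      TLrel d n δ
        (FreeAlgebra.ι ℂ (⟨0, by omega⟩ : Fin n) * FreeAlgebra.ι ℂ (⟨1, hn⟩ : Fin n) *
          (FreeAlgebra.ι ℂ (⟨0, by omega⟩ : Fin n)) ^ k * FreeAlgebra.ι ℂ (⟨1, hn⟩ : Fin n))
        (((k : ℂ) + 1) • (FreeAlgebra.ι ℂ (⟨0, by omega⟩ : Fin n) * FreeAlgebra.ι ℂ (⟨1, hn⟩ : Fin n)))
  | rel10 (k : ℕ) (hk1 : 1 ≤ k) (hk2 : k < d) (hn : 1 < n) :
      TLrel d n δ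
        (FreeAlgebra.ι ℂ (⟨1, hn⟩ : Fin n) * (FreeAlgebra.ι ℂ (⟨0, by omega⟩ : Fin n)) ^ k *
          FreeAlgebra.ι ℂ (⟨1, hn⟩ : Fin n) * FreeAlgebra.ι ℂ (⟨0, by omega⟩ : Fin n))
        (((k : ℂ) + 1) • (FreeAlgebra.ι ℂ (⟨1, hn⟩ : Fin n) * FreeAlgebra.ι ℂ (⟨0, by omega⟩ : Fin n)))

/-- The Temperley–Lieb algebra `𝒯(d,n)`. -/
abbrev TL (d n : ℕ) (δ : ℂ) := RingQuot (TLrel d n δ)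


/-- The generator `E_i` of `𝒯(d,n)` (by convention `0` for `i ≥ n`). -/
noncomputable def Egen (d n : ℕ) (δ : ℂ) (i : ℕ) : TL d n δ :=
  if h : i < n then RingQuot.mkAlgHom ℂ (TLrel d n δ) (FreeAlgebra.ι ℂ (⟨i, h⟩ : Fin n)) else 0

/-- The descending product `E_{i,j} = E_i E_{i−1} ⋯ E_j` (equal to `1` if `j = i + 1`). -/
noncomputable def Edec (d n : ℕ) (δ : ℂ) (i j : ℕ) : TL d n δ :=
  (((List.range' j (i + 1 - j)).reverse).map (Egen d n δ)).prod

/-- The ascending product `E^{j,i} = E_j E_{j+1} ⋯ E_i` (equal to `1` if `i = j - 1`). -/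
noncomputable def Einc (d n : ℕ) (δ : ℂ) (j i : ℕ) : TL d n δ :=
  ((List.range' j (i + 1 - j)).map (Egen d n δ)).prod

theorem Egen_commute {d n : ℕ} (δ : ℂ) {i j : ℕ} (hij : j + 1 < i) :
    Commute (Egen d n δ i) (Egen d n δ j) := by
  unfold Egen
  by_cases hi : i < n
  · rw [dif_pos hi, dif_pos (show j < n by omega), Commute, SemiconjBy, ← map_mul, ← map_mul]
    exact RingQuot.mkAlgHom_rel ℂ (TLrel.comm i j hij hi)
  · rw [dif_neg hi]
    exact Commute.zero_left _

theorem Egen_succ_mul_Egen_mul_Egen_succ {d n : ℕ} (δ : ℂ) {i : ℕ} (h1 : 1 ≤ i) :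
    Egen d n δ (i + 1) * Egen d n δ i * Egen d n δ (i + 1) = Egen d n δ (i + 1) := by
  unfold Egen
  by_cases hi : i + 1 < n
  · rw [dif_pos hi, dif_pos (show i < n by omega), ← map_mul, ← map_mul]
    exact RingQuot.mkAlgHom_rel ℂ (TLrel.untwist_down i h1 hi)
  · simp [hi]

theorem Edec_succ {d n : ℕ} (δ : ℂ) {i j : ℕ} (h : j ≤ i + 1) :
    Edec d n δ (i + 1) j = Egen d n δ (i + 1) * Edec d n δ i j := by
  unfold Edec
  rw [show i + 1 + 1 - j = i + 1 - j + 1 by omega, List.range'_1_concat]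
  simp [show j + (i + 1 - j) = i + 1 by omega]

theorem Egen_commute_Edec {d n : ℕ} (δ : ℂ) {i m : ℕ} (j : ℕ) (h : m + 1 < i) :
    Commute (Egen d n δ i) (Edec d n δ m j) := by
  refine Commute.list_prod_right _ _ fun y hy => ?_
  obtain ⟨l, hl, rfl⟩ := List.mem_map.1 hy
  rw [List.mem_reverse, List.mem_range'_1] at hl
  exact Egen_commute δ (by omega)

theorem Egen_commute_Einc {d n : ℕ} (δ : ℂ) {i m : ℕ} (j : ℕ) (h : m + 1 < i) :
    Commute (Egen d n δ i) (Einc d n δ j m) := by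
  refine Commute.list_prod_right _ _ fun y hy => ?_
  obtain ⟨l, hl, rfl⟩ := List.mem_map.1 hy
  rw [List.mem_range'_1] at hl
  exact Egen_commute δ (by omega)

/-- In `𝒯(d,n)`, for `i > j+1 ≥ 1` and `1 ≤ k ≤ d−1`,
`E_{i,1} E_0^k E^{1,j} E_i = E_{i−2,1} E_0^k E^{1,j} E_i`. -/
theorem TL_lemma (d n : ℕ) (hd : 2 ≤ d) (hn : 2 ≤ n) (δ : ℂ) (i j k : ℕ)
    (hij : j + 1 < i) (hi : i ≤ n - 1) (hk1 : 1 ≤ k) (hk2 : k ≤ d - 1) :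
    Edec d n δ i 1 * (Egen d n δ 0) ^ k * Einc d n δ 1 j * Egen d n δ i =
      Edec d n δ (i - 2) 1 * (Egen d n δ 0) ^ k * Einc d n δ 1 j * Egen d n δ i := by
  obtain ⟨m, rfl⟩ : ∃ m, i = m + 2 := ⟨i - 2, by omega⟩
  rw [Nat.add_sub_cancel, show m + 2 = m + 1 + 1 from rfl, Edec_succ δ (by omega),
    Edec_succ δ (by omega)]
  have hX : Commute (Egen d n δ (m + 1 + 1))
      (Edec d n δ m 1 * Egen d n δ 0 ^ k * Einc d n δ 1 j) :=
    ((Egen_commute_Edec δ 1 (by omega)).mul_right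
      ((Egen_commute δ (by omega)).pow_right k)).mul_right (Egen_commute_Einc δ 1 hij)
  have hXeq := hX.eq
  rw [← hXeq]
  simp only [mul_assoc] at hXeq ⊢
  rw [← hXeq]
  simp only [← mul_assoc]
  rw [Egen_succ_mul_Egen_mul_Egen_succ δ (by omega)]
end

section
/- For all integers n ≥ 2 and every parameter δ ∈ ℂ, the Temperley–Lieb algebra 𝒯(B_n) of type B_n is a finite-dimensional ℂ-vector space of dimension (n+2)·C_n − 1. -/
/-- The defining relations of the Temperley–Lieb algebra `𝒯(B_n)` of type `B_n`,
on the free associative `ℂ`-algebra on generators `E_0, …, E_{n-1}`. -/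
inductive TLBrel (n : ℕ) (δ : ℂ) :
    FreeAlgebra ℂ (Fin n) → FreeAlgebra ℂ (Fin n) → Prop
  | idem (i : ℕ) (h : i < n) :
      TLBrel n δ (FreeAlgebra.ι ℂ (⟨i, h⟩ : Fin n) * FreeAlgebra.ι ℂ (⟨i, h⟩ : Fin n))
        (δ • FreeAlgebra.ι ℂ (⟨i, h⟩ : Fin n))
  | comm (i j : ℕ) (hij : j + 1 < i) (hi : i < n) :
      TLBrel n δ
        (FreeAlgebra.ι ℂ (⟨i, hi⟩ : Fin n) * FreeAlgebra.ι ℂ (⟨j, by omega⟩ : Fin n))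
        (FreeAlgebra.ι ℂ (⟨j, by omega⟩ : Fin n) * FreeAlgebra.ι ℂ (⟨i, hi⟩ : Fin n))
  | untwist_up (i : ℕ) (h1 : 1 ≤ i) (h2 : i + 1 < n) :
      TLBrel n δ
        (FreeAlgebra.ι ℂ (⟨i, by omega⟩ : Fin n) * FreeAlgebra.ι ℂ (⟨i + 1, h2⟩ : Fin n) *
          FreeAlgebra.ι ℂ (⟨i, by omega⟩ : Fin n))
        (FreeAlgebra.ι ℂ (⟨i, by omega⟩ : Fin n))
  | untwist_down (i : ℕ) (h1 : 1 ≤ i) (h2 : i + 1 < n) :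
      TLBrel n δ
        (FreeAlgebra.ι ℂ (⟨i + 1, h2⟩ : Fin n) * FreeAlgebra.ι ℂ (⟨i, by omega⟩ : Fin n) *
          FreeAlgebra.ι ℂ (⟨i + 1, h2⟩ : Fin n))
        (FreeAlgebra.ι ℂ (⟨i + 1, h2⟩ : Fin n))
  | rel01 (hn : 1 < n) :
      TLBrel n δ
        (FreeAlgebra.ι ℂ (⟨0, by omega⟩ : Fin n) * FreeAlgebra.ι ℂ (⟨1, hn⟩ : Fin n) *
          FreeAlgebra.ι ℂ (⟨0, by omega⟩ : Fin n) * FreeAlgebra.ι ℂ (⟨1, hn⟩ : Fin n))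
        ((2 : ℂ) • (FreeAlgebra.ι ℂ (⟨0, by omega⟩ : Fin n) * FreeAlgebra.ι ℂ (⟨1, hn⟩ : Fin n)))
  | rel10 (hn : 1 < n) :
      TLBrel n δ
        (FreeAlgebra.ι ℂ (⟨1, hn⟩ : Fin n) * FreeAlgebra.ι ℂ (⟨0, by omega⟩ : Fin n) *
          FreeAlgebra.ι ℂ (⟨1, hn⟩ : Fin n) * FreeAlgebra.ι ℂ (⟨0, by omega⟩ : Fin n))
        ((2 : ℂ) • (FreeAlgebra.ι ℂ (⟨1, hn⟩ : Fin n) * FreeAlgebra.ι ℂ (⟨0, by omega⟩ : Fin n)))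

/-- The Temperley–Lieb algebra `𝒯(B_n)` of type `B_n`. -/
abbrev TLB (n : ℕ) (δ : ℂ) := RingQuot (TLBrel n δ)

/-- The generator `E_i` of `𝒯(B_n)` (by convention `0` for `i ≥ n`). -/
noncomputable def EgenB (n : ℕ) (δ : ℂ) (i : ℕ) : TLB n δ :=
  if h : i < n then RingQuot.mkAlgHom ℂ (TLBrel n δ) (FreeAlgebra.ι ℂ (⟨i, h⟩ : Fin n)) else 0

/-- The descending product `E_{i,j} = E_i E_{i−1} ⋯ E_j` (equal to `1` if `j = i + 1`). -/
noncomputable def EdecB (n : ℕ) (δ : ℂ) (i j : ℕ) : TLB n δ :=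
  (((List.range' j (i + 1 - j)).reverse).map (EgenB n δ)).prod

/-- The ascending product `E^{j,i} = E_j E_{j+1} ⋯ E_i` (equal to `1` if `i = j - 1`). -/
noncomputable def EincB (n : ℕ) (δ : ℂ) (j i : ℕ) : TLB n δ :=
  ((List.range' j (i + 1 - j)).map (EgenB n δ)).prod

/-- The `n`-th Catalan number `C_n = binom(2n,n)/(n+1)`. -/
def catalanNum (n : ℕ) : ℕ := (2 * n).choose n / (n + 1)

section UpperBound

variable {R : Type*} [Ring R]

/-- The descending product `e n * ⋯ * e j`. -/
def decProd (e : ℕ → R) : ℕ → ℕ → R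
  | 0, j => if j = 0 then e 0 else 1
  | n + 1, j => if j ≤ n + 1 then e (n + 1) * decProd e n j else 1

/-- The ascending product `e 1 * ⋯ * e j`. -/
def incProd (e : ℕ → R) : ℕ → R
  | 0 => 1
  | j + 1 => incProd e j * e (j + 1)

/-- The product `e n * ⋯ * e 1 * e 0 * e 1 * ⋯ * e j`. -/
def bounceProd (e : ℕ → R) (n j : ℕ) : R := decProd e n 0 * incProd e j

lemma decProd_of_lt (e : ℕ → R) {n j : ℕ} (h : n < j) : decProd e n j = 1 := by
  cases n with
  | zero => simp [decProd, Nat.pos_iff_ne_zero.1 h]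
  | succ n => simp [decProd, Nat.not_le.2 h]

lemma decProd_succ (e : ℕ → R) {n j : ℕ} (h : j ≤ n + 1) :
    decProd e (n + 1) j = e (n + 1) * decProd e n j := by
  simp [decProd, h]

lemma decProd_self (e : ℕ → R) (n : ℕ) : decProd e n n = e n := by
  cases n with
  | zero => simp [decProd]
  | succ n => rw [decProd_succ e le_rfl, decProd_of_lt e (Nat.lt_succ_self n), mul_one]

lemma decProd_mul_eq (e : ℕ → R) {n k j : ℕ} (hj : j ≤ k + 1) (hk : k ≤ n) :
    decProd e n (k + 1) * decProd e k j = decProd e n j := by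
  induction n with
  | zero =>
    obtain rfl : k = 0 := by omega
    simp [decProd]
  | succ n ih =>
    rcases Nat.lt_or_ge n k with h | h
    · obtain rfl : k = n + 1 := by omega
      rw [decProd_of_lt e (Nat.lt_succ_self _), one_mul]
    · rw [decProd_succ e (by omega), mul_assoc, ih h, decProd_succ e (by omega)]

lemma decProd_succ_mul (e : ℕ → R) {n k : ℕ} (hk : k ≤ n) :
    decProd e n (k + 1) * e k = decProd e n k := by
  rw [← decProd_mul_eq e (Nat.le_succ k) hk, decProd_self]

lemma bounceProd_succ (e : ℕ → R) (n j : ℕ) :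
    bounceProd e n (j + 1) = bounceProd e n j * e (j + 1) := by
  simp [bounceProd, incProd, mul_assoc]

open Classical in
/-- The normal monomials in `e 0, …, e (n - 1)` whose last factor ends before index `m`. -/
noncomputable def normalMonomials (e : ℕ → R) : ℕ → ℕ → Finset R
  | 0, _ => {1}
  | n + 1, m =>
    normalMonomials e n m ∪
      ((Finset.range (min m (n + 1))).biUnion fun j =>
        (normalMonomials e n (max j 1)).image (· * decProd e n j)) ∪
      (Finset.Ico 1 (min m (n + 1))).image (bounceProd e n)

/-- An upper bound for the number of normal monomials. -/
def monomialCount : ℕ → ℕ → ℕ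
  | 0, _ => 1
  | n + 1, m =>
    monomialCount n m + (∑ j ∈ Finset.range (min m (n + 1)), monomialCount n (max j 1)) +
      (min m (n + 1) - 1)

lemma card_normalMonomials_le (e : ℕ → R) (n m : ℕ) :
    (normalMonomials e n m).card ≤ monomialCount n m := by
  classical
  induction n generalizing m with
  | zero => simp [normalMonomials, monomialCount]
  | succ n ih =>
    rw [normalMonomials, monomialCount]
    refine (Finset.card_union_le _ _).trans (add_le_add ((Finset.card_union_le _ _).trans
      (add_le_add (ih m) (Finset.card_biUnion_le.trans (Finset.sum_le_sum fun j _ => ?_)))) ?_)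
    · exact Finset.card_image_le.trans (ih _)
    · exact Finset.card_image_le.trans (by simp)

lemma normalMonomials_subset (e : ℕ → R) (n m : ℕ) {x : R} (hx : x ∈ normalMonomials e n m) :
    x ∈ normalMonomials e (n + 1) m := by
  classical
  rw [normalMonomials]
  simp [hx]

lemma mul_decProd_mem_normalMonomials (e : ℕ → R) {n m j : ℕ} (hj : j < m) (hjn : j ≤ n) {x : R}
    (hx : x ∈ normalMonomials e n (max j 1)) : x * decProd e n j ∈ normalMonomials e (n + 1) m := by
  classical
  rw [normalMonomials]
  refine Finset.mem_union_left _ (Finset.mem_union_right _ (Finset.mem_biUnion.2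
    ⟨j, Finset.mem_range.2 (by omega), Finset.mem_image_of_mem _ hx⟩))

lemma bounceProd_mem_normalMonomials (e : ℕ → R) {n m j : ℕ} (hj1 : 1 ≤ j) (hj : j < m)
    (hjn : j ≤ n) : bounceProd e n j ∈ normalMonomials e (n + 1) m := by
  classical
  rw [normalMonomials]
  exact Finset.mem_union_right _ (Finset.mem_image_of_mem _ (Finset.mem_Ico.2 (by omega)))

variable [Algebra ℂ R]

/-- The relations of `𝒯(B_N)` for a family of elements of a `ℂ`-algebra. -/
structure IsTLB (N : ℕ) (δ : ℂ) (e : ℕ → R) : Prop where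
  idem : ∀ i, i < N → e i * e i = δ • e i
  comm : ∀ i j, j + 1 < i → i < N → e i * e j = e j * e i
  up : ∀ i, 1 ≤ i → i + 1 < N → e i * e (i + 1) * e i = e i
  down : ∀ i, 1 ≤ i → i + 1 < N → e (i + 1) * e i * e (i + 1) = e (i + 1)
  rel01 : 1 < N → e 0 * e 1 * e 0 * e 1 = (2 : ℂ) • (e 0 * e 1)
  rel10 : 1 < N → e 1 * e 0 * e 1 * e 0 = (2 : ℂ) • (e 1 * e 0)

/-- The subalgebra generated by `e 0, …, e (n - 1)`. -/
def initAlg (e : ℕ → R) (n : ℕ) : Subalgebra ℂ R := Algebra.adjoin ℂ (e '' Set.Iio n)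

lemma gen_mem_initAlg (e : ℕ → R) {n k : ℕ} (h : k < n) : e k ∈ initAlg e n :=
  Algebra.subset_adjoin ⟨k, h, rfl⟩

lemma initAlg_mono (e : ℕ → R) {m n : ℕ} (h : m ≤ n) : initAlg e m ≤ initAlg e n :=
  Algebra.adjoin_mono (Set.image_mono (Set.Iio_subset_Iio h))

lemma decProd_mem (e : ℕ → R) {n j m : ℕ} (h : n < m) : decProd e n j ∈ initAlg e m := by
  induction n with
  | zero =>
    unfold decProd
    split
    · exact gen_mem_initAlg e h
    · exact one_mem _
  | succ n ih =>
    unfold decProd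
    split
    · exact mul_mem (gen_mem_initAlg e h) (ih (by omega))
    · exact one_mem _

namespace IsTLB

variable {N : ℕ} {δ : ℂ} {e : ℕ → R}

lemma commute_gen (H : IsTLB N δ e) {i j : ℕ} (h : i + 1 < j ∨ j + 1 < i) (hi : i < N)
    (hj : j < N) : Commute (e i) (e j) := by
  rcases h with h | h
  · exact (H.comm j i h hj).symm
  · exact H.comm i j h hi

lemma commute_decProd_of_lt (H : IsTLB N δ e) {n j k : ℕ} (h : k + 1 < j) (hn : n < N) :
    Commute (e k) (decProd e n j) := by
  induction n with
  | zero => rw [decProd_of_lt e (by omega)]; exact Commute.one_right _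
  | succ n ih =>
    rcases Nat.lt_or_ge (n + 1) j with h' | h'
    · rw [decProd_of_lt e h']; exact Commute.one_right _
    · rw [decProd_succ e h']
      exact (H.commute_gen (by omega) (by omega) hn).mul_right (ih (by omega))

lemma commute_decProd_of_gt (H : IsTLB N δ e) {n j k : ℕ} (h : n + 1 < k) (hk : k < N) :
    Commute (e k) (decProd e n j) := by
  induction n with
  | zero =>
    unfold decProd
    split
    · exact H.commute_gen (by omega) hk (by omega)
    · exact Commute.one_right _
  | succ n ih =>
    unfold decProd
    split
    · exact (H.commute_gen (by omega) hk (by omega)).mul_right (ih (by omega))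
    · exact Commute.one_right _

lemma commute_decProd_decProd (H : IsTLB N δ e) {n k l j : ℕ} (h : l + 1 < k) (hn : n < N) :
    Commute (decProd e l j) (decProd e n k) := by
  induction n with
  | zero => rw [decProd_of_lt e (by omega : 0 < k)]; exact Commute.one_right _
  | succ n ih =>
    rcases Nat.lt_or_ge (n + 1) k with h' | h'
    · rw [decProd_of_lt e h']; exact Commute.one_right _
    · rw [decProd_succ e h']
      exact (H.commute_decProd_of_gt (by omega) hn).symm.mul_right (ih (by omega))

lemma decProd_mul_self (H : IsTLB N δ e) {n j : ℕ} (hj : j ≤ n) (hn : n < N) :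
    decProd e n j * e j = δ • decProd e n j := by
  rw [← decProd_succ_mul e hj, mul_assoc, H.idem j (by omega), mul_smul_comm]

lemma decProd_mul_succ (H : IsTLB N δ e) {n j : ℕ} (hj1 : 1 ≤ j) (hj : j + 1 ≤ n) (hn : n < N) :
    decProd e n j * e (j + 1) = decProd e n (j + 1) := by
  rw [← decProd_succ_mul e (by omega : j ≤ n), ← decProd_succ_mul e hj, mul_assoc, mul_assoc,
    ← mul_assoc (e (j + 1)), H.down j hj1 (by omega)]

lemma decProd_mul_of_lt (H : IsTLB N δ e) {n j k : ℕ} (hj : j ≤ k + 1) (hk : k + 2 ≤ n)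
    (hn : n < N) :
    decProd e n j * e (k + 2) = decProd e k j * decProd e n (k + 2) := by
  rw [← decProd_mul_eq e hj (by omega : k ≤ n), mul_assoc,
    ← (H.commute_decProd_of_gt (by omega : k + 1 < k + 2) (by omega)).eq, ← mul_assoc,
    H.decProd_mul_succ (by omega) hk hn, (H.commute_decProd_decProd (by omega) hn).eq]

lemma gen_mul_decProd (H : IsTLB N δ e) {n j l : ℕ} (hj : j ≤ l) (hl : 1 ≤ l) (hln : l < n)
    (hn : n < N) :
    e l * decProd e n j = decProd e l j * decProd e n (l + 2) := by
  obtain ⟨l, rfl⟩ : ∃ l', l = l' + 1 := ⟨l - 1, by omega⟩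
  rw [← decProd_mul_eq e (by omega : j ≤ l + 2 + 1) (by omega : l + 2 ≤ n), ← mul_assoc,
    (H.commute_decProd_of_lt (by omega : l + 1 + 1 < l + 2 + 1) hn).eq, mul_assoc,
    decProd_succ e (by omega : j ≤ l + 1 + 1), decProd_succ e (by omega : j ≤ l + 1),
    ← mul_assoc (e (l + 1 + 1)), ← mul_assoc (e (l + 1)), ← mul_assoc (e (l + 1)),
    H.up (l + 1) hl (by omega), ← decProd_succ e (by omega : j ≤ l + 1),
    (H.commute_decProd_decProd (by omega : l + 1 + 1 < l + 2 + 1) hn).eq]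

end IsTLB

/-- The span of the `a * decProd e n j` with `a` in `initAlg e n` and `1 ≤ j ≤ n + 1`. -/
def posSpan (e : ℕ → R) (n : ℕ) : Submodule ℂ R :=
  Submodule.span ℂ {x | ∃ a ∈ initAlg e n, ∃ j, 1 ≤ j ∧ j ≤ n + 1 ∧ x = a * decProd e n j}

/-- The span of the `a * decProd e n j` with `a` in `initAlg e n` and `0 ≤ j ≤ n + 1`, and of the
`bounceProd e n j` with `1 ≤ j ≤ n`. -/
def fullSpan (e : ℕ → R) (n : ℕ) : Submodule ℂ R :=
  Submodule.span ℂ {x | (∃ a ∈ initAlg e n, ∃ j, j ≤ n + 1 ∧ x = a * decProd e n j) ∨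
    ∃ j, 1 ≤ j ∧ j ≤ n ∧ x = bounceProd e n j}

lemma posSpan_le_fullSpan (e : ℕ → R) (n : ℕ) : posSpan e n ≤ fullSpan e n := by
  refine Submodule.span_mono ?_
  rintro x ⟨a, ha, j, -, hj, rfl⟩
  exact Or.inl ⟨a, ha, j, hj, rfl⟩

lemma mul_decProd_mem_posSpan {e : ℕ → R} {n j : ℕ} {a : R} (ha : a ∈ initAlg e n) (h1 : 1 ≤ j)
    (hj : j ≤ n + 1) : a * decProd e n j ∈ posSpan e n :=
  Submodule.subset_span ⟨a, ha, j, h1, hj, rfl⟩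

lemma mul_decProd_mem_fullSpan {e : ℕ → R} {n j : ℕ} {a : R} (ha : a ∈ initAlg e n)
    (hj : j ≤ n + 1) : a * decProd e n j ∈ fullSpan e n :=
  Submodule.subset_span (Or.inl ⟨a, ha, j, hj, rfl⟩)

lemma bounceProd_mem_fullSpan {e : ℕ → R} {n j : ℕ} (hj : j ≤ n) :
    bounceProd e n j ∈ fullSpan e n := by
  rcases Nat.eq_zero_or_pos j with rfl | h
  · simpa [bounceProd, incProd] using
      mul_decProd_mem_fullSpan (one_mem (initAlg e n)) (Nat.zero_le (n + 1))
  · exact Submodule.subset_span (Or.inr ⟨j, h, hj, rfl⟩)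

lemma bounceProd_mem (e : ℕ → R) {n j m : ℕ} (hn : n < m) (hj : j < m) :
    bounceProd e n j ∈ initAlg e m := by
  induction j with
  | zero => simpa [bounceProd, incProd] using decProd_mem e hn
  | succ j ih => rw [bounceProd_succ]; exact mul_mem (ih (by omega)) (gen_mem_initAlg e hj)

lemma mul_mem_posSpan {e : ℕ → R} {n : ℕ} {a x : R} (ha : a ∈ initAlg e n)
    (hx : x ∈ posSpan e n) : a * x ∈ posSpan e n := by
  induction hx using Submodule.span_induction with
  | mem x hx =>
    obtain ⟨b, hb, j, h1, hj, rfl⟩ := hx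
    rw [← mul_assoc]
    exact mul_decProd_mem_posSpan (mul_mem ha hb) h1 hj
  | zero => simp
  | add x y _ _ hx hy => rw [mul_add]; exact add_mem hx hy
  | smul c x _ hx => rw [mul_smul_comm]; exact Submodule.smul_mem _ _ hx

namespace IsTLB

variable {N : ℕ} {δ : ℂ} {e : ℕ → R}

lemma mul_gen_mem_posSpan (H : IsTLB N δ e) {n k : ℕ} {x : R} (hn : n < N)
    (hx : x ∈ posSpan e n) (hk1 : 1 ≤ k) (hk : k ≤ n) : x * e k ∈ posSpan e n := by
  induction hx using Submodule.span_induction with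
  | mem x hx =>
    obtain ⟨a, ha, j, h1, hj, rfl⟩ := hx
    rw [mul_assoc]
    rcases lt_trichotomy k j with h | rfl | h
    · rcases Nat.lt_or_ge (k + 1) j with h' | h'
      · rw [← (H.commute_decProd_of_lt h' hn).eq, ← mul_assoc]
        exact mul_decProd_mem_posSpan (mul_mem ha (gen_mem_initAlg e (by omega))) h1 hj
      · obtain rfl : j = k + 1 := by omega
        rw [decProd_succ_mul e hk]
        exact mul_decProd_mem_posSpan ha hk1 (by omega)
    · rw [H.decProd_mul_self hk hn, mul_smul_comm]
      exact Submodule.smul_mem _ _ (mul_decProd_mem_posSpan ha h1 hj)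
    · rcases Nat.lt_or_ge (j + 1) k with h' | h'
      · obtain ⟨k, rfl⟩ : ∃ k', k = k' + 2 := ⟨k - 2, by omega⟩
        rw [H.decProd_mul_of_lt (by omega) hk hn, ← mul_assoc]
        exact mul_decProd_mem_posSpan (mul_mem ha (decProd_mem e (by omega))) hk1 (by omega)
      · obtain rfl : k = j + 1 := by omega
        rw [H.decProd_mul_succ h1 hk hn]
        exact mul_decProd_mem_posSpan ha hk1 (by omega)
  | zero => simp
  | add x y _ _ hx hy => rw [add_mul]; exact add_mem hx hy
  | smul c x _ hx => rw [smul_mul_assoc]; exact Submodule.smul_mem _ _ hx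

lemma mul_incProd_mem_posSpan (H : IsTLB N δ e) {n j : ℕ} {x : R} (hn : n < N)
    (hx : x ∈ posSpan e n) (hj : j ≤ n) : x * incProd e j ∈ posSpan e n := by
  induction j with
  | zero => simpa [incProd] using hx
  | succ j ih =>
    rw [incProd, ← mul_assoc]
    exact H.mul_gen_mem_posSpan hn (ih (by omega)) (by omega) hj

lemma commute_incProd (H : IsTLB N δ e) {j k : ℕ} (h : j + 1 < k) (hk : k < N) :
    Commute (e k) (incProd e j) := by
  induction j with
  | zero => exact Commute.one_right _
  | succ j ih =>
    exact (ih (by omega)).mul_right (H.commute_gen (by omega) hk (by omega))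

lemma bounceProd_mul_mem_posSpan (H : IsTLB N δ e) {n j k : ℕ} (h : j + 1 < k) (hk : k ≤ n)
    (hn : n < N) : bounceProd e n j * e k ∈ posSpan e n := by
  rw [bounceProd, mul_assoc, ← (H.commute_incProd h (by omega)).eq, ← mul_assoc]
  refine H.mul_incProd_mem_posSpan hn ?_ (by omega)
  obtain ⟨k, rfl⟩ : ∃ k', k = k' + 2 := ⟨k - 2, by omega⟩
  rw [H.decProd_mul_of_lt (by omega) hk hn]
  exact mul_decProd_mem_posSpan (decProd_mem e (by omega)) (by omega) (by omega)

lemma bounceProd_succ_mul (H : IsTLB N δ e) {n k : ℕ} (hk : k + 1 ≤ n) (hn : n < N) :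
    ∃ c : ℂ, bounceProd e n (k + 1) * e k = c • bounceProd e n k := by
  rcases k with - | k
  · refine ⟨2, ?_⟩
    have h := H.rel10 (by omega)
    rw [bounceProd_succ, bounceProd, incProd, mul_one, zero_add,
      ← decProd_succ_mul e (Nat.zero_le n), ← decProd_succ_mul e (by omega : 0 + 1 ≤ n), zero_add]
    simp only [mul_assoc] at h ⊢
    rw [h, mul_smul_comm]
  · refine ⟨1, ?_⟩
    rw [one_smul, bounceProd_succ, bounceProd_succ, mul_assoc, mul_assoc, ← mul_assoc (e (k + 1)),
      H.up (k + 1) (by omega) (by omega)]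

lemma bounceProd_mul_mem_posSpan_of_lt (H : IsTLB N δ e) {n j k : ℕ} (h : k + 1 < j) (hj : j ≤ n)
    (hn : n < N) : bounceProd e n j * e k ∈ posSpan e n := by
  induction j, h using Nat.le_induction with
  | base =>
    obtain ⟨c, hc⟩ := H.bounceProd_succ_mul (by omega : k + 1 ≤ n) hn
    rw [bounceProd_succ, mul_assoc, H.comm (k + 1 + 1) k (by omega) (by omega), ← mul_assoc, hc,
      smul_mul_assoc]
    exact Submodule.smul_mem _ _ (H.bounceProd_mul_mem_posSpan (by omega) hj hn)
  | succ j hkj ih =>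
    rw [bounceProd_succ, mul_assoc, H.comm (j + 1) k (by omega) (by omega), ← mul_assoc]
    exact H.mul_gen_mem_posSpan hn (ih (by omega)) (by omega) hj

lemma gen_mul_bounceProd_mem (H : IsTLB N δ e) {n j k : ℕ} (hj1 : 1 ≤ j) (hj : j ≤ n) (hk : k < n)
    (hn : n < N) : e k * bounceProd e n j ∈ posSpan e n := by
  rcases Nat.eq_zero_or_pos k with rfl | hk1
  · induction j, hj1 using Nat.le_induction with
    | base =>
      have key : e 0 * bounceProd e n 1 = (2 : ℂ) • (e 0 * decProd e n 1) := by
        have h := H.rel01 (by omega)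
        have hc := (H.commute_decProd_of_lt (by omega : 0 + 1 < 2) hn).eq
        have h1 : decProd e n 1 = decProd e n 2 * e 1 := (decProd_succ_mul e (by omega)).symm
        have h0 : decProd e n 0 = decProd e n 1 * e 0 := (decProd_succ_mul e (by omega)).symm
        rw [bounceProd_succ, bounceProd, incProd, mul_one, h0, h1]
        simp only [← mul_assoc]
        rw [hc]
        simp only [mul_assoc] at h ⊢
        rw [zero_add, h, mul_smul_comm]
      rw [key]
      exact Submodule.smul_mem _ _
        (mul_decProd_mem_posSpan (gen_mem_initAlg e hk) le_rfl (by omega))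
    | succ j hj1 ih =>
      rw [bounceProd_succ, ← mul_assoc]
      exact H.mul_gen_mem_posSpan hn (ih (by omega)) (by omega) hj
  · rw [bounceProd, ← mul_assoc, H.gen_mul_decProd (Nat.zero_le k) hk1 hk hn]
    exact H.mul_incProd_mem_posSpan hn
      (mul_decProd_mem_posSpan (decProd_mem e hk) (by omega) (by omega)) hj

lemma mul_bounceProd_mem (H : IsTLB N δ e) {n j : ℕ} {a : R} (ha : a ∈ initAlg e n) (hj1 : 1 ≤ j)
    (hj : j ≤ n) (hn : n < N) : a * bounceProd e n j ∈ fullSpan e n := by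
  suffices h : ∃ c : ℂ, a * bounceProd e n j - c • bounceProd e n j ∈ posSpan e n by
    obtain ⟨c, hc⟩ := h
    rw [← sub_add_cancel (a * bounceProd e n j) (c • bounceProd e n j)]
    exact add_mem (posSpan_le_fullSpan e n hc)
      (Submodule.smul_mem _ _ (bounceProd_mem_fullSpan hj))
  induction ha using Algebra.adjoin_induction with
  | mem x hx =>
    obtain ⟨k, hk, rfl⟩ := hx
    exact ⟨0, by simpa using H.gen_mul_bounceProd_mem hj1 hj hk hn⟩
  | algebraMap r => exact ⟨r, by simp [Algebra.smul_def]⟩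
  | add x y _ _ hx hy =>
    obtain ⟨c, hc⟩ := hx
    obtain ⟨d, hd⟩ := hy
    exact ⟨c + d, by convert add_mem hc hd using 1; rw [add_mul, add_smul]; abel⟩
  | mul x y hx' _ hx hy =>
    obtain ⟨c, hc⟩ := hx
    obtain ⟨d, hd⟩ := hy
    refine ⟨d * c, ?_⟩
    convert add_mem (mul_mem_posSpan hx' hd) (Submodule.smul_mem _ d hc) using 1
    rw [mul_sub, mul_smul_comm, smul_sub, mul_assoc, smul_smul]
    abel

lemma mul_gen_mem_fullSpan (H : IsTLB N δ e) {n k : ℕ} {x : R} (hn : n < N)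
    (hx : x ∈ fullSpan e n) (hk : k ≤ n) : x * e k ∈ fullSpan e n := by
  induction hx using Submodule.span_induction with
  | mem x hx =>
    rcases hx with ⟨a, ha, j, hj, rfl⟩ | ⟨j, h1, hj, rfl⟩
    · rcases Nat.eq_zero_or_pos j with rfl | hj1
      · rcases k with - | - | k
        · rw [mul_assoc, H.decProd_mul_self hk hn, mul_smul_comm]
          exact Submodule.smul_mem _ _ (mul_decProd_mem_fullSpan ha hj)
        · have := H.mul_bounceProd_mem ha le_rfl hk hn
          rwa [bounceProd_succ, bounceProd, incProd, mul_one, ← mul_assoc] at this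
        · rw [mul_assoc, H.decProd_mul_of_lt (by omega) hk hn, ← mul_assoc]
          exact mul_decProd_mem_fullSpan (mul_mem ha (decProd_mem e (by omega))) (by omega)
      · rcases Nat.eq_zero_or_pos k with rfl | hk1
        · rw [mul_assoc]
          rcases Nat.lt_or_ge 1 j with h' | h'
          · rw [← (H.commute_decProd_of_lt h' hn).eq, ← mul_assoc]
            exact mul_decProd_mem_fullSpan (mul_mem ha (gen_mem_initAlg e (by omega))) hj
          · obtain rfl : j = 0 + 1 := by omega
            rw [decProd_succ_mul e hk]
            exact mul_decProd_mem_fullSpan ha (by omega)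
        · exact posSpan_le_fullSpan e n
            (H.mul_gen_mem_posSpan hn (mul_decProd_mem_posSpan ha hj1 hj) hk1 hk)
    · rcases lt_trichotomy k j with h | rfl | h
      · rcases Nat.lt_or_ge (k + 1) j with h' | h'
        · exact posSpan_le_fullSpan e n (H.bounceProd_mul_mem_posSpan_of_lt h' hj hn)
        · obtain rfl : j = k + 1 := by omega
          obtain ⟨c, hc⟩ := H.bounceProd_succ_mul hj hn
          rw [hc]
          exact Submodule.smul_mem _ _ (bounceProd_mem_fullSpan hk)
      · obtain ⟨k, rfl⟩ : ∃ k', k = k' + 1 := ⟨k - 1, by omega⟩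
        rw [bounceProd_succ, mul_assoc, H.idem _ (by omega), mul_smul_comm, ← bounceProd_succ]
        exact Submodule.smul_mem _ _ (bounceProd_mem_fullSpan hk)
      · rcases Nat.lt_or_ge (j + 1) k with h' | h'
        · exact posSpan_le_fullSpan e n (H.bounceProd_mul_mem_posSpan h' hk hn)
        · obtain rfl : k = j + 1 := by omega
          rw [← bounceProd_succ]
          exact bounceProd_mem_fullSpan hk
  | zero => simp
  | add x y _ _ hx hy => rw [add_mul]; exact add_mem hx hy
  | smul c x _ hx => rw [smul_mul_assoc]; exact Submodule.smul_mem _ _ hx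

lemma initAlg_succ_le (H : IsTLB N δ e) {n : ℕ} (hn : n < N) :
    Subalgebra.toSubmodule (initAlg e (n + 1)) ≤ fullSpan e n := by
  have key : ∀ a ∈ initAlg e (n + 1), ∀ x ∈ fullSpan e n, x * a ∈ fullSpan e n := by
    intro a ha
    induction ha using Algebra.adjoin_induction with
    | mem y hy =>
      obtain ⟨k, hk, rfl⟩ := hy
      exact fun x hx => H.mul_gen_mem_fullSpan hn hx (Nat.lt_succ_iff.1 hk)
    | algebraMap r =>
      intro x hx
      rw [← Algebra.commutes, ← Algebra.smul_def]
      exact Submodule.smul_mem _ _ hx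
    | add a b _ _ ha hb => intro x hx; rw [mul_add]; exact add_mem (ha x hx) (hb x hx)
    | mul a b _ _ ha hb => intro x hx; rw [← mul_assoc]; exact hb _ (ha x hx)
  intro a ha
  have h1 : (1 : R) ∈ fullSpan e n := by
    have := mul_decProd_mem_fullSpan (one_mem (initAlg e n)) (le_refl (n + 1))
    rwa [decProd_of_lt e (Nat.lt_succ_self n), one_mul] at this
  simpa using key a ha 1 h1

end IsTLB

lemma normalMonomials_mem_initAlg (e : ℕ → R) (n m : ℕ) {x : R}
    (hx : x ∈ normalMonomials e n m) : x ∈ initAlg e n := by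
  classical
  induction n generalizing m x with
  | zero => simp only [normalMonomials, Finset.mem_singleton] at hx; subst hx; exact one_mem _
  | succ n ih =>
    rw [normalMonomials] at hx
    simp only [Finset.mem_union, Finset.mem_biUnion, Finset.mem_image, Finset.mem_range,
      Finset.mem_Ico] at hx
    rcases hx with (hx | ⟨j, -, y, hy, rfl⟩) | ⟨j, hj, rfl⟩
    · exact initAlg_mono e (Nat.le_succ n) (ih m hx)
    · exact mul_mem (initAlg_mono e (Nat.le_succ n) (ih _ hy)) (decProd_mem e (Nat.lt_succ_self n))
    · exact bounceProd_mem e (Nat.lt_succ_self n) (by omega)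

/-- The span of the elements `a * e l` with `a` in `initAlg e n` and `m ≤ l < n`. -/
def tailSpan (e : ℕ → R) (n m : ℕ) : Submodule ℂ R :=
  Submodule.span ℂ {x | ∃ a ∈ initAlg e n, ∃ l, m ≤ l ∧ l < n ∧ x = a * e l}

lemma mul_gen_mem_tailSpan {e : ℕ → R} {n m l : ℕ} {a : R} (ha : a ∈ initAlg e n) (hm : m ≤ l)
    (hl : l < n) : a * e l ∈ tailSpan e n m :=
  Submodule.subset_span ⟨a, ha, l, hm, hl, rfl⟩

lemma tailSpan_le_succ (e : ℕ → R) (n m : ℕ) : tailSpan e n m ≤ tailSpan e (n + 1) m := by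
  refine Submodule.span_mono ?_
  rintro x ⟨a, ha, l, h1, h2, rfl⟩
  exact ⟨a, initAlg_mono e (Nat.le_succ n) ha, l, h1, by omega, rfl⟩

namespace IsTLB

variable {N : ℕ} {δ : ℂ} {e : ℕ → R}

theorem initAlg_le_span_sup_tailSpan (H : IsTLB N δ e) {n m : ℕ} (hn : n ≤ N) (hm : 1 ≤ m) :
    Subalgebra.toSubmodule (initAlg e n) ≤
      Submodule.span ℂ (normalMonomials e n m : Set R) ⊔ tailSpan e n m := by
  induction n generalizing m with
  | zero =>
    intro x hx
    have : x ∈ (⊥ : Subalgebra ℂ R) := by simpa [initAlg] using hx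
    obtain ⟨c, rfl⟩ := Algebra.mem_bot.1 this
    refine Submodule.mem_sup_left ?_
    rw [Algebra.algebraMap_eq_smul_one]
    exact Submodule.smul_mem _ _ (Submodule.subset_span (by simp [normalMonomials]))
  | succ n ih =>
    have hnN : n < N := hn
    replace ih := fun {m : ℕ} (hm : 1 ≤ m) => ih (m := m) hnN.le hm
    set T := Submodule.span ℂ (normalMonomials e (n + 1) m : Set R) ⊔ tailSpan e (n + 1) m with hT
    have step : ∀ i j, j ≤ n + 1 → i + j = n + 1 → ∀ a ∈ initAlg e n, a * decProd e n j ∈ T := by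
      intro i
      induction i using Nat.strong_induction_on with
      | _ i IH =>
      intro j hj hij a ha
      rcases Nat.lt_or_ge n j with hnj | hjn
      · rw [decProd_of_lt e hnj, mul_one]
        refine (sup_le_sup (Submodule.span_mono fun x hx => ?_) (tailSpan_le_succ e n m))
          (ih hm ha)
        exact normalMonomials_subset e n m hx
      · obtain ⟨x, hx, y, hy, rfl⟩ := Submodule.mem_sup.1 (ih (le_max_right j 1) ha)
        rw [add_mul]
        clear ha
        refine add_mem ?_ ?_
        · induction hx using Submodule.span_induction with
          | mem x hx =>
            rcases Nat.lt_or_ge j m with hjm | hjm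
            · exact Submodule.mem_sup_left
                (Submodule.subset_span (mul_decProd_mem_normalMonomials e hjm hjn hx))
            · refine Submodule.mem_sup_right ?_
              rw [← decProd_succ_mul e hjn, ← mul_assoc]
              exact mul_gen_mem_tailSpan (mul_mem (initAlg_mono e (Nat.le_succ n)
                (normalMonomials_mem_initAlg e _ _ hx)) (decProd_mem e (Nat.lt_succ_self n))) hjm
                (by omega)
          | zero => simp
          | add x y _ _ hx hy => rw [add_mul]; exact add_mem hx hy
          | smul c x _ hx => rw [smul_mul_assoc]; exact Submodule.smul_mem _ _ hx
        · induction hy using Submodule.span_induction with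
          | mem y hy =>
            obtain ⟨b, hb, l, hl, hln, rfl⟩ := hy
            rw [mul_assoc, H.gen_mul_decProd (by omega) (by omega) hln hnN, ← mul_assoc]
            exact IH (i - (l + 2 - j)) (by omega) (l + 2) (by omega) (by omega) _
              (mul_mem hb (decProd_mem e hln))
          | zero => simp
          | add x y _ _ hx hy => rw [add_mul]; exact add_mem hx hy
          | smul c x _ hx => rw [smul_mul_assoc]; exact Submodule.smul_mem _ _ hx
    refine (H.initAlg_succ_le hnN).trans (Submodule.span_le.2 ?_)
    rintro x (⟨a, ha, j, hj, rfl⟩ | ⟨j, hj1, hj, rfl⟩)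
    · exact step (n + 1 - j) j hj (by omega) a ha
    · rcases Nat.lt_or_ge j m with hjm | hjm
      · exact Submodule.mem_sup_left
          (Submodule.subset_span (bounceProd_mem_normalMonomials e hj1 hjm hj))
      · refine Submodule.mem_sup_right ?_
        obtain ⟨j, rfl⟩ : ∃ j', j = j' + 1 := ⟨j - 1, by omega⟩
        rw [bounceProd_succ]
        exact mul_gen_mem_tailSpan (bounceProd_mem e (by omega) (by omega)) hjm (by omega)

theorem initAlg_le_span (H : IsTLB N δ e) (hN : 1 ≤ N) :
    Subalgebra.toSubmodule (initAlg e N) ≤ Submodule.span ℂ (normalMonomials e N N : Set R) := by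
  refine (H.initAlg_le_span_sup_tailSpan le_rfl hN).trans (sup_le le_rfl (Submodule.span_le.2 ?_))
  rintro x ⟨a, ha, l, h1, h2, rfl⟩
  omega

theorem finite_and_finrank_le (H : IsTLB N δ e) (hN : 1 ≤ N) (hgen : initAlg e N = ⊤) :
    FiniteDimensional ℂ R ∧ Module.finrank ℂ R ≤ monomialCount N N := by
  have htop : Submodule.span ℂ (normalMonomials e N N : Set R) = ⊤ := by
    rw [eq_top_iff, ← Algebra.top_toSubmodule, ← hgen]
    exact H.initAlg_le_span hN
  refine ⟨Module.Finite.of_fg_top ⟨_, htop⟩, ?_⟩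
  rw [← finrank_top, ← htop]
  exact (finrank_span_finset_le_card _).trans (card_normalMonomials_le e N N)

end IsTLB

end UpperBound

/-- A perfect matching of `ℕ` each of whose arcs may carry a dot. -/
@[ext]
structure DottedMatching where
  /-- The other end of the arc at a point. -/
  partner : ℕ → ℕ
  /-- Whether the arc at a point carries a dot. -/
  dot : ℕ → Bool
  partner_partner : ∀ a, partner (partner a) = a
  partner_ne : ∀ a, partner a ≠ a
  dot_partner : ∀ a, dot (partner a) = dot a

namespace DottedMatching

/-- Join the arcs at `x` and `y`, and connect `x` with `y` by an undotted arc. -/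
def cap (x y : ℕ) (h : x ≠ y) (d : DottedMatching) : DottedMatching where
  partner a :=
    if a = x then y else if a = y then x else
    if a = d.partner x then d.partner y else if a = d.partner y then d.partner x else d.partner a
  dot a :=
    if a = x ∨ a = y then false else
    if a = d.partner x ∨ a = d.partner y then d.dot x || d.dot y else d.dot a
  partner_partner a := by
    have := d.partner_partner
    have := d.partner_ne
    grind
  partner_ne a := by
    have := d.partner_partner
    have := d.partner_ne
    grind
  dot_partner a := by
    have := d.partner_partner
    have := d.partner_ne
    have := d.dot_partner
    grind

/-- The scalar by which `cap x y` is weighted. -/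
def capCoeff (δ : ℂ) (x y : ℕ) (d : DottedMatching) : ℂ :=
  if d.partner x = y then (if d.dot x then 2 else δ) else if d.dot x && d.dot y then δ else 1

/-- Put a dot on the arc at `x`. -/
def mark (x : ℕ) (d : DottedMatching) : DottedMatching where
  partner := d.partner
  dot a := if a = x ∨ a = d.partner x then true else d.dot a
  partner_partner := d.partner_partner
  partner_ne := d.partner_ne
  dot_partner a := by
    have := d.partner_partner
    have := d.dot_partner
    grind

/-- The scalar by which `mark x` is weighted. -/
def markCoeff (δ : ℂ) (x : ℕ) (d : DottedMatching) : ℂ := if d.dot x then δ else 1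

variable {x y z w : ℕ} (d : DottedMatching) (δ : ℂ)

lemma cap_cap_self (h : x ≠ y) : cap x y h (cap x y h d) = cap x y h d := by
  ext a <;> simp only [cap] <;> grind

lemma capCoeff_cap_self (h : x ≠ y) : capCoeff δ x y (cap x y h d) = δ := by
  simp [capCoeff, cap]

lemma cap_cap_cap (hxy : x ≠ y) (hyz : y ≠ z) (hxz : x ≠ z) :
    cap x y hxy (cap y z hyz (cap x y hxy d)) = cap x y hxy d := by
  have := d.partner_partner
  have := d.partner_ne
  have := d.dot_partner
  ext a <;> simp only [cap] <;> grind

lemma capCoeff_cap (hxy : x ≠ y) (hxz : x ≠ z) :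
    capCoeff δ y z (cap x y hxy d) = 1 := by
  simp [capCoeff, cap, hxz, hxy.symm]

lemma capCoeff_cap' (hxy : x ≠ y) (hyz : y ≠ z) (hxz : x ≠ z) :
    capCoeff δ x y (cap y z hyz d) = 1 := by
  have := d.partner_partner
  have := d.partner_ne
  have := d.dot_partner
  simp only [capCoeff, cap]
  grind

lemma cap_cap_cap' (hxy : x ≠ y) (hyz : y ≠ z) (hxz : x ≠ z) :
    cap y z hyz (cap x y hxy (cap y z hyz d)) = cap y z hyz d := by
  have := d.partner_partner
  have := d.partner_ne
  have := d.dot_partner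
  ext a <;> simp only [cap] <;> grind

lemma cap_cap_comm (hxy : x ≠ y) (hzw : z ≠ w) (hxz : x ≠ z) (hxw : x ≠ w) (hyz : y ≠ z)
    (hyw : y ≠ w) : cap x y hxy (cap z w hzw d) = cap z w hzw (cap x y hxy d) := by
  have := d.partner_partner
  have := d.partner_ne
  have := d.dot_partner
  ext a <;> simp only [cap, hxz, hxw, hyz, hyw, if_false, or_false] <;> grind (splits := 40)

lemma capCoeff_comm (hxy : x ≠ y) (hzw : z ≠ w) (hxz : x ≠ z) (hxw : x ≠ w) (hyz : y ≠ z)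
    (hyw : y ≠ w) : capCoeff δ z w d * capCoeff δ x y (cap z w hzw d) =
      capCoeff δ x y d * capCoeff δ z w (cap x y hxy d) := by
  have := d.partner_partner
  have := d.partner_ne
  have := d.dot_partner
  simp only [capCoeff, cap, hxz, hxw, hyz, hyw, hxz.symm, hxw.symm, hyz.symm, hyw.symm, if_false,
    or_false]
  grind (splits := 40)

lemma mark_mark_self : mark x (mark x d) = mark x d := by
  ext a <;> simp only [mark]
  grind

lemma markCoeff_mark_self : markCoeff δ x (mark x d) = δ := by
  simp [markCoeff, mark]

lemma mark_cap_comm (hzw : z ≠ w) (hxz : x ≠ z) (hxw : x ≠ w) :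
    mark x (cap z w hzw d) = cap z w hzw (mark x d) := by
  have := d.partner_partner
  have := d.partner_ne
  have := d.dot_partner
  ext a <;> simp only [cap, mark] <;> grind

lemma markCoeff_comm (hzw : z ≠ w) (hxz : x ≠ z) (hxw : x ≠ w) :
    capCoeff δ z w d * markCoeff δ x (cap z w hzw d) =
      markCoeff δ x d * capCoeff δ z w (mark x d) := by
  have := d.partner_partner
  have := d.partner_ne
  have := d.dot_partner
  simp only [cap, mark, capCoeff, markCoeff]
  grind

lemma cap_mark_cap (hxy : x ≠ y) : cap x y hxy (mark x (cap x y hxy d)) = cap x y hxy d := by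
  have := d.partner_partner
  have := d.partner_ne
  have := d.dot_partner
  ext a <;> simp only [cap, mark] <;> grind

lemma markCoeff_cap (hxy : x ≠ y) : markCoeff δ x (cap x y hxy d) = 1 := by
  simp [markCoeff, cap]

lemma capCoeff_mark_cap (hxy : x ≠ y) : capCoeff δ x y (mark x (cap x y hxy d)) = 2 := by
  simp [capCoeff, cap, mark]

end DottedMatching

namespace DottedMatching

variable {x y z : ℕ} {d : DottedMatching}

lemma cap_eq_self (h : x ≠ y) (hp : d.partner x = y) (hd : d.dot x = false) :
    cap x y h d = d := by
  have := d.partner_partner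
  have := d.dot_partner
  ext a <;> simp only [cap] <;> grind

lemma cap_cap_eq_self (hxy : x ≠ y) (hyz : y ≠ z) (hxz : x ≠ z) (hp : d.partner y = z)
    (hd : d.dot y = false) : cap y z hyz (cap x y hxy d) = d := by
  conv_lhs => rw [← cap_eq_self hyz hp hd]
  rw [cap_cap_cap' d hxy hyz hxz, cap_eq_self hyz hp hd]

lemma capCoeff_eq_one (δ : ℂ) (hxz : x ≠ z) (hp : d.partner y = z) (hd : d.dot y = false) :
    capCoeff δ x y d = 1 := by
  have := d.partner_partner
  simp only [capCoeff]
  grind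

lemma mark_injOn (x : ℕ) : Set.InjOn (mark x) {d | d.dot x = false} := by
  intro d hd d' hd' h
  have h1 : d.partner = d'.partner := by simpa only [mark] using congrArg DottedMatching.partner h
  have h2 := congrArg DottedMatching.dot h
  have := d.dot_partner x
  have := d'.dot_partner x
  ext a
  · rw [h1]
  · have h3 := congrFun h2 a
    simp only [mark] at h3
    grind

/-- The action of the `k`-th generator on matchings, up to scalars. The matching is thought of as
a diagram whose bottom points are the even numbers and whose top points are the odd ones. -/
def step : ℕ → DottedMatching → DottedMatching
  | 0 => mark 0
  | k + 1 => cap (2 * k) (2 * k + 2) (by omega)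

/-- The scalar that accompanies `step`. -/
def stepCoeff (δ : ℂ) : ℕ → DottedMatching → ℂ
  | 0 => markCoeff δ 0
  | k + 1 => capCoeff δ (2 * k) (2 * k + 2)

/-- The matching of the identity diagram. -/
def vertical : DottedMatching where
  partner a := if Even a then a + 1 else a - 1
  dot _ := false
  partner_partner a := by grind
  partner_ne a := by grind
  dot_partner _ := rfl

/-- Apply the generators `j + l`, …, `j + 1`, `j` successively. -/
def descend : ℕ → ℕ → DottedMatching → DottedMatching
  | j, 0, d => step j d
  | j, l + 1, d => step j (descend (j + 1) l d)

/-- The matchings which only involve the first `n` strands, and all of whose undotted cups between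
neighbouring bottom points lie to the left of the `m`-th bottom point. -/
structure IsNormal (n m : ℕ) (d : DottedMatching) : Prop where
  partner_even : ∀ k, n ≤ k → d.partner (2 * k) = 2 * k + 1
  dot_even : ∀ k, n ≤ k → d.dot (2 * k) = false
  dot_cup : ∀ k, m ≤ k + 1 → d.partner (2 * k) = 2 * k + 2 → d.dot (2 * k) = true

lemma IsNormal.mono {n m n' m' : ℕ} (h : IsNormal n m d) (hn : n ≤ n') (hm : m ≤ m') :
    IsNormal n' m' d :=
  ⟨fun k hk ↦ h.1 k (hn.trans hk), fun k hk ↦ h.2 k (hn.trans hk),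
    fun k hk ↦ h.3 k (hm.trans hk)⟩

lemma isNormal_vertical (n m : ℕ) : IsNormal n m vertical := by
  constructor <;> intro k _ <;> simp [vertical]

/-- The shape of a matching obtained from an `m`-normal one by applying the generators
`n`, …, `j + 1`. -/
structure IsDescent (n m j : ℕ) (d : DottedMatching) : Prop where
  partner_even : ∀ k, n + 1 ≤ k → d.partner (2 * k) = 2 * k + 1
  dot_even : ∀ k, n + 1 ≤ k → d.dot (2 * k) = false
  partner_cup : d.partner (2 * j) = 2 * j + 2
  dot_cup : d.dot (2 * j) = false
  dot_right : ∀ k, j + 1 ≤ k → d.partner (2 * k) = 2 * k + 2 → d.dot (2 * k) = true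
  dot_last : d.partner (2 * n) = 2 * n + 1 → d.dot (2 * n) = true
  dot_left : ∀ k, m ≤ k + 1 → k + 1 < j → d.partner (2 * k) = 2 * k + 2 → d.dot (2 * k) = true
  dot_middle : ∀ k, m ≤ k + 1 → k + 1 = j →
    d.partner (2 * k) = (if n = j + 1 then 2 * n + 1 else 2 * j + 4) → d.dot (2 * k) = true

lemma IsNormal.isDescent {m j : ℕ} (h : IsNormal (j + 1) m d) (_ : m ≤ j + 1) :
    IsDescent (j + 1) m j (step (j + 1) d) := by
  obtain ⟨h1, h2, h3⟩ := h
  have e1 := h1 (j + 1) le_rfl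
  have e2 := h2 (j + 1) le_rfl
  have e3 := d.partner_partner
  have e4 := d.dot_partner
  constructor <;> simp only [step, cap]
  all_goals grind

lemma IsDescent.step {n m j : ℕ} (h : IsDescent n m (j + 1) d) (hn : j + 1 < n) (hm : m ≤ j + 1) :
    IsDescent n m j (step (j + 1) d) := by
  obtain ⟨h1, h2, h3, h4, h5, h6, h7, h8⟩ := h
  have e3 := d.partner_partner
  have e4 := d.dot_partner
  constructor <;> simp only [DottedMatching.step, cap]
  case dot_right =>
    intro k hk
    have := h1 (j + 3)
    have := e3 (2 * j)
    have := h8 j hm rfl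
    grind
  all_goals grind

lemma stepCoeff_eq_one (δ : ℂ) {j z : ℕ} (hz : 2 * j < z) (hp : d.partner (2 * j) = z)
    (hd : d.dot (2 * j) = false) : stepCoeff δ j d = 1 := by
  cases j with
  | zero => simp_all [stepCoeff, markCoeff]
  | succ j => exact capCoeff_eq_one δ (by omega) hp hd

lemma step_injOn {j z : ℕ} (hz : 2 * j < z) :
    Set.InjOn (step j) {d | d.partner (2 * j) = z ∧ d.dot (2 * j) = false} := by
  cases j with
  | zero => exact (mark_injOn 0).mono fun d hd ↦ hd.2
  | succ j =>
    refine Set.LeftInvOn.injOn (f₁' := cap (2 * j + 2) z (by omega)) fun d hd ↦ ?_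
    exact cap_cap_eq_self (by omega) (by omega) (by omega) hd.1 hd.2

lemma descend_succ_eq (j l : ℕ) (d : DottedMatching) :
    ∃ d', descend (j + 1) l d = step (j + 1) d' := by
  cases l <;> exact ⟨_, rfl⟩

lemma partner_step_succ (j : ℕ) : (step (j + 1) d).partner (2 * j) = 2 * j + 2 := by
  simp [step, cap]

lemma dot_step_succ (j : ℕ) : (step (j + 1) d).dot (2 * j) = false := by
  simp [step, cap]

lemma partner_descend_succ (j l : ℕ) : (descend (j + 1) l d).partner (2 * j) = 2 * j + 2 := by
  obtain ⟨d', h⟩ := descend_succ_eq j l d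
  rw [h, partner_step_succ]

lemma dot_descend_succ (j l : ℕ) : (descend (j + 1) l d).dot (2 * j) = false := by
  obtain ⟨d', h⟩ := descend_succ_eq j l d
  rw [h, dot_step_succ]

lemma descend_induction (δ : ℂ) {P : DottedMatching → Prop} {j l : ℕ}
    (hp : d.partner (2 * (j + l)) = 2 * (j + l) + 1) (hd : d.dot (2 * (j + l)) = false) (h : P d)
    (hstep : ∀ k d, j ≤ k → k ≤ j + l → stepCoeff δ k d = 1 → P d → P (step k d)) :
    P (descend j l d) := by
  induction l generalizing j with
  | zero => exact hstep _ _ le_rfl le_rfl (stepCoeff_eq_one δ (by omega) hp hd) h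
  | succ l ih =>
    rw [show j + (l + 1) = j + 1 + l by ring] at *
    exact hstep _ _ le_rfl (by omega)
      (stepCoeff_eq_one δ (by omega) (partner_descend_succ j l) (dot_descend_succ j l))
      (ih hp hd fun k d hk ↦ hstep k d (by omega))

lemma descend_injOn (j l : ℕ) : Set.InjOn (descend j l)
    {d | d.partner (2 * (j + l)) = 2 * (j + l) + 1 ∧ d.dot (2 * (j + l)) = false} := by
  induction l generalizing j with
  | zero => exact step_injOn (by omega)
  | succ l ih =>
    refine (step_injOn (z := 2 * j + 2) (by omega)).comp ?_ fun d _ ↦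
      ⟨partner_descend_succ j l, dot_descend_succ j l⟩
    rw [show j + (l + 1) = j + 1 + l by ring]
    exact ih (j + 1)

lemma IsNormal.isDescent_descend {m j l : ℕ} (hm : m ≤ j + 1) (h : IsNormal (j + 1 + l) m d) :
    IsDescent (j + 1 + l) m j (descend (j + 1) l d) := by
  induction l generalizing j with
  | zero => exact h.isDescent hm
  | succ l ih =>
    rw [show j + 1 + (l + 1) = j + 1 + 1 + l by ring] at *
    exact (ih (by omega) h).step (by omega) hm

lemma IsNormal.descend {j l : ℕ} (h : IsNormal (j + l) (max j 1) d) :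
    IsNormal (j + l + 1) (j + 1) (descend j l d) ∧
      ((descend j l d).partner (2 * (j + l)) = 2 * (j + l) + 1 →
        (descend j l d).dot (2 * (j + l)) = true) := by
  cases j with
  | succ j =>
    have h' := h.isDescent_descend (show max (j + 1) 1 ≤ j + 1 by omega)
    exact ⟨⟨h'.1, h'.2, fun k hk ↦ h'.5 k (by omega)⟩, h'.6⟩
  | zero =>
    cases l with
    | zero =>
      obtain ⟨h1, h2, h3⟩ := h
      simp only [DottedMatching.descend, step]
      refine ⟨⟨fun k hk ↦ h1 k (by omega), fun k hk ↦ ?_, fun k hk hp ↦ ?_⟩, ?_⟩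
      · have := h1 0
        have := h2 k
        simp only [mark]
        grind
      · have := h1 k
        simp only [mark] at hp
        grind
      · simp [mark]
    | succ l =>
      rw [show 0 + (l + 1) = 0 + 1 + l by ring] at *
      have h' := h.isDescent_descend (show max 0 1 ≤ 0 + 1 by omega)
      obtain ⟨h1, h2, h3, h4, h5, h6, -, -⟩ := h'
      simp only [DottedMatching.descend, step]
      generalize DottedMatching.descend (0 + 1) l d = e at *
      have e4 := e.dot_partner
      have e5 := e.partner_partner
      refine ⟨⟨fun k hk ↦ h1 k (by omega), fun k hk ↦ ?_, fun k hk hp ↦ ?_⟩, ?_⟩ <;>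
        simp only [mark] at * <;> grind

end DottedMatching

/-- The number of normal matchings on `n` strands that are built from products of the generators
which descend to an index at least `s`. -/
def matchingCount (s : ℕ) : ℕ → ℕ → ℕ
  | 0, _ => 1
  | n + 1, m => matchingCount s n m +
      ∑ j ∈ Finset.Ico s (min m (n + 1)), matchingCount s n (max j 1)

namespace DottedMatching

lemma exists_finset_isNormal {s N : ℕ} {P : DottedMatching → Prop} (hv : P vertical)
    (hP : ∀ j l d, s ≤ j → j + l < N → IsNormal (j + l) (max j 1) d → P d → P (descend j l d))
    {n m : ℕ} (hn : n ≤ N) (hm : 1 ≤ m) :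
    ∃ S : Finset DottedMatching, S.card = matchingCount s n m ∧ ∀ d ∈ S, IsNormal n m d ∧ P d := by
  classical
  induction n generalizing m with
  | zero => exact ⟨{vertical}, rfl, by simp [isNormal_vertical, hv]⟩
  | succ n ih =>
    obtain ⟨S, hS, hSP⟩ := ih (by omega) hm
    choose F hF hFP using fun j ↦ ih (by omega) (le_max_right j 1)
    have key : ∀ j ∈ Finset.Ico s (min m (n + 1)), ∀ d ∈ F j,
        IsNormal (n + 1) (j + 1) (descend j (n - j) d) ∧
        ((descend j (n - j) d).partner (2 * n) = 2 * n + 1 →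
          (descend j (n - j) d).dot (2 * n) = true) ∧ P (descend j (n - j) d) := by
      intro j hj d hd
      obtain ⟨h1, h2⟩ := hFP j d hd
      have hj' := Finset.mem_Ico.1 hj
      obtain ⟨l, rfl⟩ : ∃ l, n = j + l := ⟨n - j, by omega⟩
      rw [Nat.add_sub_cancel_left]
      exact ⟨h1.descend.1, h1.descend.2, hP j l d hj'.1 (by omega) h1 h2⟩
    refine ⟨S ∪ (Finset.Ico s (min m (n + 1))).biUnion fun j ↦ (F j).image (descend j (n - j)),
      ?_, ?_⟩
    · rw [Finset.card_union_of_disjoint, hS, Finset.card_biUnion, matchingCount]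
      · congr 1
        refine Finset.sum_congr rfl fun j hj ↦ ?_
        rw [Finset.card_image_of_injOn, hF]
        refine (descend_injOn j (n - j)).mono fun d hd ↦ ?_
        have hj' := Finset.mem_Ico.1 hj
        rw [show j + (n - j) = n by omega]
        exact ⟨(hFP j d hd).1.1 n le_rfl, (hFP j d hd).1.2 n le_rfl⟩
      · have main : ∀ i ∈ Finset.Ico s (min m (n + 1)), ∀ j ∈ Finset.Ico s (min m (n + 1)),
            i < j → Disjoint ((F i).image (descend i (n - i)))
              ((F j).image (descend j (n - j))) := by
          intro i hi j hj hij
          obtain ⟨j, rfl⟩ : ∃ k, j = k + 1 := ⟨j - 1, by omega⟩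
          simp only [Finset.disjoint_left, Finset.mem_image, not_exists, not_and]
          rintro _ ⟨d, hd, rfl⟩ d' - h
          have h1 := (key i hi d hd).1.3 j (by omega)
          rw [← h, partner_descend_succ, dot_descend_succ] at h1
          simp at h1
        intro i hi j hj hij
        rcases hij.lt_or_gt with h | h
        · exact main i hi j hj h
        · exact (main j hj i hi h).symm
      · simp only [Finset.disjoint_left, Finset.mem_biUnion, Finset.mem_image, not_exists, not_and]
        rintro d hd j hj d' hd' rfl
        obtain ⟨⟨h1, h2, -⟩, -⟩ := hSP _ hd
        have h3 := (key j hj d' hd').2.1 (h1 n le_rfl)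
        simp [h2 n le_rfl] at h3
    · intro d hd
      simp only [Finset.mem_union, Finset.mem_biUnion, Finset.mem_image] at hd
      rcases hd with hd | ⟨j, hj, d, hd, rfl⟩
      · exact ⟨(hSP d hd).1.mono (by omega) le_rfl, (hSP d hd).2⟩
      · obtain ⟨h1, -, h3⟩ := key j hj d hd
        exact ⟨h1.mono le_rfl (by have := Finset.mem_Ico.1 hj; omega), h3⟩

end DottedMatching

/-- The linear endomorphism that sends each basis vector `a` to the `c a`-fold of `g a`. -/
noncomputable def weightedMap {α : Type*} (g : α → α) (c : α → ℂ) : Module.End ℂ (α →₀ ℂ) :=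
  Finsupp.linearCombination ℂ fun a ↦ Finsupp.single (g a) (c a)

section WeightedMap

variable {α : Type*} (g g' : α → α) (c c' : α → ℂ)

lemma weightedMap_single (a : α) :
    weightedMap g c (Finsupp.single a 1) = Finsupp.single (g a) (c a) := by
  simp [weightedMap]

lemma weightedMap_mul : weightedMap g c * weightedMap g' c' =
    weightedMap (fun a ↦ g (g' a)) fun a ↦ c' a * c (g' a) := by
  ext a : 3
  simp [weightedMap]

lemma smul_weightedMap (t : ℂ) : t • weightedMap g c = weightedMap g fun a ↦ t * c a := by
  ext a : 3
  simp [weightedMap]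

end WeightedMap

namespace DottedMatching

/-- The operators on formal linear combinations of matchings by which the generators act, where
the marking operator is scaled by `β`. -/
noncomputable def stepOp (β δ : ℂ) (k : ℕ) : Module.End ℂ (DottedMatching →₀ ℂ) :=
  (if k = 0 then β else 1) • weightedMap (step k) (stepCoeff δ k)

lemma isTLB_stepOp (N : ℕ) {β : ℂ} (hβ : β * β = β) (δ : ℂ) : IsTLB N δ (stepOp β δ) where
  idem i _ := by
    simp only [stepOp, smul_mul_smul_comm, smul_comm δ, weightedMap_mul]
    cases i with
    | zero =>
      simp only [if_true, hβ, smul_weightedMap, step, stepCoeff, mark_mark_self,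
        markCoeff_mark_self, mul_comm δ]
    | succ i =>
      simp only [smul_weightedMap, step, stepCoeff, cap_cap_self, capCoeff_cap_self, mul_comm δ]
      simp
  comm i j hij _ := by
    obtain ⟨i, rfl⟩ : ∃ k, i = k + 1 := ⟨i - 1, by omega⟩
    simp only [stepOp, smul_mul_smul_comm, weightedMap_mul]
    rw [mul_comm (ite _ _ _)]
    cases j with
    | zero =>
      congr 2
      · funext d
        exact (mark_cap_comm d (by omega) (by omega) (by omega)).symm
      · funext d
        exact (markCoeff_comm d δ (by omega) (by omega) (by omega)).symm
    | succ j =>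
      congr 2
      · funext d
        exact cap_cap_comm d (by omega) (by omega) (by omega) (by omega) (by omega) (by omega)
      · funext d
        exact capCoeff_comm d δ (by omega) (by omega) (by omega) (by omega) (by omega) (by omega)
  up i hi _ := by
    obtain ⟨i, rfl⟩ : ∃ k, i = k + 1 := ⟨i - 1, by omega⟩
    simp only [stepOp, weightedMap_mul, Nat.add_eq_zero_iff, one_ne_zero, and_false, if_false,
      one_smul]
    congr 1
    · funext d
      exact cap_cap_cap d (by omega) (by omega) (by omega)
    · funext d
      change capCoeff δ (2 * i) (2 * i + 2) d * (capCoeff δ (2 * i + 2) (2 * i + 4)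
        (cap (2 * i) (2 * i + 2) (by omega) d) * capCoeff δ (2 * i) (2 * i + 2)
        (cap (2 * i + 2) (2 * i + 4) (by omega) _)) = capCoeff δ (2 * i) (2 * i + 2) d
      rw [capCoeff_cap _ _ (by omega) (by omega),
        capCoeff_cap' _ _ (by omega) (by omega) (by omega), one_mul, mul_one]
  down i hi _ := by
    obtain ⟨i, rfl⟩ : ∃ k, i = k + 1 := ⟨i - 1, by omega⟩
    simp only [stepOp, weightedMap_mul, Nat.add_eq_zero_iff, one_ne_zero, and_false, if_false,
      one_smul]
    congr 1
    · funext d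
      exact cap_cap_cap' d (by omega) (by omega) (by omega)
    · funext d
      change capCoeff δ (2 * i + 2) (2 * i + 4) d * (capCoeff δ (2 * i) (2 * i + 2)
        (cap (2 * i + 2) (2 * i + 4) (by omega) d) * capCoeff δ (2 * i + 2) (2 * i + 4)
        (cap (2 * i) (2 * i + 2) (by omega) _)) = capCoeff δ (2 * i + 2) (2 * i + 4) d
      rw [capCoeff_cap' _ _ (by omega) (by omega) (by omega),
        capCoeff_cap _ _ (by omega) (by omega), one_mul, mul_one]
  rel01 _ := by
    simp only [stepOp, weightedMap_mul, one_ne_zero, if_false, if_true, mul_one, mul_zero, zero_add,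
      smul_weightedMap, step, stepCoeff, cap_mark_cap, markCoeff_cap, capCoeff_mark_cap]
    congr 1
    funext d
    linear_combination (2 * capCoeff δ 0 2 d) * hβ
  rel10 _ := by
    simp only [stepOp, weightedMap_mul, one_ne_zero, if_false, if_true, mul_one, one_mul, mul_zero,
      zero_add, smul_weightedMap, step, stepCoeff, cap_mark_cap, markCoeff_cap, capCoeff_mark_cap]
    congr 1
    funext d
    linear_combination (2 * markCoeff δ 0 d * capCoeff δ 0 2 (mark 0 d)) * hβ

end DottedMatching

namespace DottedMatching

variable {d : DottedMatching} {δ : ℂ} {N : ℕ}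

lemma stepOp_single (β : ℂ) (k : ℕ) (h : stepCoeff δ k d = 1) :
    stepOp β δ k (Finsupp.single d 1) =
      (if k = 0 then β else 1) • Finsupp.single (step k d) 1 := by
  rw [stepOp, LinearMap.smul_apply, weightedMap_single, h]

/-- A subspace of pairs of formal linear combinations of matchings is stable if it is stable under
the first `N` generators, of which the one with index zero acts by zero on second components. -/
def IsStable (N : ℕ) (δ : ℂ)
    (V : Submodule ℂ ((DottedMatching →₀ ℂ) × (DottedMatching →₀ ℂ))) : Prop :=
  ∀ k < N, ∀ v ∈ V, (stepOp 1 δ k v.1, stepOp 0 δ k v.2) ∈ V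

variable {V : Submodule ℂ ((DottedMatching →₀ ℂ) × (DottedMatching →₀ ℂ))}

lemma IsStable.single_single (hV : IsStable N δ V) {k : ℕ} (hk : k + 1 < N)
    (hd : stepCoeff δ (k + 1) d = 1)
    (h : (Finsupp.single d 1, Finsupp.single d 1) ∈ V) :
    (Finsupp.single (step (k + 1) d) 1, Finsupp.single (step (k + 1) d) 1) ∈ V := by
  have := hV (k + 1) hk _ h
  simpa [stepOp_single _ _ hd] using this

lemma IsStable.single_zero (hV : IsStable N δ V) {k : ℕ} (hk : k < N)
    (hd : stepCoeff δ k d = 1) (h : (Finsupp.single d 1, 0) ∈ V) :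
    (Finsupp.single (step k d) 1, 0) ∈ V := by
  have := hV k hk _ h
  simpa [stepOp_single _ _ hd] using this

lemma IsStable.mark_zero (hV : IsStable N δ V) (hN : 0 < N) (hd : stepCoeff δ 0 d = 1)
    (h : (Finsupp.single d 1, Finsupp.single d 1) ∈ V) :
    (Finsupp.single (step 0 d) 1, 0) ∈ V := by
  have := hV 0 hN _ h
  simpa [stepOp_single _ _ hd] using this

lemma IsStable.descend_single_single (hV : IsStable N δ V) {j l : ℕ} (hjl : j + 1 + l < N)
    (hp : d.partner (2 * (j + 1 + l)) = 2 * (j + 1 + l) + 1)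
    (hd : d.dot (2 * (j + 1 + l)) = false)
    (h : (Finsupp.single d 1, Finsupp.single d 1) ∈ V) :
    (Finsupp.single (descend (j + 1) l d) 1, Finsupp.single (descend (j + 1) l d) 1) ∈ V := by
  refine descend_induction δ hp hd
    (P := fun d ↦ (Finsupp.single d 1, Finsupp.single d 1) ∈ V) h fun k d hk hk' hd h ↦ ?_
  obtain ⟨k, rfl⟩ : ∃ i, k = i + 1 := ⟨k - 1, by omega⟩
  exact hV.single_single (by omega) hd h

lemma IsStable.descend_single_zero (hV : IsStable N δ V) {j l : ℕ} (hjl : j + l < N)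
    (hp : d.partner (2 * (j + l)) = 2 * (j + l) + 1) (hd : d.dot (2 * (j + l)) = false)
    (h : (Finsupp.single d 1, 0) ∈ V) : (Finsupp.single (descend j l d) 1, 0) ∈ V :=
  descend_induction δ hp hd (P := fun d ↦ (Finsupp.single d 1, 0) ∈ V) h
    fun _ _ _ _ hd h ↦ hV.single_zero (by omega) hd h

lemma IsStable.descend_vertical (hV : IsStable N δ V)
    (h : (Finsupp.single vertical 1, Finsupp.single vertical 1) ∈ V) {j l : ℕ} (hjl : j + l < N) :
    (Finsupp.single (descend j l vertical) 1, 0) ∈ V := by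
  have hver := isNormal_vertical 0 0
  induction j generalizing l with
  | zero =>
    cases l with
    | zero =>
      exact hV.mark_zero (by omega) (stepCoeff_eq_one δ (by omega) (hver.1 0 le_rfl)
        (hver.2 0 le_rfl)) h
    | succ l =>
      exact hV.mark_zero (by omega) (stepCoeff_eq_one δ (by omega)
        (partner_descend_succ 0 l) (dot_descend_succ 0 l))
        (hV.descend_single_single (by omega) (hver.1 _ (Nat.zero_le _))
        (hver.2 _ (Nat.zero_le _)) h)
  | succ j ih =>
    have h1 := hV (j + 1) (by omega) _ (ih (l := l + 1) (by omega))
    obtain ⟨d, hd⟩ := descend_succ_eq j l vertical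
    simp only [descend, hd] at h1 ⊢
    cases j with
    | zero =>
      simp only [stepOp, weightedMap_single, step, stepCoeff, LinearMap.smul_apply] at h1
      simp only [mul_zero, zero_add, cap_mark_cap, capCoeff_mark_cap] at h1
      have h2 := V.smul_mem (2⁻¹ : ℂ) h1
      simpa [step] using h2
    | succ j =>
      have h2 : stepCoeff δ (j + 1 + 1) (step (j + 1) (step (j + 1 + 1) d)) = 1 :=
        capCoeff_cap _ δ (by omega) (by omega)
      have h3 : step (j + 1 + 1) (step (j + 1) (step (j + 1 + 1) d)) = step (j + 1 + 1) d :=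
        cap_cap_cap' d (by omega) (by omega) (by omega)
      simpa [stepOp_single _ _ h2, h3] using h1

theorem IsStable.card_add_card_le [FiniteDimensional ℂ V] (hV : IsStable N δ V)
    (h : (Finsupp.single vertical 1, Finsupp.single vertical 1) ∈ V) (hN : 1 ≤ N) :
    matchingCount 0 N N + matchingCount 1 N N ≤ Module.finrank ℂ V + 1 := by
  classical
  obtain ⟨S, hS, hSP⟩ := exists_finset_isNormal (s := 0) (N := N) (m := N)
    (P := fun d ↦ d = vertical ∨ (Finsupp.single d 1, 0) ∈ V) (Or.inl rfl) (by
      rintro j l d - hjl hd (rfl | hd')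
      · exact Or.inr (hV.descend_vertical h hjl)
      · exact Or.inr (hV.descend_single_zero hjl (hd.1 _ le_rfl) (hd.2 _ le_rfl) hd')) le_rfl hN
  obtain ⟨T, hT, hTP⟩ := exists_finset_isNormal (s := 1) (N := N) (m := N)
    (P := fun d ↦ (Finsupp.single d 1, Finsupp.single d 1) ∈ V) h (by
      intro j l d hj hjl hd hd'
      obtain ⟨j, rfl⟩ : ∃ i, j = i + 1 := ⟨j - 1, by omega⟩
      exact hV.descend_single_single hjl (hd.1 _ le_rfl) (hd.2 _ le_rfl) hd') le_rfl hN
  have hlin : LinearIndependent ℂ (Sum.elim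
      (fun d : S.erase vertical ↦
        ((Finsupp.single d.1 1, 0) : (DottedMatching →₀ ℂ) × (DottedMatching →₀ ℂ)))
      (fun d : T ↦ (Finsupp.single d.1 1, Finsupp.single d.1 1))) := by
    refine LinearIndependent.of_comp (LinearMap.prod (LinearMap.fst ℂ _ _ - LinearMap.snd ℂ _ _)
      (LinearMap.snd ℂ _ _)) ?_
    have h0 : LinearIndependent ℂ fun d : DottedMatching ↦ Finsupp.single d (1 : ℂ) :=
      Finsupp.linearIndependent_single_one ℂ DottedMatching
    have h1 := linearIndependent_inl_union_inr'
      (h0.comp _ (Subtype.val_injective (p := (· ∈ S.erase vertical))))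
      (h0.comp _ (Subtype.val_injective (p := (· ∈ T))))
    convert h1 using 1
    ext x : 1
    cases x <;> simp
  have hmem : ∀ x, Sum.elim
      (fun d : S.erase vertical ↦
        ((Finsupp.single d.1 1, 0) : (DottedMatching →₀ ℂ) × (DottedMatching →₀ ℂ)))
      (fun d : T ↦ (Finsupp.single d.1 1, Finsupp.single d.1 1)) x ∈ V := by
    rintro (⟨d, hd⟩ | ⟨d, hd⟩)
    · exact (hSP d (Finset.mem_of_mem_erase hd)).2.resolve_left (Finset.ne_of_mem_erase hd)
    · exact (hTP d hd).2
  have hlin' : LinearIndependent ℂ fun x ↦ (⟨_, hmem x⟩ : V) :=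
    LinearIndependent.of_comp V.subtype hlin
  have := hlin'.fintype_card_le_finrank
  simp only [Fintype.card_sum, Fintype.card_coe] at this
  have := Finset.pred_card_le_card_erase (s := S) (a := vertical)
  omega

end DottedMatching

section Counting

lemma matchingCount_of_le (s : ℕ) {n m : ℕ} (h : n ≤ m) :
    matchingCount s n m = matchingCount s n n := by
  induction n generalizing m with
  | zero => rfl
  | succ n ih =>
    rw [matchingCount, matchingCount, ih (by omega : n ≤ m), ih (by omega : n ≤ n + 1),
      min_eq_right h, min_self]

lemma matchingCount_succ_succ {s n m : ℕ} (hs : s ≤ 1) (hm : m + 1 ≤ n) :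
    matchingCount s (n + 1) (m + 1 + 1) = matchingCount s (n + 1) (m + 1) +
      matchingCount s n (m + 1 + 1) := by
  rw [matchingCount, matchingCount, min_eq_left (by omega), min_eq_left (by omega),
    Finset.sum_Ico_succ_top (by omega), max_eq_left (by omega)]
  ring

lemma matchingCount_one_one (n : ℕ) : matchingCount 1 n 1 = 1 := by
  induction n with
  | zero => rfl
  | succ n ih => simp [matchingCount, ih]

lemma matchingCount_zero_one (n : ℕ) : matchingCount 0 n 1 = 2 ^ n := by
  induction n with
  | zero => rfl
  | succ n ih => simp [matchingCount, ih, pow_succ, mul_two]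

lemma monomialCount_succ (n : ℕ) {m : ℕ} (hm : 1 ≤ m) :
    monomialCount n m + 1 = matchingCount 0 n m + matchingCount 1 n m := by
  induction n generalizing m with
  | zero => rfl
  | succ n ih =>
    rw [monomialCount, matchingCount, matchingCount]
    obtain ⟨k, hk⟩ : ∃ k, min m (n + 1) = k + 1 := ⟨min m (n + 1) - 1, by omega⟩
    have h1 := Finset.sum_congr rfl fun j (_ : j ∈ Finset.range (k + 1)) ↦
      ih (le_max_right j 1)
    have h2 : ∑ j ∈ Finset.range (k + 1), matchingCount 1 n (max j 1) =
        1 + ∑ j ∈ Finset.Ico 1 (k + 1), matchingCount 1 n (max j 1) := by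
      rw [Finset.range_eq_Ico, Finset.sum_eq_sum_Ico_succ_bot (Nat.succ_pos k)]
      simp [matchingCount_one_one]
    rw [Finset.sum_add_distrib, Finset.sum_add_distrib, Finset.sum_const, Finset.card_range,
      smul_eq_mul, mul_one] at h1
    have := ih hm
    rw [hk, ← Finset.range_eq_Ico]
    omega

lemma matchingCount_one_add_choose {n k : ℕ} (hk : k ≤ n) :
    matchingCount 1 n (k + 1) + (n + k).choose (n + 1) = (n + k).choose n := by
  induction n generalizing k with
  | zero =>
    obtain rfl : k = 0 := by omega
    rfl
  | succ n ih =>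
    induction k with
    | zero => simp [matchingCount_one_one]
    | succ k ihk =>
      have h1 := ihk (by omega)
      have e1 := Nat.choose_succ_succ (n + 1 + k) n
      have e2 := Nat.choose_succ_succ (n + 1 + k) (n + 1)
      simp only [Nat.succ_eq_add_one] at e1 e2
      rw [← add_assoc (n + 1)]
      rcases (by omega : k + 1 ≤ n ∨ k = n) with h | rfl
      · have h2 := ih h
        rw [matchingCount_succ_succ le_rfl h]
        rw [show n + (k + 1) = n + 1 + k by ring] at h2
        omega
      · rw [matchingCount_of_le 1 (by omega)]
        have h3 := Nat.choose_symm_half k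
        rw [show 2 * k + 1 = k + 1 + k by ring] at h3
        omega

lemma sum_range_choose_succ (n k : ℕ) : ∑ i ∈ Finset.range (k + 1), (n + 1).choose i =
    ∑ i ∈ Finset.range (k + 1), n.choose i + ∑ i ∈ Finset.range k, n.choose i := by
  rw [Finset.sum_range_succ', Finset.sum_range_succ' (fun i ↦ n.choose i)]
  simp only [Nat.choose_succ_succ, Finset.sum_add_distrib, Nat.choose_zero_right,
    Nat.succ_eq_add_one]
  ring

lemma matchingCount_zero_add_sum {n k : ℕ} (hk : k ≤ n) :
    matchingCount 0 n (k + 1) + 2 * ∑ i ∈ Finset.range k, (n + k).choose i = 2 ^ (n + k) := by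
  induction n generalizing k with
  | zero =>
    obtain rfl : k = 0 := by omega
    rfl
  | succ n ih =>
    induction k with
    | zero => simp [matchingCount_zero_one]
    | succ k ihk =>
      have h1 := ihk (by omega)
      rw [← add_assoc (n + 1), sum_range_choose_succ, pow_succ]
      rcases (by omega : k + 1 ≤ n ∨ k = n) with h | rfl
      · have h2 := ih h
        rw [matchingCount_succ_succ zero_le_one h]
        rw [show n + (k + 1) = n + 1 + k by ring] at h2
        omega
      · rw [matchingCount_of_le 0 (by omega)]
        have h3 := Nat.sum_range_choose_halfway k
        rw [show 2 * k + 1 = k + 1 + k by ring] at h3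
        have h4 : 2 ^ (k + 1 + k) = 2 * 4 ^ k := by
          rw [show k + 1 + k = 2 * k + 1 by ring, pow_succ, pow_mul, mul_comm]
          norm_num
        omega

lemma matchingCount_zero_self (n : ℕ) : matchingCount 0 n n = (2 * n).choose n := by
  cases n with
  | zero => rfl
  | succ n =>
    have h1 := matchingCount_zero_add_sum (le_refl (n + 1))
    have h2 := Nat.sum_range_choose_halfway n
    have h3 := Nat.choose_symm_half n
    have h4 := Nat.choose_succ_succ (2 * n + 1) n
    rw [matchingCount_of_le 0 (by omega), show n + 1 + (n + 1) = 2 * n + 1 + 1 by ring,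
      sum_range_choose_succ, h2] at h1
    rw [Finset.sum_range_succ] at h2
    have h5 : 2 ^ (2 * n + 1 + 1) = 4 * 4 ^ n := by
      rw [pow_succ, pow_succ, pow_mul]
      norm_num
      ring
    rw [show 2 * (n + 1) = (2 * n + 1).succ by simp; ring, ← Nat.succ_eq_add_one n, h4]
    simp only [Nat.succ_eq_add_one]
    omega

lemma matchingCount_one_self (n : ℕ) : matchingCount 1 n n = catalanNum n ∧
    (n + 1) * catalanNum n = (2 * n).choose n := by
  have h1 := matchingCount_one_add_choose (le_refl n)
  rw [matchingCount_of_le 1 (by omega), ← two_mul] at h1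
  have h2 := Nat.choose_succ_right_eq (2 * n) n
  rw [show 2 * n - n = n by omega] at h2
  have h3 : (n + 1) * matchingCount 1 n n = (2 * n).choose n := by nlinarith
  have h4 : catalanNum n = matchingCount 1 n n := by
    rw [catalanNum, ← h3, Nat.mul_div_cancel_left _ n.succ_pos]
  exact ⟨h4.symm, h4 ▸ h3⟩

lemma monomialCount_self {n : ℕ} (hn : 1 ≤ n) :
    monomialCount n n = (n + 2) * catalanNum n - 1 := by
  have h1 := monomialCount_succ n hn
  obtain ⟨h2, h3⟩ := matchingCount_one_self n
  rw [matchingCount_zero_self, h2, ← h3] at h1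
  have : (n + 2) * catalanNum n = (n + 1) * catalanNum n + catalanNum n := by ring
  omega

end Counting

section Presentation

variable {n : ℕ} {δ : ℂ}

lemma isTLB_EgenB (n : ℕ) (δ : ℂ) : IsTLB n δ (EgenB n δ) where
  idem i h := by
    have := RingQuot.mkAlgHom_rel ℂ (TLBrel.idem (δ := δ) i h)
    simpa only [EgenB, h, dif_pos, map_mul, map_smul] using this
  comm i j hij h := by
    have := RingQuot.mkAlgHom_rel ℂ (TLBrel.comm (δ := δ) i j hij h)
    simpa only [EgenB, h, show j < n by omega, dif_pos, map_mul] using this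
  up i h1 h := by
    have := RingQuot.mkAlgHom_rel ℂ (TLBrel.untwist_up (δ := δ) i h1 h)
    simpa only [EgenB, h, show i < n by omega, dif_pos, map_mul] using this
  down i h1 h := by
    have := RingQuot.mkAlgHom_rel ℂ (TLBrel.untwist_down (δ := δ) i h1 h)
    simpa only [EgenB, h, show i < n by omega, dif_pos, map_mul] using this
  rel01 h := by
    have := RingQuot.mkAlgHom_rel ℂ (TLBrel.rel01 (δ := δ) h)
    simpa only [EgenB, h, show 0 < n by omega, dif_pos, map_mul, map_smul] using this
  rel10 h := by
    have := RingQuot.mkAlgHom_rel ℂ (TLBrel.rel10 (δ := δ) h)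
    simpa only [EgenB, h, show 0 < n by omega, dif_pos, map_mul, map_smul] using this

lemma initAlg_EgenB (n : ℕ) (δ : ℂ) : initAlg (EgenB n δ) n = ⊤ := by
  have h : EgenB n δ '' Set.Iio n =
      RingQuot.mkAlgHom ℂ (TLBrel n δ) '' Set.range (FreeAlgebra.ι ℂ) := by
    ext x
    simp only [Set.mem_image, Set.mem_Iio, Set.mem_range, exists_exists_eq_and]
    constructor
    · rintro ⟨k, hk, rfl⟩
      exact ⟨⟨k, hk⟩, by simp [EgenB, hk]⟩
    · rintro ⟨k, rfl⟩
      exact ⟨k, k.2, by simp [EgenB]⟩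
  rw [initAlg, h, ← AlgHom.map_adjoin, FreeAlgebra.adjoin_range_ι, Algebra.map_top,
    AlgHom.range_eq_top]
  exact RingQuot.mkAlgHom_surjective ℂ _

lemma IsTLB.exists_algHom {R : Type*} [Ring R] [Algebra ℂ R] {e : ℕ → R} (H : IsTLB n δ e) :
    ∃ φ : TLB n δ →ₐ[ℂ] R, ∀ k < n, φ (EgenB n δ k) = e k := by
  refine ⟨RingQuot.liftAlgHom ℂ ⟨FreeAlgebra.lift ℂ fun k : Fin n ↦ e k, ?_⟩, fun k hk ↦ ?_⟩
  · rintro _ _ (⟨i, h⟩ | ⟨i, j, hij, h⟩ | ⟨i, h1, h⟩ | ⟨i, h1, h⟩ | h | h) <;>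
      simp only [map_mul, map_smul, FreeAlgebra.lift_ι_apply]
    · exact H.idem i h
    · exact H.comm i j hij h
    · exact H.up i h1 h
    · exact H.down i h1 h
    · exact H.rel01 h
    · exact H.rel10 h
  · simp [EgenB, hk]

open DottedMatching in
theorem matchingCount_add_le_finrank (hn : 1 ≤ n) [FiniteDimensional ℂ (TLB n δ)] :
    matchingCount 0 n n + matchingCount 1 n n ≤ Module.finrank ℂ (TLB n δ) + 1 := by
  obtain ⟨φ, hφ⟩ := (isTLB_stepOp n (mul_one 1) δ).exists_algHom
  obtain ⟨ψ, hψ⟩ := (isTLB_stepOp n (mul_zero 0) δ).exists_algHom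
  let v : DottedMatching →₀ ℂ := Finsupp.single vertical 1
  let f : TLB n δ →ₗ[ℂ] (DottedMatching →₀ ℂ) × (DottedMatching →₀ ℂ) :=
    (LinearMap.applyₗ v ∘ₗ φ.toLinearMap).prod (LinearMap.applyₗ v ∘ₗ ψ.toLinearMap)
  have hf : ∀ a, f a = (φ a v, ψ a v) := fun a ↦ rfl
  have hstable : IsStable n δ (LinearMap.range f) := by
    rintro k hk _ ⟨a, rfl⟩
    refine ⟨EgenB n δ k * a, ?_⟩
    simp only [hf, map_mul, hφ k hk, hψ k hk, Module.End.mul_apply]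
  refine (hstable.card_add_card_le ⟨1, ?_⟩ hn).trans
    (Nat.add_le_add_right (LinearMap.finrank_range_le f) 1)
  simp only [hf, map_one, Module.End.one_apply, v]

end Presentation

/-- `𝒯(B_n)` is finite-dimensional over `ℂ` of dimension `(n+2)·C_n − 1`. -/
theorem finrank_TLB (n : ℕ) (hn : 2 ≤ n) (δ : ℂ) :
    FiniteDimensional ℂ (TLB n δ) ∧
      Module.finrank ℂ (TLB n δ) = (n + 2) * catalanNum n - 1 := by
  have hn' : 1 ≤ n := by omega
  obtain ⟨hfin, hle⟩ := (isTLB_EgenB n δ).finite_and_finrank_le hn' (initAlg_EgenB n δ)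
  refine ⟨hfin, ?_⟩
  have hge := matchingCount_add_le_finrank (δ := δ) hn'
  rw [← monomialCount_succ n hn'] at hge
  rw [← monomialCount_self hn']
  omega
end

section
/- In the Temperley–Lieb algebra 𝒯(B_n), for all integers i, j with i > j+1 ≥ 1 (so 2 ≤ i ≤ n−1 and 0 ≤ j ≤ i−2), the relation E_{i,0}E^{1,j}E_i = E_{i−2,0}E^{1,j}E_i holds. -/
theorem EgenB_commute (n : ℕ) (δ : ℂ) {i j : ℕ} (hij : j + 1 < i) :
    Commute (EgenB n δ i) (EgenB n δ j) := by
  by_cases hi : i < n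
  · have hj : j < n := by omega
    have h := RingQuot.mkAlgHom_rel ℂ (TLBrel.comm (δ := δ) i j hij hi)
    simpa [Commute, SemiconjBy, EgenB, hi, hj] using h
  · simp [EgenB, hi]

theorem EgenB_succ_mul_EgenB_mul_EgenB_succ (n : ℕ) (δ : ℂ) {i : ℕ} (h1 : 1 ≤ i) :
    EgenB n δ (i + 1) * EgenB n δ i * EgenB n δ (i + 1) = EgenB n δ (i + 1) := by
  by_cases hi : i + 1 < n
  · have hi' : i < n := by omega
    have h := RingQuot.mkAlgHom_rel ℂ (TLBrel.untwist_down (δ := δ) i h1 hi)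
    simpa [EgenB, hi, hi'] using h
  · simp [EgenB, hi]

theorem EdecB_succ (n : ℕ) (δ : ℂ) (i : ℕ) :
    EdecB n δ (i + 1) 0 = EgenB n δ (i + 1) * EdecB n δ i 0 := by
  simp [EdecB, List.range'_concat]

theorem EgenB_commute_EdecB (n : ℕ) (δ : ℂ) {i j k : ℕ} (h : j + 1 < i) :
    Commute (EgenB n δ i) (EdecB n δ j k) := by
  refine Commute.list_prod_right _ _ fun x hx => ?_
  obtain ⟨m, hm, rfl⟩ := List.mem_map.1 hx
  rw [List.mem_reverse, List.mem_range'_1] at hm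
  exact EgenB_commute n δ (by omega)

theorem EgenB_commute_EincB (n : ℕ) (δ : ℂ) {i j k : ℕ} (h : j + 1 < i) :
    Commute (EgenB n δ i) (EincB n δ k j) := by
  refine Commute.list_prod_right _ _ fun x hx => ?_
  obtain ⟨m, hm, rfl⟩ := List.mem_map.1 hx
  rw [List.mem_range'_1] at hm
  exact EgenB_commute n δ (by omega)

/-- In `𝒯(B_n)`, for `i > j+1 ≥ 1`, `E_{i,0} E^{1,j} E_i = E_{i−2,0} E^{1,j} E_i`. -/
theorem TLB_lemma (n : ℕ) (hn : 2 ≤ n) (δ : ℂ) (i j : ℕ)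
    (hij : j + 1 < i) (hi : i ≤ n - 1) :
    EdecB n δ i 0 * EincB n δ 1 j * EgenB n δ i =
      EdecB n δ (i - 2) 0 * EincB n δ 1 j * EgenB n δ i := by
  obtain ⟨k, rfl⟩ : ∃ k, i = k + 1 + 1 := ⟨i - 2, by omega⟩
  have hc : Commute (EgenB n δ (k + 1 + 1)) (EdecB n δ k 0 * EincB n δ 1 j) :=
    (EgenB_commute_EdecB n δ (by omega)).mul_right (EgenB_commute_EincB n δ hij)
  rw [EdecB_succ, EdecB_succ, show k + 1 + 1 - 2 = k by omega]
  calc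
    _ = EgenB n δ (k + 1 + 1) * EgenB n δ (k + 1) *
        ((EdecB n δ k 0 * EincB n δ 1 j) * EgenB n δ (k + 1 + 1)) := by
      simp only [mul_assoc]
    _ = EgenB n δ (k + 1 + 1) * (EdecB n δ k 0 * EincB n δ 1 j) := by
      rw [← hc.eq, ← mul_assoc, EgenB_succ_mul_EgenB_mul_EgenB_succ n δ (by omega)]
    _ = _ := hc.eq
end

section
/- For every integer n ≥ 1, the number of pairs of strictly increasing integer sequences ((i_1,…,i_p), (j_1,…,j_p)) of common length p with 0 ≤ p ≤ n−1, entries 1 ≤ i_1 < ⋯ < i_p ≤ n−1 and 1 ≤ j_1 < ⋯ < j_p ≤ n−1, satisfying i_m ≥ j_m for all 1 ≤ m ≤ p, equals the Catalan number C_n = binom(2n,n)/(n+1). -/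
/-- The list `l` is strictly increasing with entries in `(a, a + N]`. -/
def IsIncreasingIn (a N : ℕ) (l : List ℕ) : Prop :=
  l.Pairwise (· < ·) ∧ ∀ x ∈ l, a < x ∧ x ≤ a + N

theorem isIncreasingIn_zero {a : ℕ} {l : List ℕ} : IsIncreasingIn a 0 l ↔ l = [] := by
  constructor
  · rintro ⟨-, h⟩
    refine List.eq_nil_iff_forall_not_mem.2 fun x hx => ?_
    have := h x hx
    omega
  · rintro rfl
    simp [IsIncreasingIn]

theorem isIncreasingIn_succ {a N : ℕ} {l : List ℕ} :
    IsIncreasingIn a (N + 1) l ↔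
      IsIncreasingIn (a + 1) N l ∨ ∃ l', l = (a + 1) :: l' ∧ IsIncreasingIn (a + 1) N l' := by
  constructor
  · rintro ⟨hp, hb⟩
    rcases l with _ | ⟨b, l⟩
    · simp [IsIncreasingIn]
    · rw [List.pairwise_cons] at hp
      have hbb := hb b (by simp)
      rcases eq_or_ne b (a + 1) with rfl | hne
      · refine Or.inr ⟨l, rfl, hp.2, fun x hx => ⟨hp.1 x hx, ?_⟩⟩
        have := hb x (by simp [hx])
        omega
      · refine Or.inl ⟨List.pairwise_cons.2 hp, fun x hx => ?_⟩
        have hxb := hb x hx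
        rcases List.mem_cons.1 hx with rfl | hx
        · omega
        · have := hp.1 x hx
          omega
  · rintro (⟨hp, hb⟩ | ⟨l, rfl, hp, hb⟩)
    · refine ⟨hp, fun x hx => ?_⟩
      have := hb x hx
      omega
    · refine ⟨List.pairwise_cons.2 ⟨fun x hx => (hb x hx).1, hp⟩, fun x hx => ?_⟩
      rcases List.mem_cons.1 hx with rfl | hx
      · omega
      · have := hb x hx
        omega

theorem IsIncreasingIn.lt_of_getElem? {a N m x : ℕ} {l : List ℕ} (h : IsIncreasingIn a N l)
    (hx : l[m]? = some x) : a < x :=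
  (h.2 x (List.mem_of_getElem? hx)).1

theorem IsIncreasingIn.cons_ne {a N : ℕ} {l : List ℕ} (l' : List ℕ) (h : IsIncreasingIn a N l) :
    a :: l' ≠ l := by
  rintro rfl
  exact absurd (h.2 a (by simp)).1 (lt_irrefl a)

theorem IsIncreasingIn.length_le {a N : ℕ} {l : List ℕ} (h : IsIncreasingIn a N l) :
    l.length ≤ N := by
  induction N generalizing a l with
  | zero => simp [isIncreasingIn_zero.1 h]
  | succ N ih =>
    rcases isIncreasingIn_succ.1 h with hl | ⟨l, rfl, hl⟩
    · exact (ih hl).trans N.le_succ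
    · exact Nat.succ_le_succ (ih hl)

/-- The first list is `h` entries longer than the second, and dominates it entrywise
after its first `h` entries are dropped. -/
def Dominates (h : ℕ) (s : List ℕ × List ℕ) : Prop :=
  s.1.length = s.2.length + h ∧
    ∀ m x y, s.2[m]? = some y → s.1[m + h]? = some x → y ≤ x

theorem dominates_cons_cons {a N h : ℕ} {i j : List ℕ} (hi : IsIncreasingIn a N i) :
    Dominates h (a :: i, a :: j) ↔ Dominates h (i, j) := by
  refine and_congr (by simp; omega)
    ⟨fun H m x y hy hx => H (m + 1) x y ?_ ?_, fun H m x y hy hx => ?_⟩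
  · simpa using hy
  · simpa [Nat.add_right_comm m 1 h] using hx
  · rcases m with _ | m
    · obtain rfl : a = y := by simpa using hy
      rcases List.mem_cons.1 (List.mem_of_getElem? hx) with rfl | hx
      · exact le_rfl
      · exact (hi.2 x hx).1.le
    · rw [Nat.add_right_comm] at hx
      exact H m x y (by simpa using hy) (by simpa using hx)

theorem dominates_cons_right {a N h : ℕ} {i j : List ℕ} (hi : IsIncreasingIn a N i) :
    Dominates h (i, a :: j) ↔ Dominates (h + 1) (i, j) := by
  refine and_congr (by simp; omega)
    ⟨fun H m x y hy hx => H (m + 1) x y ?_ ?_, fun H m x y hy hx => ?_⟩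
  · simpa using hy
  · rwa [Nat.add_right_comm]
  · rcases m with _ | m
    · obtain rfl : a = y := by simpa using hy
      exact (hi.lt_of_getElem? hx).le
    · rw [Nat.add_right_comm] at hx
      exact H m x y (by simpa using hy) hx

theorem dominates_succ_cons_left {a h : ℕ} {i j : List ℕ} :
    Dominates (h + 1) (a :: i, j) ↔ Dominates h (i, j) := by
  refine and_congr (by simp; omega) ?_
  simp [← Nat.add_assoc]

theorem not_dominates_zero_cons_left {a N : ℕ} {i j : List ℕ} (hj : IsIncreasingIn a N j) :
    ¬ Dominates 0 (a :: i, j) := by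
  rintro ⟨hl, H⟩
  rcases j with _ | ⟨b, j⟩
  · simp at hl
  · have h₁ := H 0 a b (by simp) (by simp)
    have h₂ := (hj.2 b (by simp)).1
    omega

/-- The pairs of increasing lists with entries in `(a, a + N]` satisfying `Dominates h`,
generated by deciding which of the two lists contain the value `a + 1`. -/
def dominatingPairs : ℕ → ℕ → ℕ → Finset (List ℕ × List ℕ)
  | _, 0, 0 => {([], [])}
  | _, 0, _ + 1 => ∅
  | a, N + 1, 0 =>
    dominatingPairs (a + 1) N 0 ∪
      (dominatingPairs (a + 1) N 0).image (Prod.map (List.cons (a + 1)) (List.cons (a + 1))) ∪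
      (dominatingPairs (a + 1) N 1).image (Prod.map id (List.cons (a + 1)))
  | a, N + 1, h + 1 =>
    dominatingPairs (a + 1) N (h + 1) ∪
      (dominatingPairs (a + 1) N (h + 1)).image
        (Prod.map (List.cons (a + 1)) (List.cons (a + 1))) ∪
      (dominatingPairs (a + 1) N (h + 2)).image (Prod.map id (List.cons (a + 1))) ∪
      (dominatingPairs (a + 1) N h).image (Prod.map (List.cons (a + 1)) id)

theorem mem_dominatingPairs {a N h : ℕ} {i j : List ℕ} :
    (i, j) ∈ dominatingPairs a N h ↔
      IsIncreasingIn a N i ∧ IsIncreasingIn a N j ∧ Dominates h (i, j) := by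
  induction N generalizing a h i j with
  | zero =>
    rw [isIncreasingIn_zero, isIncreasingIn_zero]
    rcases h with _ | h
    · simp only [dominatingPairs, Finset.mem_singleton, Prod.mk.injEq]
      constructor
      · rintro ⟨rfl, rfl⟩
        simp [Dominates]
      · tauto
    · simp only [dominatingPairs, Finset.notMem_empty, false_iff]
      rintro ⟨rfl, rfl, hl, -⟩
      simp at hl
  | succ N ih =>
    rw [isIncreasingIn_succ, isIncreasingIn_succ]
    rcases h with _ | h
    · simp only [dominatingPairs, Finset.mem_union, Finset.mem_image, Prod.exists, Prod.map_apply,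
        Prod.mk.injEq, ih, id]
      constructor
      · rintro ((⟨hi, hj, hd⟩ | ⟨i, j, ⟨hi, hj, hd⟩, rfl, rfl⟩) | ⟨i, j, ⟨hi, hj, hd⟩, rfl, rfl⟩)
        · exact ⟨Or.inl hi, Or.inl hj, hd⟩
        · exact ⟨Or.inr ⟨i, rfl, hi⟩, Or.inr ⟨j, rfl, hj⟩, (dominates_cons_cons hi).2 hd⟩
        · exact ⟨Or.inl hi, Or.inr ⟨j, rfl, hj⟩, (dominates_cons_right hi).2 hd⟩
      · rintro ⟨hi | ⟨i, rfl, hi⟩, hj | ⟨j, rfl, hj⟩, hd⟩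
        · exact Or.inl (Or.inl ⟨hi, hj, hd⟩)
        · exact Or.inr ⟨i, j, ⟨hi, hj, (dominates_cons_right hi).1 hd⟩, rfl, rfl⟩
        · exact absurd hd (not_dominates_zero_cons_left hj)
        · exact Or.inl (Or.inr ⟨i, j, ⟨hi, hj, (dominates_cons_cons hi).1 hd⟩, rfl, rfl⟩)
    · simp only [dominatingPairs, Finset.mem_union, Finset.mem_image, Prod.exists, Prod.map_apply,
        Prod.mk.injEq, ih, id]
      constructor
      · rintro (((⟨hi, hj, hd⟩ | ⟨i, j, ⟨hi, hj, hd⟩, rfl, rfl⟩) | ⟨i, j, ⟨hi, hj, hd⟩, rfl, rfl⟩) |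
          ⟨i, j, ⟨hi, hj, hd⟩, rfl, rfl⟩)
        · exact ⟨Or.inl hi, Or.inl hj, hd⟩
        · exact ⟨Or.inr ⟨i, rfl, hi⟩, Or.inr ⟨j, rfl, hj⟩, (dominates_cons_cons hi).2 hd⟩
        · exact ⟨Or.inl hi, Or.inr ⟨j, rfl, hj⟩, (dominates_cons_right hi).2 hd⟩
        · exact ⟨Or.inr ⟨i, rfl, hi⟩, Or.inl hj, dominates_succ_cons_left.2 hd⟩
      · rintro ⟨hi | ⟨i, rfl, hi⟩, hj | ⟨j, rfl, hj⟩, hd⟩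
        · exact Or.inl (Or.inl (Or.inl ⟨hi, hj, hd⟩))
        · exact Or.inl (Or.inr ⟨i, j, ⟨hi, hj, (dominates_cons_right hi).1 hd⟩, rfl, rfl⟩)
        · exact Or.inr ⟨i, j, ⟨hi, hj, dominates_succ_cons_left.1 hd⟩, rfl, rfl⟩
        · exact Or.inl (Or.inl (Or.inr ⟨i, j, ⟨hi, hj, (dominates_cons_cons hi).1 hd⟩, rfl, rfl⟩))

theorem disjoint_dominatingPairs_image_cons_cons (a N h h' : ℕ) :
    Disjoint (dominatingPairs a N h)
      ((dominatingPairs a N h').image (Prod.map (List.cons a) (List.cons a))) := by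
  rw [Finset.disjoint_right]
  rintro _ hs ht
  obtain ⟨⟨i, j⟩, -, rfl⟩ := Finset.mem_image.1 hs
  exact (mem_dominatingPairs.1 ht).1.cons_ne i rfl

theorem disjoint_union_image_cons_right (a N h h' h'' : ℕ) :
    Disjoint (dominatingPairs a N h ∪
        (dominatingPairs a N h').image (Prod.map (List.cons a) (List.cons a)))
      ((dominatingPairs a N h'').image (Prod.map id (List.cons a))) := by
  rw [Finset.disjoint_right]
  rintro _ hs ht
  obtain ⟨⟨i, j⟩, hij, rfl⟩ := Finset.mem_image.1 hs
  rcases Finset.mem_union.1 ht with ht | ht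
  · exact (mem_dominatingPairs.1 ht).2.1.cons_ne j rfl
  · obtain ⟨⟨i', j'⟩, -, he⟩ := Finset.mem_image.1 ht
    exact (mem_dominatingPairs.1 hij).1.cons_ne i' (congrArg Prod.fst he)

theorem disjoint_union_image_cons_left (a N h h' h'' h''' : ℕ) :
    Disjoint (dominatingPairs a N h ∪
        (dominatingPairs a N h').image (Prod.map (List.cons a) (List.cons a)) ∪
        (dominatingPairs a N h'').image (Prod.map id (List.cons a)))
      ((dominatingPairs a N h''').image (Prod.map (List.cons a) id)) := by
  rw [Finset.disjoint_right]
  rintro _ hs ht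
  obtain ⟨⟨i, j⟩, hij, rfl⟩ := Finset.mem_image.1 hs
  have hj := (mem_dominatingPairs.1 hij).2.1
  rcases Finset.mem_union.1 ht with ht | ht
  · rcases Finset.mem_union.1 ht with ht | ht
    · exact (mem_dominatingPairs.1 ht).1.cons_ne i rfl
    · obtain ⟨⟨i', j'⟩, -, he⟩ := Finset.mem_image.1 ht
      exact hj.cons_ne j' (congrArg Prod.snd he)
  · obtain ⟨⟨i', j'⟩, -, he⟩ := Finset.mem_image.1 ht
    exact hj.cons_ne j' (congrArg Prod.snd he)

theorem card_dominatingPairs_succ_zero (a N : ℕ) :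
    (dominatingPairs a (N + 1) 0).card =
      2 * (dominatingPairs (a + 1) N 0).card + (dominatingPairs (a + 1) N 1).card := by
  have hc : Function.Injective (List.cons (a + 1)) := List.cons_injective
  rw [dominatingPairs, Finset.card_union_of_disjoint (disjoint_union_image_cons_right ..),
    Finset.card_union_of_disjoint (disjoint_dominatingPairs_image_cons_cons ..),
    Finset.card_image_of_injective _ (hc.prodMap hc),
    Finset.card_image_of_injective _ (Function.injective_id.prodMap hc)]
  ring

theorem card_dominatingPairs_succ_succ (a N h : ℕ) :
    (dominatingPairs a (N + 1) (h + 1)).card =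
      2 * (dominatingPairs (a + 1) N (h + 1)).card + (dominatingPairs (a + 1) N (h + 2)).card +
        (dominatingPairs (a + 1) N h).card := by
  have hc : Function.Injective (List.cons (a + 1)) := List.cons_injective
  rw [dominatingPairs, Finset.card_union_of_disjoint (disjoint_union_image_cons_left ..),
    Finset.card_union_of_disjoint (disjoint_union_image_cons_right ..),
    Finset.card_union_of_disjoint (disjoint_dominatingPairs_image_cons_cons ..),
    Finset.card_image_of_injective _ (hc.prodMap hc),
    Finset.card_image_of_injective _ (Function.injective_id.prodMap hc),
    Finset.card_image_of_injective _ (hc.prodMap Function.injective_id)]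
  ring

theorem choose_add_two_add_two (m k : ℕ) :
    (m + 2).choose (k + 2) = m.choose k + 2 * m.choose (k + 1) + m.choose (k + 2) := by
  simp only [Nat.choose_succ_succ']
  ring

theorem choose_two_mul_succ_self (N : ℕ) :
    (2 * (N + 1)).choose (N + 1) = 2 * ((2 * N).choose N + (2 * N).choose (N + 1)) := by
  rw [Nat.mul_add, Nat.choose_succ_succ' (2 * N + 1) N, ← Nat.choose_symm_half,
    Nat.choose_succ_succ' (2 * N) N]
  ring

theorem card_dominatingPairs_add_choose (a N h : ℕ) :
    (dominatingPairs a N h).card + (2 * N).choose (N + h + 2) = (2 * N).choose (N + h) := by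
  induction N generalizing a h with
  | zero => rcases h with _ | h <;> simp [dominatingPairs]
  | succ N ih =>
    rcases h with _ | h
    · have h₀ := ih (a + 1) 0
      have h₁ := ih (a + 1) 1
      have hp := choose_add_two_add_two (2 * N) (N + 1)
      have hs := choose_two_mul_succ_self N
      rw [card_dominatingPairs_succ_zero]
      simp only [Nat.mul_add, Nat.add_assoc, Nat.reduceAdd, Nat.reduceMul, Nat.add_zero] at *
      omega
    · have h₀ := ih (a + 1) h
      have h₁ := ih (a + 1) (h + 1)
      have h₂ := ih (a + 1) (h + 2)
      have hp := choose_add_two_add_two (2 * N) (N + h)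
      have hq := choose_add_two_add_two (2 * N) (N + h + 2)
      rw [card_dominatingPairs_succ_succ, show N + 1 + (h + 1) + 2 = N + h + 2 + 2 by ring,
        show N + 1 + (h + 1) = N + h + 2 by ring, Nat.mul_add]
      simp only [← Nat.add_assoc, Nat.add_right_comm _ 1 2, Nat.mul_one] at *
      omega

theorem card_dominatingPairs_zero (a N : ℕ) :
    (dominatingPairs a N 0).card = catalanNum (N + 1) := by
  have h := card_dominatingPairs_add_choose a N 0
  have h₁ := Nat.choose_succ_right_eq (2 * N) N
  have h₂ := Nat.choose_succ_right_eq (2 * N) (N + 1)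
  rw [catalanNum, choose_two_mul_succ_self]
  symm
  apply Nat.div_eq_of_eq_mul_left (by omega)
  rw [show 2 * N - N = N by omega] at h₁
  rw [Nat.add_zero] at h
  rcases N with _ | N
  · simp [dominatingPairs]
  · rw [show 2 * (N + 1) - (N + 1 + 1) = N by omega] at h₂
    zify at *
    linear_combination (N + 3 : ℤ) * (-h) + h₂ + h₁

/-- For `n ≥ 1`, the number of pairs of strictly increasing sequences
`((i_1,…,i_p),(j_1,…,j_p))` of common length `0 ≤ p ≤ n−1` with entries in
`{1,…,n−1}` satisfying `i_m ≥ j_m` for all `m`, equals the Catalan number `C_n`. -/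
theorem card_index_pairs (n : ℕ) (hn : 1 ≤ n) :
    Nat.card {s : List ℕ × List ℕ //
      s.1.length = s.2.length ∧ s.1.length ≤ n - 1 ∧
      s.1.Chain' (· < ·) ∧ s.2.Chain' (· < ·) ∧
      (∀ x ∈ s.1, 1 ≤ x ∧ x ≤ n - 1) ∧ (∀ x ∈ s.2, 1 ≤ x ∧ x ≤ n - 1) ∧
      (∀ (m : ℕ) (h1 : m < s.1.length) (h2 : m < s.2.length),
        s.2.get ⟨m, h2⟩ ≤ s.1.get ⟨m, h1⟩)} = catalanNum n := by
  obtain ⟨N, rfl⟩ := Nat.exists_eq_add_of_le' hn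
  rw [← card_dominatingPairs_zero 0 N]
  refine Nat.subtype_card _ ?_
  rintro ⟨i, j⟩
  rw [mem_dominatingPairs]
  simp only [IsIncreasingIn, Dominates, Nat.add_sub_cancel, Nat.zero_add, Nat.add_zero,
    List.get_eq_getElem]
  constructor
  · rintro ⟨⟨hi, hi'⟩, ⟨hj, hj'⟩, hl, H⟩
    have hN : IsIncreasingIn 0 N i := ⟨hi, by simpa using hi'⟩
    exact ⟨hl, hN.length_le, List.isChain_iff_pairwise.2 hi, List.isChain_iff_pairwise.2 hj,
      hi', hj', fun m h1 h2 => H m _ _ (List.getElem?_eq_getElem h2) (List.getElem?_eq_getElem h1)⟩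
  · rintro ⟨hl, -, hi, hj, hi', hj', H⟩
    refine ⟨⟨List.isChain_iff_pairwise.1 hi, hi'⟩, ⟨List.isChain_iff_pairwise.1 hj, hj'⟩, hl,
      fun m x y hy hx => ?_⟩
    obtain ⟨h2, rfl⟩ := List.getElem?_eq_some_iff.1 hy
    obtain ⟨h1, rfl⟩ := List.getElem?_eq_some_iff.1 hx
    exact H m h1 h2
end

section
/- Let W(B_n) (n ≥ 2) be the Coxeter group with generators s_0, s_1, …, s_{n−1} and relations s_i² = 1 for all i, s_is_j = s_js_i for |i−j| > 1, s_is_{i+1}s_i = s_{i+1}s_is_{i+1} for 1 ≤ i < n−1, and s_1s_0s_1s_0 = s_0s_1s_0s_1. Then the map sending each tuple ((a_0,…,a_{n−1}), (k_0,…,k_{n−1})) with 1 ≤ a_i ≤ i+1 and k_i ∈ {0,1} to the element of W(B_n) represented by the word s_{0,a_0}^{(k_0)} s_{1,a_1}^{(k_1)} ⋯ s_{n−1,a_{n−1}}^{(k_{n−1})} is a bijection onto W(B_n), and each such word is a reduced expression (its length in W(B_n) equals the number of letters of the word). -/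
/-- The Coxeter matrix of type `B_n` with the `4`-bond between `0` and `1`:
`m(0,1) = 4`, `m(i,i+1) = 3` for `1 ≤ i ≤ n−2`, and `m(i,j) = 2` for `|i−j| > 1`. -/
def BnMatrix (n : ℕ) : CoxeterMatrix (Fin n) where
  M := Matrix.of fun i j : Fin n ↦
    if i = j then 1
    else if ((i : ℕ) = 0 ∧ (j : ℕ) = 1) ∨ ((i : ℕ) = 1 ∧ (j : ℕ) = 0) then 4
    else if (j : ℕ) + 1 = i ∨ (i : ℕ) + 1 = j then 3 else 2
  isSymm := by unfold Matrix.IsSymm; aesop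
  diagonal := by simp
  off_diagonal := by aesop

/-- The Coxeter group `W(B_n)` of type `B_n`. -/
abbrev WB (n : ℕ) : Type := (BnMatrix n).Group

/-- The generator `s_i` of `W(B_n)` (by convention `1` for `i ≥ n`). -/
def sB (n : ℕ) (i : ℕ) : WB n :=
  if h : i < n then (BnMatrix n).simple ⟨i, h⟩ else 1

/-- The word `s_{i,j} = s_i s_{i−1} ⋯ s_j` (empty if `j = i + 1`), as a list of indices. -/
def sdecW (i j : ℕ) : List ℕ := (List.range' j (i + 1 - j)).reverse

/-- The word `s^{1,j} = s_1 s_2 ⋯ s_j` (empty if `j = 0`), as a list of indices. -/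
def sincW (j : ℕ) : List ℕ := List.range' 1 j

/-- The word `s_{i,a}^{(k)}`: equal to `s_{i,a}` if `k = 0`, and to `s_{i,0}s^{1,a−1}`
if `k = 1`. -/
def blockB (i a k : ℕ) : List ℕ :=
  if k = 0 then sdecW i a else sdecW i 0 ++ sincW (a - 1)

/-- The canonical word `s_{0,a_0}^{(k_0)} s_{1,a_1}^{(k_1)} ⋯ s_{n−1,a_{n−1}}^{(k_{n−1})}`
associated to the tuple `((a_0,…,a_{n−1}), (k_0,…,k_{n−1}))`. -/
def canonWordB (n : ℕ) (a k : Fin n → ℕ) : List ℕ :=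
  ((List.finRange n).map (fun i : Fin n => blockB (i : ℕ) (a i) (k i))).flatten

/-- The `q`-th letter of the palindrome `s_m ⋯ s_1 s_0 s_1 ⋯ s_m`. -/
def cosetLetter (m q : ℕ) : ℕ := (m - q) + (q - m)

section NormalForm

variable {G : Type*} [Group G] (s : ℕ → G)

/-- The product of the first `q` letters of the palindrome `s_m ⋯ s_1 s_0 s_1 ⋯ s_m`. -/
def cosetRep (m q : ℕ) : G := ((List.range q).map fun r => s (cosetLetter m r)).prod

/-- The product of the first `m` coset representatives, the `i`-th one of length `p i`. -/
def normalForm (p : ℕ → ℕ) (m : ℕ) : G := ((List.range m).map fun i => cosetRep s i (p i)).prod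

@[simp] theorem cosetRep_zero (m : ℕ) : cosetRep s m 0 = 1 := by simp [cosetRep]

theorem cosetRep_succ (m q : ℕ) :
    cosetRep s m (q + 1) = cosetRep s m q * s (cosetLetter m q) := by
  simp [cosetRep, List.range_succ]

@[simp] theorem normalForm_zero (p : ℕ → ℕ) : normalForm s p 0 = 1 := by simp [normalForm]

theorem normalForm_succ (p : ℕ → ℕ) (m : ℕ) :
    normalForm s p (m + 1) = normalForm s p m * cosetRep s m (p m) := by
  simp [normalForm, List.range_succ]

theorem normalForm_congr {p p' : ℕ → ℕ} {m : ℕ} (h : ∀ i < m, p i = p' i) :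
    normalForm s p m = normalForm s p' m := by
  unfold normalForm
  congr 1
  exact List.map_congr_left fun i hi => by rw [h i (List.mem_range.1 hi)]

variable {s} {n : ℕ} (hsq : ∀ i, s i * s i = 1)
  (hcomm : ∀ i j, i + 2 ≤ j → s i * s j = s j * s i)
  (hbraid : ∀ i, 1 ≤ i → i + 1 < n → s i * s (i + 1) * s i = s (i + 1) * s i * s (i + 1))
  (hfour : 1 < n → s 0 * s 1 * s 0 * s 1 = s 1 * s 0 * s 1 * s 0)

include hcomm hbraid hfour in
theorem exists_cosetRep_mul_eq {m : ℕ} (hm : m < n) (q : ℕ) :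
    q ≤ 2 * m + 1 → ∀ j ≤ m, j ≠ cosetLetter m q → (∀ r, q = r + 1 → j ≠ cosetLetter m r) →
      ∃ j' < m, cosetRep s m q * s j = s j' * cosetRep s m q := by
  induction q using Nat.strong_induction_on with
  | _ q ih =>
  intro hq j hj h₁ h₂
  rcases q with _ | q
  · refine ⟨j, ?_, by simp⟩
    simp only [cosetLetter] at h₁
    omega
  have h₂ := h₂ q rfl
  rw [cosetRep_succ]
  have reduce {x y : G} (r i : ℕ) (hr : r < q + 1) (hi : i ≤ m) (hi₁ : i ≠ cosetLetter m r)
      (hi₂ : ∀ r', r = r' + 1 → i ≠ cosetLetter m r')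
      (hx : x = cosetRep s m r * y) (hz : x * s j = cosetRep s m r * s i * y) :
      ∃ j' < m, x * s j = s j' * x := by
    obtain ⟨j', hj', h⟩ := ih r hr (by omega) i hi hi₁ hi₂
    exact ⟨j', hj', by rw [hz, h, hx, mul_assoc]⟩
  by_cases hc : j + 2 ≤ cosetLetter m q ∨ cosetLetter m q + 2 ≤ j
  · have hcj : s (cosetLetter m q) * s j = s j * s (cosetLetter m q) :=
      hc.elim (fun h => (hcomm _ _ h).symm) (hcomm _ _)
    refine reduce q j (by omega) hj h₂ ?_ rfl (by rw [mul_assoc, hcj, mul_assoc])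
    rintro r rfl h
    simp only [cosetLetter] at *
    omega
  obtain ⟨r, rfl⟩ : ∃ r, q = r + 1 := by
    refine ⟨q - 1, ?_⟩
    simp only [cosetLetter] at *
    omega
  have hjr : j = cosetLetter m r := by
    simp only [cosetLetter] at *
    omega
  by_cases hrm : r = m
  · obtain ⟨t, rfl⟩ : ∃ t, r = t + 1 := by
      refine ⟨r - 1, ?_⟩
      simp only [cosetLetter] at *
      omega
    subst hrm
    have e₀ : cosetLetter (t + 1) (t + 1) = 0 := by simp [cosetLetter]
    have e₁ : cosetLetter (t + 1) (t + 1 + 1) = 1 := by simp [cosetLetter]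
    have e₂ : cosetLetter (t + 1) t = 1 := by simp [cosetLetter]
    rw [e₀] at hjr
    subst hjr
    refine reduce (y := s 1 * s 0 * s 1) t 0 (by omega) (by omega) (by rw [e₂]; omega)
      ?_ ?_ ?_
    · rintro r' rfl
      simp only [cosetLetter]
      omega
    · simp only [cosetRep_succ, e₀, e₁, e₂, mul_assoc]
    · have := hfour (by omega)
      simp only [mul_assoc] at this
      simp only [cosetRep_succ, e₀, e₁, e₂, mul_assoc, this]
  · have hb : s j * s (cosetLetter m (r + 1)) * s j =
        s (cosetLetter m (r + 1)) * s j * s (cosetLetter m (r + 1)) := by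
      rcases (show j = cosetLetter m (r + 1) + 1 ∧ 1 ≤ cosetLetter m (r + 1) ∨
          cosetLetter m (r + 1) = j + 1 ∧ 1 ≤ j ∨ cosetLetter m (r + 1) = 0 by
            simp only [cosetLetter] at *; omega) with ⟨e, h⟩ | ⟨e, h⟩ | e
      · rw [e]
        exact (hbraid _ h (by omega)).symm
      · rw [e]
        refine hbraid _ h ?_
        simp only [cosetLetter] at *
        omega
      · simp only [cosetLetter] at *
        omega
    refine reduce (y := s j * s (cosetLetter m (r + 1))) r (cosetLetter m (r + 1))
      (by omega) ?_ ?_ ?_ ?_ ?_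
    · simp only [cosetLetter] at *
      omega
    · simp only [cosetLetter] at *
      omega
    · rintro r' rfl
      simp only [cosetLetter] at *
      omega
    · rw [cosetRep_succ, ← hjr, mul_assoc]
    · rw [cosetRep_succ, ← hjr]
      simp only [mul_assoc] at hb ⊢
      rw [hb]

include hsq hcomm hbraid hfour in
theorem exists_normalForm_mul_eq {m : ℕ} (hm : m ≤ n) :
    ∀ p : ℕ → ℕ, (∀ i < m, p i ≤ 2 * i + 1) → ∀ j < m,
      ∃ p' : ℕ → ℕ, (∀ i < m, p' i ≤ 2 * i + 1) ∧
        normalForm s p m * s j = normalForm s p' m ∧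
        ((List.range m).map p').sum ≤ ((List.range m).map p).sum + 1 := by
  induction m with
  | zero => intro p _ j hj; omega
  | succ m ih =>
  intro p hp j hj
  have extend (p' : ℕ → ℕ) (q : ℕ) (hp' : ∀ i < m, p' i ≤ 2 * i + 1) (hq : q ≤ 2 * m + 1)
      (heq : normalForm s p (m + 1) * s j = normalForm s p' m * cosetRep s m q)
      (hsum : ((List.range m).map p').sum + q ≤ ((List.range m).map p).sum + p m + 1) :
      ∃ p' : ℕ → ℕ, (∀ i < m + 1, p' i ≤ 2 * i + 1) ∧
        normalForm s p (m + 1) * s j = normalForm s p' (m + 1) ∧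
        ((List.range (m + 1)).map p').sum ≤ ((List.range (m + 1)).map p).sum + 1 := by
    have hne : ∀ i < m, Function.update p' m q i = p' i := fun i hi =>
      Function.update_of_ne hi.ne _ _
    refine ⟨Function.update p' m q, ?_, ?_, ?_⟩
    · intro i hi
      rcases Nat.lt_succ_iff_lt_or_eq.1 hi with h | rfl
      · rw [hne i h]
        exact hp' i h
      · simpa using hq
    · rw [heq, normalForm_succ, normalForm_congr s hne, Function.update_self]
    · have : (List.range m).map (Function.update p' m q) = (List.range m).map p' :=
        List.map_congr_left fun i hi => hne i (List.mem_range.1 hi)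
      simp only [List.range_succ, List.map_append, List.sum_append, this]
      simpa [add_assoc] using hsum
  have hp₀ : ∀ i < m, p i ≤ 2 * i + 1 := fun i hi => hp i (by omega)
  have hpm := hp m (by omega)
  by_cases h₁ : j = cosetLetter m (p m)
  · refine extend p (p m + 1) hp₀ ?_ ?_ (by omega)
    · simp only [cosetLetter] at h₁
      omega
    · rw [normalForm_succ, cosetRep_succ, ← h₁, mul_assoc]
  by_cases h₂ : ∀ r, p m = r + 1 → j ≠ cosetLetter m r
  · obtain ⟨j', hj', h⟩ := exists_cosetRep_mul_eq hcomm hbraid hfour (by omega) (p m) hpm j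
      (by omega) h₁ h₂
    obtain ⟨p', hp', heq, hsum⟩ := ih (by omega) p hp₀ j' hj'
    refine extend p' (p m) hp' hpm ?_ (by omega)
    rw [normalForm_succ, mul_assoc, h, ← mul_assoc, heq]
  · push Not at h₂
    obtain ⟨r, hr, h⟩ := h₂
    refine extend p r hp₀ (by omega) ?_ (by omega)
    rw [normalForm_succ, hr, cosetRep_succ, ← h, mul_assoc, mul_assoc, hsq, mul_one]

end NormalForm

/-- The action of the generator `s_i` of `W(B_n)` on `ℤ` by signed permutations of
`1, …, n`. -/
def signedSwap (i : ℕ) : Function.End ℤ := fun x =>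
  if i = 0 then if x = 1 then -1 else if x = -1 then 1 else x
  else if x = i then i + 1 else if x = i + 1 then i
  else if x = -i then -(i + 1) else if x = -(i + 1) then -i else x

theorem signedSwap_apply (i : ℕ) (x : ℤ) : signedSwap i x =
    if i = 0 then if x = 1 then -1 else if x = -1 then 1 else x
    else if x = i then i + 1 else if x = i + 1 then i
    else if x = -i then -(i + 1) else if x = -(i + 1) then -i else x := rfl

theorem signedSwap_mul_self (i : ℕ) : signedSwap i * signedSwap i = 1 := by
  funext x
  change signedSwap i (signedSwap i x) = x
  simp only [signedSwap_apply]
  grind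

theorem signedSwap_comm {i j : ℕ} (h : i + 2 ≤ j) :
    signedSwap i * signedSwap j = signedSwap j * signedSwap i := by
  funext x
  change signedSwap i (signedSwap j x) = signedSwap j (signedSwap i x)
  have h₁ := signedSwap_apply i x
  have h₂ := signedSwap_apply j x
  have h₃ := signedSwap_apply i (signedSwap j x)
  have h₄ := signedSwap_apply j (signedSwap i x)
  generalize signedSwap i (signedSwap j x) = a at *
  generalize signedSwap j (signedSwap i x) = b at *
  generalize signedSwap i x = c at *
  generalize signedSwap j x = d at *
  grind (splits := 25)

theorem signedSwap_braid {i : ℕ} (h : 1 ≤ i) :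
    signedSwap i * signedSwap (i + 1) * signedSwap i =
      signedSwap (i + 1) * signedSwap i * signedSwap (i + 1) := by
  funext x
  change signedSwap i (signedSwap (i + 1) (signedSwap i x)) =
    signedSwap (i + 1) (signedSwap i (signedSwap (i + 1) x))
  have h₁ := signedSwap_apply i x
  have h₂ := signedSwap_apply (i + 1) x
  have h₃ := signedSwap_apply (i + 1) (signedSwap i x)
  have h₄ := signedSwap_apply i (signedSwap (i + 1) x)
  have h₅ := signedSwap_apply i (signedSwap (i + 1) (signedSwap i x))
  have h₆ := signedSwap_apply (i + 1) (signedSwap i (signedSwap (i + 1) x))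
  generalize signedSwap i (signedSwap (i + 1) (signedSwap i x)) = a at *
  generalize signedSwap (i + 1) (signedSwap i (signedSwap (i + 1) x)) = b at *
  generalize signedSwap (i + 1) (signedSwap i x) = c at *
  generalize signedSwap i (signedSwap (i + 1) x) = d at *
  grind (splits := 25)

theorem signedSwap_four :
    signedSwap 0 * signedSwap 1 * signedSwap 0 * signedSwap 1 =
      signedSwap 1 * signedSwap 0 * signedSwap 1 * signedSwap 0 := by
  funext x
  change signedSwap 0 (signedSwap 1 (signedSwap 0 (signedSwap 1 x))) =
    signedSwap 1 (signedSwap 0 (signedSwap 1 (signedSwap 0 x)))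
  simp only [signedSwap_apply]
  grind

theorem BnMatrix_apply (n : ℕ) (i j : Fin n) : BnMatrix n i j =
    if i = j then 1
    else if ((i : ℕ) = 0 ∧ (j : ℕ) = 1) ∨ ((i : ℕ) = 1 ∧ (j : ℕ) = 0) then 4
    else if (j : ℕ) + 1 = i ∨ (i : ℕ) + 1 = j then 3 else 2 := rfl

section Monoid

variable {M : Type*} [Monoid M] {a b : M} (ha : a * a = 1) (hb : b * b = 1)

include ha hb

theorem mul_pow_two_eq_one_of_comm (h : a * b = b * a) : (a * b) ^ 2 = 1 := by
  rw [pow_two]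
  nth_rw 2 [h]
  rw [mul_assoc, ← mul_assoc b, hb, one_mul, ha]

theorem mul_pow_three_eq_one_of_braid (h : a * b * a = b * a * b) : (a * b) ^ 3 = 1 := by
  have : (a * b) ^ 3 = a * b * a * (b * a * b) := by
    simp only [pow_succ, pow_zero, one_mul, mul_assoc]
  rw [this, ← h]
  simp only [mul_assoc]
  rw [← mul_assoc a a, ha, one_mul, ← mul_assoc b b, hb, one_mul, ha]

theorem mul_pow_four_eq_one_of_braid (h : a * b * a * b = b * a * b * a) : (a * b) ^ 4 = 1 := by
  have : (a * b) ^ 4 = a * b * a * b * (a * b * a * b) := by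
    simp only [pow_succ, pow_zero, one_mul, mul_assoc]
  rw [this]
  nth_rw 2 [h]
  simp only [mul_assoc]
  rw [← mul_assoc b b, hb, one_mul, ← mul_assoc a a, ha, one_mul, ← mul_assoc b b, hb, one_mul, ha]

end Monoid

theorem isLiftable_signedSwap (n : ℕ) :
    (BnMatrix n).IsLiftable fun i : Fin n => signedSwap i := by
  intro i j
  have hi := signedSwap_mul_self i
  have hj := signedSwap_mul_self j
  change (signedSwap i * signedSwap j) ^ BnMatrix n i j = 1
  rw [BnMatrix_apply]
  split_ifs with h₁ h₂ h₃
  · rw [h₁, pow_one, hj]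
  · refine mul_pow_four_eq_one_of_braid hi hj ?_
    rcases h₂ with ⟨h, h'⟩ | ⟨h, h'⟩ <;> rw [h, h']
    exacts [signedSwap_four, signedSwap_four.symm]
  · refine mul_pow_three_eq_one_of_braid hi hj ?_
    rcases h₃ with h | h <;> rw [← h]
    exacts [(signedSwap_braid (by omega)).symm, signedSwap_braid (by omega)]
  · have := Fin.val_ne_of_ne h₁
    refine mul_pow_two_eq_one_of_comm hi hj ?_
    rcases (show (i : ℕ) + 2 ≤ j ∨ (j : ℕ) + 2 ≤ i by omega) with h | h
    exacts [signedSwap_comm h, (signedSwap_comm h).symm]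

/-- The action of `W(B_n)` on `ℤ` by signed permutations. -/
def signedPermHom (n : ℕ) : WB n →* Function.End ℤ :=
  (BnMatrix n).toCoxeterSystem.lift ⟨fun i : Fin n => signedSwap i, isLiftable_signedSwap n⟩

theorem sB_of_lt {n i : ℕ} (h : i < n) :
    sB n i = (BnMatrix n).toCoxeterSystem.simple ⟨i, h⟩ := by
  rw [sB, dif_pos h, CoxeterMatrix.toCoxeterSystem_simple]

theorem signedPermHom_sB {n i : ℕ} (h : i < n) : signedPermHom n (sB n i) = signedSwap i := by
  rw [sB_of_lt h, signedPermHom, CoxeterSystem.lift_apply_simple]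

theorem sB_mul_self (n i : ℕ) : sB n i * sB n i = 1 := by
  by_cases h : i < n
  · rw [sB_of_lt h, CoxeterSystem.simple_mul_simple_self]
  · simp [sB, h]

theorem sB_inv (n i : ℕ) : (sB n i)⁻¹ = sB n i := inv_eq_of_mul_eq_one_left (sB_mul_self n i)

theorem sB_comm (n i j : ℕ) (hij : i + 2 ≤ j) : sB n i * sB n j = sB n j * sB n i := by
  by_cases hj : j < n
  · have h := (BnMatrix n).toCoxeterSystem.simple_mul_simple_pow ⟨i, by omega⟩ ⟨j, hj⟩
    rw [← sB_of_lt, ← sB_of_lt, BnMatrix_apply, if_neg (by simp; omega), if_neg (by simp; omega),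
      if_neg (by simp; omega), pow_two] at h
    rw [eq_inv_of_mul_eq_one_left h, mul_inv_rev, sB_inv, sB_inv]
  · simp [sB, hj]

theorem sB_braid (n i : ℕ) (hi : 1 ≤ i) (hin : i + 1 < n) :
    sB n i * sB n (i + 1) * sB n i = sB n (i + 1) * sB n i * sB n (i + 1) := by
  have h := (BnMatrix n).toCoxeterSystem.simple_mul_simple_pow ⟨i, by omega⟩ ⟨i + 1, hin⟩
  rw [← sB_of_lt, ← sB_of_lt, BnMatrix_apply, if_neg (by simp), if_neg (by simp; omega),
    if_pos (by simp)] at h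
  have h' : sB n i * sB n (i + 1) * sB n i * (sB n (i + 1) * sB n i * sB n (i + 1)) = 1 := by
    rw [← h]
    simp only [pow_succ, pow_zero, one_mul, mul_assoc]
  rw [eq_inv_of_mul_eq_one_left h']
  simp only [mul_inv_rev, sB_inv, mul_assoc]

theorem sB_four (n : ℕ) (hn : 1 < n) :
    sB n 0 * sB n 1 * sB n 0 * sB n 1 = sB n 1 * sB n 0 * sB n 1 * sB n 0 := by
  have h := (BnMatrix n).toCoxeterSystem.simple_mul_simple_pow ⟨0, by omega⟩ ⟨1, hn⟩
  rw [← sB_of_lt, ← sB_of_lt, BnMatrix_apply, if_neg (by simp), if_pos (by simp)] at h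
  have h' : sB n 0 * sB n 1 * sB n 0 * sB n 1 * (sB n 0 * sB n 1 * sB n 0 * sB n 1) = 1 := by
    rw [← h]
    simp only [pow_succ, pow_zero, one_mul, mul_assoc]
  rw [eq_inv_of_mul_eq_one_left h']
  simp only [mul_inv_rev, sB_inv, mul_assoc]

theorem signedPermHom_cosetRep_inv {n m : ℕ} (hm : m < n) {q : ℕ} (hq : q ≤ 2 * m + 1) :
    signedPermHom n (cosetRep (sB n) m q)⁻¹ (m + 1 : ℤ) =
      if q ≤ m then (m + 1 - q : ℤ) else (m - q : ℤ) := by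
  induction q with
  | zero => simp [Function.End.one_def]
  | succ q ih =>
    rw [cosetRep_succ, mul_inv_rev, sB_inv, map_mul,
      signedPermHom_sB (by simp only [cosetLetter]; omega)]
    change signedSwap _ (signedPermHom n _ _) = _
    rw [ih (by omega), signedSwap_apply]
    simp only [cosetLetter]
    split_ifs <;> omega

theorem signedPermHom_cosetRep_inv_of_lt {n m : ℕ} (hm : m < n) {q : ℕ} (hq : q ≤ 2 * m + 1)
    {x : ℤ} (hx : m + 1 < x) : signedPermHom n (cosetRep (sB n) m q)⁻¹ x = x := by
  induction q with
  | zero => simp [Function.End.one_def]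
  | succ q ih =>
    rw [cosetRep_succ, mul_inv_rev, sB_inv, map_mul,
      signedPermHom_sB (by simp only [cosetLetter]; omega)]
    change signedSwap _ (signedPermHom n _ _) = _
    rw [ih (by omega), signedSwap_apply]
    simp only [cosetLetter]
    split_ifs <;> omega

theorem signedPermHom_normalForm_inv_of_lt {n m : ℕ} (hm : m ≤ n) {p : ℕ → ℕ}
    (hp : ∀ i < m, p i ≤ 2 * i + 1) {x : ℤ} (hx : m < x) :
    signedPermHom n (normalForm (sB n) p m)⁻¹ x = x := by
  induction m with
  | zero => simp [Function.End.one_def]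
  | succ m ih =>
    push_cast at hx
    rw [normalForm_succ, mul_inv_rev, map_mul]
    change signedPermHom n _ (signedPermHom n _ _) = _
    rw [ih (by omega) (fun i hi => hp i (by omega)) (by omega),
      signedPermHom_cosetRep_inv_of_lt (by omega) (hp m (by omega)) hx]

theorem normalForm_sB_injective {n m : ℕ} (hm : m ≤ n) {p p' : ℕ → ℕ}
    (hp : ∀ i < m, p i ≤ 2 * i + 1) (hp' : ∀ i < m, p' i ≤ 2 * i + 1)
    (h : normalForm (sB n) p m = normalForm (sB n) p' m) : ∀ i < m, p i = p' i := by
  induction m with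
  | zero => intro i hi; omega
  | succ m ih =>
    have value {p : ℕ → ℕ} (hp : ∀ i < m + 1, p i ≤ 2 * i + 1) :
        signedPermHom n (normalForm (sB n) p (m + 1))⁻¹ (m + 1 : ℤ) =
          if p m ≤ m then (m + 1 - p m : ℤ) else (m - p m : ℤ) := by
      rw [normalForm_succ, mul_inv_rev, map_mul]
      change signedPermHom n _ (signedPermHom n _ _) = _
      rw [signedPermHom_normalForm_inv_of_lt (by omega) (fun i hi => hp i (by omega)) (by omega),
        signedPermHom_cosetRep_inv (by omega) (hp m (by omega))]
    have hm' : p m = p' m := by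
      have hv := value hp
      rw [h, value hp'] at hv
      split_ifs at hv <;> omega
    rw [normalForm_succ, normalForm_succ, hm', mul_left_inj] at h
    intro i hi
    rcases Nat.lt_succ_iff_lt_or_eq.1 hi with hi | rfl
    · exact ih (by omega) (fun i hi => hp i (by omega)) (fun i hi => hp' i (by omega)) h i hi
    · exact hm'

theorem exists_normalForm_eq_wordProd (n : ℕ) (ω : List (Fin n)) :
    ∃ p : ℕ → ℕ, (∀ i < n, p i ≤ 2 * i + 1) ∧
      normalForm (sB n) p n = (BnMatrix n).toCoxeterSystem.wordProd ω ∧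
      ((List.range n).map p).sum ≤ ω.length := by
  induction ω using List.reverseRecOn with
  | nil => exact ⟨fun _ => 0, by simp, by simp [normalForm], by simp⟩
  | append_singleton ω j ih =>
    obtain ⟨p, hp, heq, hsum⟩ := ih
    obtain ⟨p', hp', heq', hsum'⟩ := exists_normalForm_mul_eq (sB_mul_self n) (sB_comm n)
      (sB_braid n) (sB_four n) le_rfl p hp j j.2
    refine ⟨p', hp', ?_, by simp; omega⟩
    rw [← heq', heq, sB_of_lt j.2, CoxeterSystem.wordProd_append,
      CoxeterSystem.wordProd_singleton]

/-- The length of the block `s_{i,a}^{(k)}`. -/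
def blockLength (i a k : ℕ) : ℕ := if k = 0 then i + 1 - a else i + a

theorem blockB_eq_map_range {i a k : ℕ} (ha : 1 ≤ a) (ha' : a ≤ i + 1) :
    blockB i a k = (List.range (blockLength i a k)).map (cosetLetter i) := by
  unfold blockB blockLength sdecW sincW
  split_ifs
  · refine List.ext_getElem (by simp) fun r h₁ h₂ => ?_
    simp at h₁
    simp [cosetLetter]
    omega
  · refine List.ext_getElem (by simp; omega) fun r h₁ h₂ => ?_
    simp at h₁
    simp [List.getElem_append, cosetLetter]
    split_ifs <;> omega

/-- The lengths of the blocks of a canonical word, extended by zero. -/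
def blockLengths {n : ℕ} (a k : Fin n → ℕ) (i : ℕ) : ℕ :=
  if h : i < n then blockLength i (a ⟨i, h⟩) (k ⟨i, h⟩) else 0

theorem blockLengths_val {n : ℕ} (a k : Fin n → ℕ) (i : Fin n) :
    blockLengths a k i = blockLength i (a i) (k i) := by simp [blockLengths]

theorem blockLengths_le {n : ℕ} {a k : Fin n → ℕ} (ha : ∀ i, 1 ≤ a i ∧ a i ≤ (i : ℕ) + 1) :
    ∀ i < n, blockLengths a k i ≤ 2 * i + 1 := by
  intro i hi
  have := ha ⟨i, hi⟩
  simp only [blockLengths, dif_pos hi, blockLength]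
  split_ifs <;> simp only at this <;> omega

theorem prod_canonWordB {n : ℕ} {a k : Fin n → ℕ} (ha : ∀ i, 1 ≤ a i ∧ a i ≤ (i : ℕ) + 1) :
    ((canonWordB n a k).map (sB n)).prod = normalForm (sB n) (blockLengths a k) n := by
  rw [normalForm, ← List.map_coe_finRange_eq_range, canonWordB, List.map_flatten, List.prod_flatten]
  simp only [List.map_map]
  congr 1
  refine List.map_congr_left fun i _ => ?_
  simp [cosetRep, blockLengths_val, blockB_eq_map_range (ha i).1 (ha i).2, Function.comp_def]

theorem length_canonWordB {n : ℕ} {a k : Fin n → ℕ} (ha : ∀ i, 1 ≤ a i ∧ a i ≤ (i : ℕ) + 1) :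
    (canonWordB n a k).length = ((List.range n).map (blockLengths a k)).sum := by
  rw [← List.map_coe_finRange_eq_range, canonWordB, List.length_flatten]
  simp only [List.map_map]
  congr 1
  refine List.map_congr_left fun i _ => ?_
  simp [blockLengths_val, blockB_eq_map_range (ha i).1 (ha i).2]

theorem lt_of_mem_canonWordB {n : ℕ} {a k : Fin n → ℕ}
    (ha : ∀ i, 1 ≤ a i ∧ a i ≤ (i : ℕ) + 1) {j : ℕ} (hj : j ∈ canonWordB n a k) : j < n := by
  simp only [canonWordB, List.mem_flatten, List.mem_map] at hj
  obtain ⟨_, ⟨i, -, rfl⟩, hj⟩ := hj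
  have hle := blockLengths_le (k := k) ha i i.2
  rw [blockLengths_val] at hle
  rw [blockB_eq_map_range (ha i).1 (ha i).2, List.mem_map] at hj
  obtain ⟨r, hr, rfl⟩ := hj
  rw [List.mem_range] at hr
  simp only [cosetLetter]
  omega

theorem length_prod_map_sB_le {n : ℕ} {l : List ℕ} (hl : ∀ j ∈ l, j < n) :
    (BnMatrix n).toCoxeterSystem.length ((l.map (sB n)).prod) ≤ l.length := by
  have : (l.map (sB n)).prod = (BnMatrix n).toCoxeterSystem.wordProd
      (l.attach.map fun j => ⟨j.1, hl j.1 j.2⟩) := by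
    rw [CoxeterSystem.wordProd, List.map_map]
    conv_lhs => rw [← List.attach_map_subtype_val l, List.map_map]
    congr 1
    exact List.map_congr_left fun j _ => sB_of_lt (hl j.1 j.2)
  rw [this]
  exact (CoxeterSystem.length_wordProd_le _ _).trans (by simp)

/-- The canonical form for `W(B_n)`: the map sending each tuple
`((a_0,…,a_{n−1}), (k_0,…,k_{n−1}))` with `1 ≤ a_i ≤ i+1` and `k_i ∈ {0,1}` to the
element of `W(B_n)` represented by the word
`s_{0,a_0}^{(k_0)} ⋯ s_{n−1,a_{n−1}}^{(k_{n−1})}` is a bijection onto `W(B_n)`, and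
each such word is a reduced expression for the element it represents. -/
theorem canonical_form_WB (n : ℕ) (hn : 2 ≤ n) :
    Function.Bijective
      (fun t : {ak : (Fin n → ℕ) × (Fin n → ℕ) //
          (∀ i, 1 ≤ ak.1 i ∧ ak.1 i ≤ (i : ℕ) + 1) ∧ (∀ i, ak.2 i ≤ 1)} =>
        ((canonWordB n t.val.1 t.val.2).map (sB n)).prod) ∧
    (∀ (a k : Fin n → ℕ), (∀ i, 1 ≤ a i ∧ a i ≤ (i : ℕ) + 1) → (∀ i, k i ≤ 1) →
      (BnMatrix n).toCoxeterSystem.length (((canonWordB n a k).map (sB n)).prod) =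
        (canonWordB n a k).length) := by
  refine ⟨⟨?_, ?_⟩, ?_⟩
  · rintro ⟨⟨a, k⟩, ha, hk⟩ ⟨⟨a', k'⟩, ha', hk'⟩ h
    simp only at ha hk ha' hk'
    simp only [prod_canonWordB ha, prod_canonWordB ha'] at h
    have hpp := normalForm_sB_injective le_rfl (blockLengths_le ha) (blockLengths_le ha') h
    have key : ∀ i, a i = a' i ∧ k i = k' i := by
      intro i
      have := hpp i i.2
      simp only [blockLengths_val, blockLength] at this
      have := ha i
      have := ha' i
      have := hk i
      have := hk' i
      split_ifs at * <;> omega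
    simp only [Subtype.mk.injEq, Prod.mk.injEq]
    exact ⟨funext fun i => (key i).1, funext fun i => (key i).2⟩
  · intro w
    obtain ⟨ω, rfl⟩ := (BnMatrix n).toCoxeterSystem.wordProd_surjective w
    obtain ⟨p, hp, heq, -⟩ := exists_normalForm_eq_wordProd n ω
    have ha : ∀ i : Fin n, 1 ≤ (if p i ≤ i then i + 1 - p i else p i - i) ∧
        (if p i ≤ i then i + 1 - p i else p i - i) ≤ (i : ℕ) + 1 := by
      intro i
      have := hp i i.2
      split_ifs <;> omega
    refine ⟨⟨(fun i : Fin n => if p i ≤ i then i + 1 - p i else p i - i,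
      fun i : Fin n => if p i ≤ i then 0 else 1), ha, fun i => by dsimp only; split_ifs <;> simp⟩,
      ?_⟩
    simp only
    rw [prod_canonWordB ha, ← heq]
    refine normalForm_congr _ fun i hi => ?_
    have := hp i hi
    simp only [blockLengths, dif_pos hi, blockLength]
    by_cases h : p i ≤ i <;> simp [h] <;> omega
  · intro a k ha hk
    refine le_antisymm (length_prod_map_sB_le fun j hj => lt_of_mem_canonWordB ha hj) ?_
    obtain ⟨ω, hω, hprod⟩ := (BnMatrix n).toCoxeterSystem.exists_isReduced
      ((canonWordB n a k).map (sB n)).prod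
    obtain ⟨p, hp, heq, hsum⟩ := exists_normalForm_eq_wordProd n ω
    rw [← hprod, prod_canonWordB ha] at heq
    have hpp := normalForm_sB_injective le_rfl hp (blockLengths_le ha) heq
    have hmap : (List.range n).map p = (List.range n).map (blockLengths a k) :=
      List.map_congr_left fun i hi => hpp i (List.mem_range.1 hi)
    rw [hprod, hω.eq, length_canonWordB ha, ← hmap]
    exact hsum
end

section
/- Let d, n ≥ 2 and let G(d,1,n) be the group presented by generators s_0, s_1, …, s_{n−1} with relations s_0^d = 1, s_i² = 1 for 1 ≤ i ≤ n−1, s_is_j = s_js_i for |i−j| > 1, s_is_{i+1}s_i = s_{i+1}s_is_{i+1} for 1 ≤ i < n−1, and s_1s_0s_1s_0 = s_0s_1s_0s_1. Then the map sending each tuple ((a_0,…,a_{n−1}), (k_0,…,k_{n−1})) with 1 ≤ a_i ≤ i+1 and 0 ≤ k_i ≤ d−1 to the element of G(d,1,n) represented by the word s_{0,a_0}^{(k_0)} s_{1,a_1}^{(k_1)} ⋯ s_{n−1,a_{n−1}}^{(k_{n−1})} is a bijection onto G(d,1,n); in particular G(d,1,n) is a finite group of order n!·d^n. -/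
/-- The defining relators of the complex reflection group `G(d,1,n)`:
`s_0^d`, `s_i^2` for `1 ≤ i ≤ n−1`, commutation relators for `|i−j| > 1`, the braid
relators `s_is_{i+1}s_i(s_{i+1}s_is_{i+1})⁻¹` for `1 ≤ i < n−1`, and
`s_1s_0s_1s_0(s_0s_1s_0s_1)⁻¹`. -/
inductive GRels (d n : ℕ) : FreeGroup (Fin n) → Prop
  | pow_zero (h : 0 < n) : GRels d n ((FreeGroup.of (⟨0, h⟩ : Fin n)) ^ d)
  | sq (i : ℕ) (h1 : 1 ≤ i) (h2 : i < n) : GRels d n ((FreeGroup.of (⟨i, h2⟩ : Fin n)) ^ 2)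
  | comm (i j : ℕ) (hij : j + 1 < i) (hi : i < n) :
      GRels d n (FreeGroup.of (⟨i, hi⟩ : Fin n) * FreeGroup.of (⟨j, by omega⟩ : Fin n) *
        (FreeGroup.of (⟨i, hi⟩ : Fin n))⁻¹ * (FreeGroup.of (⟨j, by omega⟩ : Fin n))⁻¹)
  | braid (i : ℕ) (h1 : 1 ≤ i) (h2 : i + 1 < n) :
      GRels d n
        (FreeGroup.of (⟨i, by omega⟩ : Fin n) * FreeGroup.of (⟨i + 1, h2⟩ : Fin n) *
          FreeGroup.of (⟨i, by omega⟩ : Fin n) *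
          (FreeGroup.of (⟨i + 1, h2⟩ : Fin n) * FreeGroup.of (⟨i, by omega⟩ : Fin n) *
            FreeGroup.of (⟨i + 1, h2⟩ : Fin n))⁻¹)
  | braid01 (h : 1 < n) :
      GRels d n
        (FreeGroup.of (⟨1, h⟩ : Fin n) * FreeGroup.of (⟨0, by omega⟩ : Fin n) *
          FreeGroup.of (⟨1, h⟩ : Fin n) * FreeGroup.of (⟨0, by omega⟩ : Fin n) *
          (FreeGroup.of (⟨0, by omega⟩ : Fin n) * FreeGroup.of (⟨1, h⟩ : Fin n) *
            FreeGroup.of (⟨0, by omega⟩ : Fin n) * FreeGroup.of (⟨1, h⟩ : Fin n))⁻¹)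

/-- The complex reflection group `G(d,1,n)`, given by its presentation. -/
abbrev GroupG (d n : ℕ) : Type := PresentedGroup {w | GRels d n w}

/-- The generator `s_i` of `G(d,1,n)` (by convention `1` for `i ≥ n`). -/
def sG (d n : ℕ) (i : ℕ) : GroupG d n :=
  if h : i < n then PresentedGroup.of ⟨i, h⟩ else 1

/-- The word `s_{i,a}^{(k)}`: equal to `s_{i,a}` if `k = 0`, and to
`s_{i,1}s_0^k s^{1,a−1}` if `1 ≤ k ≤ d−1`. -/
def blockG (i a k : ℕ) : List ℕ :=
  if k = 0 then sdecW i a else sdecW i 1 ++ List.replicate k 0 ++ sincW (a - 1)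

/-- The canonical word `s_{0,a_0}^{(k_0)} s_{1,a_1}^{(k_1)} ⋯ s_{n−1,a_{n−1}}^{(k_{n−1})}`
associated to the tuple `((a_0,…,a_{n−1}), (k_0,…,k_{n−1}))`. -/
def canonWordG (n : ℕ) (a k : Fin n → ℕ) : List ℕ :=
  ((List.finRange n).map (fun i : Fin n => blockG (i : ℕ) (a i) (k i))).flatten

section Relations

variable {d n : ℕ}

theorem sG_of_lt {i : ℕ} (h : i < n) : sG d n i = PresentedGroup.of ⟨i, h⟩ := dif_pos h

theorem sG_zero_pow (h : 0 < n) : sG d n 0 ^ d = 1 := by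
  rw [sG_of_lt h]
  exact PresentedGroup.one_of_mem (rels := {w | GRels d n w}) (GRels.pow_zero h)

theorem sG_mul_self {i : ℕ} (h1 : 1 ≤ i) (h2 : i < n) : sG d n i * sG d n i = 1 := by
  rw [sG_of_lt h2, ← pow_two]
  exact PresentedGroup.one_of_mem (rels := {w | GRels d n w}) (GRels.sq i h1 h2)

theorem sG_inv {i : ℕ} (h1 : 1 ≤ i) (h2 : i < n) : (sG d n i)⁻¹ = sG d n i :=
  inv_eq_of_mul_eq_one_left (sG_mul_self h1 h2)

theorem sG_commute {i j : ℕ} (hij : j + 1 < i) (hi : i < n) :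
    Commute (sG d n i) (sG d n j) := by
  rw [sG_of_lt hi, sG_of_lt (show j < n by omega), ← commutatorElement_eq_one_iff_commute]
  exact PresentedGroup.one_of_mem (rels := {w | GRels d n w}) (GRels.comm i j hij hi)

theorem sG_braid {i : ℕ} (h1 : 1 ≤ i) (h2 : i + 1 < n) :
    sG d n i * sG d n (i + 1) * sG d n i = sG d n (i + 1) * sG d n i * sG d n (i + 1) := by
  rw [sG_of_lt h2, sG_of_lt (show i < n by omega), ← mul_inv_eq_one]
  exact PresentedGroup.one_of_mem (rels := {w | GRels d n w}) (GRels.braid i h1 h2)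

theorem sG_braid_zero_one (h : 1 < n) :
    sG d n 1 * sG d n 0 * sG d n 1 * sG d n 0 = sG d n 0 * sG d n 1 * sG d n 0 * sG d n 1 := by
  rw [sG_of_lt h, sG_of_lt (show 0 < n by omega), ← mul_inv_eq_one]
  exact PresentedGroup.one_of_mem (rels := {w | GRels d n w}) (GRels.braid01 h)

end Relations

/-- The element `s_m s_{m-1} ⋯ s_1` of `G(d,1,n)`. -/
def decG (d n : ℕ) : ℕ → GroupG d n
  | 0 => 1
  | m + 1 => sG d n (m + 1) * decG d n m

/-- The element `s_m ⋯ s_1 s_0^k (s_{a-1} ⋯ s_1)⁻¹` of `G(d,1,n)`. -/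
def blockElt (d n m a k : ℕ) : GroupG d n :=
  decG d n m * sG d n 0 ^ k * (decG d n (a - 1))⁻¹

/-- The product of the first `m` blocks with parameters `a` and `k`. -/
def blockProd (d n : ℕ) (a k : ℕ → ℕ) : ℕ → GroupG d n
  | 0 => 1
  | m + 1 => blockProd d n a k m * blockElt d n m (a m) (k m)

/-- The parameters `a`, `k` are those of a canonical word with `m` blocks. -/
def IsCanonical (d m : ℕ) (a k : ℕ → ℕ) : Prop :=
  ∀ i < m, (1 ≤ a i ∧ a i ≤ i + 1) ∧ k i < d

/-- Extension of a finite tuple by `0`. -/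
def extendNat {n : ℕ} (a : Fin n → ℕ) (i : ℕ) : ℕ := if h : i < n then a ⟨i, h⟩ else 0

section Words

variable {d n : ℕ}

theorem sdecW_self_succ (i : ℕ) : sdecW i (i + 1) = [] := by simp [sdecW]

theorem sdecW_eq_append {i a : ℕ} (h : a ≤ i) : sdecW i a = sdecW i (a + 1) ++ [a] := by
  obtain ⟨c, rfl⟩ := Nat.exists_eq_add_of_le h
  have h1 : a + c + 1 - a = c + 1 := by omega
  have h2 : a + c + 1 - (a + 1) = c := by omega
  simp [sdecW, h1, h2, List.range'_succ]

theorem sdecW_succ_one (i : ℕ) : sdecW (i + 1) 1 = (i + 1) :: sdecW i 1 := by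
  simp [sdecW, List.range'_concat, add_comm]

theorem sdecW_one_prod (i : ℕ) : ((sdecW i 1).map (sG d n)).prod = decG d n i := by
  induction i with
  | zero => simp [sdecW, decG]
  | succ i ih => simp [sdecW_succ_one, decG, ih]

theorem sdecW_prod {i a : ℕ} (ha : a ≤ i) :
    ((sdecW i (a + 1)).map (sG d n)).prod = decG d n i * (decG d n a)⁻¹ := by
  induction a with
  | zero => simp [sdecW_one_prod, decG]
  | succ a ih =>
    have h := ih (by omega)
    rw [sdecW_eq_append ha, List.map_append, List.prod_append] at h
    simp only [List.map_cons, List.map_nil, List.prod_cons, List.prod_nil, mul_one] at h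
    rw [decG, mul_inv_rev, ← mul_assoc, ← h, mul_inv_cancel_right]

theorem sincW_prod {j : ℕ} (hj : j < n) :
    ((sincW j).map (sG d n)).prod = (decG d n j)⁻¹ := by
  induction j with
  | zero => simp [sincW, decG]
  | succ j ih =>
    have h := ih (by omega)
    rw [sincW] at h ⊢
    rw [List.range'_concat, List.map_append, List.prod_append, h, decG, mul_inv_rev,
      sG_inv (by omega) hj]
    simp [add_comm]

theorem blockG_prod {i a k : ℕ} (hi : i < n) (h1 : 1 ≤ a) (h2 : a ≤ i + 1) :
    ((blockG i a k).map (sG d n)).prod = blockElt d n i a k := by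
  obtain ⟨b, rfl⟩ := Nat.exists_eq_add_of_le' h1
  unfold blockG blockElt
  split_ifs with hk
  · rcases Nat.lt_or_ge i (b + 1) with h | h
    · obtain rfl : b = i := by omega
      simp [hk, sdecW_self_succ]
    · simp [hk, sdecW_prod (show b ≤ i by omega)]
  · simp [sdecW_one_prod, sincW_prod (show b < n by omega), mul_assoc]

theorem blockProd_eq_prod_range (a k : ℕ → ℕ) (m : ℕ) :
    blockProd d n a k m = ((List.range m).map fun i => blockElt d n i (a i) (k i)).prod := by
  induction m with
  | zero => simp [blockProd]
  | succ m ih => simp [blockProd, ih, List.range_succ]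

theorem blockProd_congr {a k a' k' : ℕ → ℕ} {m : ℕ}
    (h : ∀ i < m, a i = a' i ∧ k i = k' i) :
    blockProd d n a k m = blockProd d n a' k' m := by
  induction m with
  | zero => rfl
  | succ m ih =>
    rw [blockProd, blockProd, ih fun i hi => h i (by omega), (h m (by omega)).1,
      (h m (by omega)).2]

theorem canonWordG_prod {a k : Fin n → ℕ} (ha : ∀ i, 1 ≤ a i ∧ a i ≤ (i : ℕ) + 1) :
    ((canonWordG n a k).map (sG d n)).prod = blockProd d n (extendNat a) (extendNat k) n := by
  rw [blockProd_eq_prod_range, ← List.map_coe_finRange_eq_range, canonWordG, List.map_flatten,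
    List.prod_flatten, List.map_map, List.map_map, List.map_map]
  congr 1
  apply List.map_congr_left
  intro i _
  simp [extendNat, blockG_prod i.2 (ha i).1 (ha i).2]

theorem isCanonical_extendNat (hd : 0 < d) {a k : Fin n → ℕ}
    (ha : ∀ i, 1 ≤ a i ∧ a i ≤ (i : ℕ) + 1) (hk : ∀ i, k i ≤ d - 1) :
    IsCanonical d n (extendNat a) (extendNat k) := by
  intro i hi
  have h1 := ha ⟨i, hi⟩
  have h2 := hk ⟨i, hi⟩
  simp only [extendNat, hi, dif_pos]
  exact ⟨h1, by omega⟩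

end Words

section Rewriting

variable {d n : ℕ}

theorem decG_commute {p j : ℕ} (h : p + 1 < j) (hj : j < n) :
    Commute (decG d n p) (sG d n j) := by
  induction p with
  | zero => exact Commute.one_left _
  | succ p ih => exact (sG_commute h hj).symm.mul_left (ih (by omega))

theorem decG_mul_sG {m j : ℕ} (h1 : 1 ≤ j) (h2 : j < m) (hm : m < n) :
    decG d n m * sG d n (j + 1) = sG d n j * decG d n m := by
  induction m with
  | zero => omega
  | succ m ih =>
    rcases Nat.lt_succ_iff_lt_or_eq.mp h2 with h | rfl
    · rw [decG, mul_assoc, ih h (by omega), ← mul_assoc, ← mul_assoc,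
        (sG_commute (by omega) hm : Commute (sG d n (m + 1)) (sG d n j)).eq]
    · obtain ⟨p, rfl⟩ := Nat.exists_eq_add_of_le' h1
      rw [decG, decG, mul_assoc, mul_assoc, (decG_commute (by omega) hm).eq]
      simp only [← mul_assoc]
      rw [sG_braid h1 hm]

theorem decG_mul_one_commute {p : ℕ} (h1 : 1 ≤ p) (hp : p < n) :
    Commute (decG d n p * sG d n 1) (sG d n 0) := by
  induction p, h1 using Nat.le_induction with
  | base =>
    rw [decG, decG, mul_one, zero_add, sG_mul_self le_rfl hp]
    exact Commute.one_left _
  | succ p h1 ih =>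
    rw [decG, mul_assoc]
    exact (sG_commute (by omega) hp).mul_left (ih (by omega))

theorem one_zero_pow_one_commute (hn : 1 < n) (k : ℕ) :
    Commute (sG d n 1 * sG d n 0 ^ k * sG d n 1) (sG d n 0) := by
  have h : Commute (sG d n 1 * sG d n 0 * (sG d n 1)⁻¹) (sG d n 0) := by
    rw [sG_inv le_rfl hn]
    exact (sG_braid_zero_one hn).trans (by simp only [mul_assoc])
  have h2 := h.pow_left k
  rwa [conj_pow, sG_inv le_rfl hn] at h2

theorem blockElt_commute_zero {m a : ℕ} (k : ℕ) (hm : m < n) (h1 : 2 ≤ a) (h2 : a ≤ m + 1) :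
    Commute (blockElt d n m a k) (sG d n 0) := by
  have h : blockElt d n m a k = (decG d n m * sG d n 1) *
      (sG d n 1 * sG d n 0 ^ k * sG d n 1) * (decG d n (a - 1) * sG d n 1)⁻¹ := by
    have hs := sG_mul_self (d := d) le_rfl (show 1 < n by omega)
    rw [blockElt, mul_inv_rev]
    simp only [mul_assoc, mul_inv_cancel_left]
    rw [← mul_assoc (sG d n 1) (sG d n 1), hs, one_mul]
  rw [h]
  exact ((decG_mul_one_commute (by omega) hm).mul_left
    (one_zero_pow_one_commute (by omega) k)).mul_left
      (decG_mul_one_commute (by omega) (by omega)).inv_left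

theorem blockElt_mul_sG {m a k j : ℕ} (hd : 0 < d) (hm : m < n) (h1 : 1 ≤ a) (h2 : a ≤ m + 1)
    (hk : k < d) (hj : j ≤ m) :
    (∃ a' k', 1 ≤ a' ∧ a' ≤ m + 1 ∧ k' < d ∧
      blockElt d n m a k * sG d n j = blockElt d n m a' k') ∨
    ∃ j' < m, blockElt d n m a k * sG d n j = sG d n j' * blockElt d n m a k := by
  obtain ⟨b, rfl⟩ := Nat.exists_eq_add_of_le' h1
  rcases Nat.eq_zero_or_pos j with rfl | hj0
  · rcases Nat.eq_zero_or_pos b with rfl | hb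
    · refine Or.inl ⟨1, (k + 1) % d, le_rfl, by omega, Nat.mod_lt _ hd, ?_⟩
      have : sG d n 0 ^ ((k + 1) % d) = sG d n 0 ^ (k + 1) :=
        (pow_eq_pow_mod _ (sG_zero_pow (by omega))).symm
      simp [blockElt, decG, this, pow_succ, mul_assoc]
    · exact Or.inr ⟨0, by omega, (blockElt_commute_zero k hm (by omega) h2).eq⟩
  rcases lt_trichotomy j (b + 1) with h | rfl | h
  · rcases Nat.lt_succ_iff_lt_or_eq.mp h with h | rfl
    · refine Or.inr ⟨j, by omega, ?_⟩
      have e1 : (decG d n b)⁻¹ * sG d n j = sG d n (j + 1) * (decG d n b)⁻¹ := by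
        rw [inv_mul_eq_iff_eq_mul, ← mul_assoc, decG_mul_sG hj0 h (by omega),
          mul_inv_cancel_right]
      have e2 : Commute (sG d n (j + 1)) (sG d n 0 ^ k) :=
        (sG_commute (by omega) (by omega)).pow_right k
      rw [blockElt, Nat.add_sub_cancel, mul_assoc, e1, mul_assoc, ← mul_assoc _ _ (decG d n b)⁻¹,
        ← e2.eq, mul_assoc, ← mul_assoc, decG_mul_sG hj0 (by omega) hm]
      simp only [mul_assoc]
    · obtain ⟨c, rfl⟩ := Nat.exists_eq_add_of_le' hj0
      refine Or.inl ⟨c + 1, k, by omega, by omega, hk, ?_⟩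
      simp [blockElt, decG, mul_assoc]
  · refine Or.inl ⟨b + 2, k, by omega, by omega, hk, ?_⟩
    rw [blockElt, blockElt, show b + 2 - 1 = b + 1 from rfl, decG, mul_inv_rev,
      sG_inv hj0 (by omega), Nat.add_sub_cancel]
    simp only [mul_assoc]
  · obtain ⟨i, rfl⟩ := Nat.exists_eq_add_of_le' hj0
    refine Or.inr ⟨i, by omega, ?_⟩
    have e1 : Commute (sG d n 0 ^ k * (decG d n b)⁻¹) (sG d n (i + 1)) :=
      ((sG_commute (by omega) (by omega)).symm.pow_left k).mul_left
        (decG_commute (by omega) (by omega)).inv_left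
    rw [blockElt, Nat.add_sub_cancel, mul_assoc (decG d n m), mul_assoc (decG d n m), e1.eq,
      ← mul_assoc, decG_mul_sG (by omega) (by omega) hm, mul_assoc]

theorem exists_blockProd_mul_sG (hd : 0 < d) {m : ℕ} (hm : m ≤ n) {a k : ℕ → ℕ}
    (h : IsCanonical d m a k) {j : ℕ} (hj : j < m) :
    ∃ a' k', IsCanonical d m a' k' ∧
      blockProd d n a k m * sG d n j = blockProd d n a' k' m := by
  induction m generalizing a k j with
  | zero => omega
  | succ m ih =>
    have extend (a₁ k₁ : ℕ → ℕ) (b l : ℕ) (h₁ : IsCanonical d m a₁ k₁) (hb1 : 1 ≤ b)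
        (hb2 : b ≤ m + 1) (hl : l < d) : ∃ a' k', IsCanonical d (m + 1) a' k' ∧
        blockProd d n a₁ k₁ m * blockElt d n m b l = blockProd d n a' k' (m + 1) := by
      refine ⟨Function.update a₁ m b, Function.update k₁ m l, fun i hi => ?_, ?_⟩
      · rcases Nat.lt_succ_iff_lt_or_eq.mp hi with hi | rfl
        · simpa [hi.ne] using h₁ i hi
        · simpa using ⟨⟨hb1, hb2⟩, hl⟩
      · rw [blockProd, Function.update_self, Function.update_self]
        congr 1
        exact blockProd_congr fun i hi => by simp [hi.ne]
    have h' : IsCanonical d m a k := fun i hi => h i (by omega)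
    obtain ⟨⟨ha1, ha2⟩, hk⟩ := h m (by omega)
    rw [blockProd, mul_assoc]
    rcases blockElt_mul_sG hd (by omega : m < n) ha1 ha2 hk (Nat.lt_succ_iff.mp hj) with
      ⟨b, l, hb1, hb2, hl, e⟩ | ⟨j', hj', e⟩
    · rw [e]
      exact extend a k b l h' hb1 hb2 hl
    · obtain ⟨a₁, k₁, h₁, e₁⟩ := ih (by omega) h' hj'
      rw [e, ← mul_assoc, e₁]
      exact extend a₁ k₁ _ _ h₁ ha1 ha2 hk

theorem exists_blockProd_mul_sG_pow (hd : 0 < d) {a k : ℕ → ℕ}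
    (h : IsCanonical d n a k) {j : ℕ} (hj : j < n) (p : ℕ) :
    ∃ a' k', IsCanonical d n a' k' ∧
      blockProd d n a k n * sG d n j ^ p = blockProd d n a' k' n := by
  induction p with
  | zero => exact ⟨a, k, h, by simp⟩
  | succ p ih =>
    obtain ⟨a₁, k₁, h₁, e₁⟩ := ih
    rw [pow_succ, ← mul_assoc, e₁]
    exact exists_blockProd_mul_sG hd le_rfl h₁ hj

theorem exists_sG_inv_eq_pow (hd : 0 < d) {j : ℕ} (hj : j < n) :
    ∃ p, (sG d n j)⁻¹ = sG d n j ^ p := by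
  rcases Nat.eq_zero_or_pos j with rfl | h
  · refine ⟨d - 1, inv_eq_of_mul_eq_one_left ?_⟩
    rw [pow_sub_one_mul hd.ne', sG_zero_pow hj]
  · exact ⟨1, by rw [pow_one, sG_inv h hj]⟩

theorem exists_blockProd_eq_one (hd : 0 < d) :
    ∃ a k, IsCanonical d n a k ∧ blockProd d n a k n = 1 := by
  refine ⟨fun i => i + 1, fun _ => 0, fun i _ => by simpa using hd, ?_⟩
  suffices h : ∀ m, blockProd d n (fun i => i + 1) (fun _ => 0) m = 1 from h n
  intro m
  induction m with
  | zero => rfl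
  | succ m ih => simp [blockProd, ih, blockElt]

theorem exists_blockProd_eq (hd : 0 < d) (x : GroupG d n) :
    ∃ a k, IsCanonical d n a k ∧ blockProd d n a k n = x := by
  have hx : x ∈ Subgroup.closure (Set.range (PresentedGroup.of (rels := {w | GRels d n w}))) := by
    rw [PresentedGroup.closure_range_of]
    trivial
  induction hx using Subgroup.closure_induction_right with
  | one => exact exists_blockProd_eq_one hd
  | mul_right x _ y hy ih =>
    obtain ⟨⟨j, hj⟩, rfl⟩ := hy
    obtain ⟨a, k, h, rfl⟩ := ih
    obtain ⟨a', k', h', e⟩ := exists_blockProd_mul_sG hd le_rfl h hj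
    exact ⟨a', k', h', by rw [← e, sG_of_lt hj]⟩
  | mul_inv_cancel x _ y hy ih =>
    obtain ⟨⟨j, hj⟩, rfl⟩ := hy
    obtain ⟨a, k, h, rfl⟩ := ih
    obtain ⟨p, hp⟩ := exists_sG_inv_eq_pow (n := n) hd hj
    obtain ⟨a', k', h', e⟩ := exists_blockProd_mul_sG_pow hd h hj p
    exact ⟨a', k', h', by rw [← e, ← hp, sG_of_lt hj]⟩

end Rewriting

section Action

/-- The permutation of `ℕ × ZMod d` by which `s_i` acts: `s_0` increments the colour of the
point `0`, and `s_i` swaps the points `i - 1` and `i` for `i ≥ 1`. -/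
def colouredPerm (d : ℕ) : ℕ → Equiv.Perm (ℕ × ZMod d)
  | 0 =>
    { toFun := fun x => if x.1 = 0 then (0, x.2 + 1) else x
      invFun := fun x => if x.1 = 0 then (0, x.2 - 1) else x
      left_inv := fun x => by rcases x with ⟨_ | x, c⟩ <;> simp
      right_inv := fun x => by rcases x with ⟨_ | x, c⟩ <;> simp }
  | i + 1 => Equiv.prodCongr (Equiv.swap i (i + 1)) (Equiv.refl _)

variable {d n : ℕ}

theorem colouredPerm_zero_apply (x : ℕ) (c : ZMod d) :
    colouredPerm d 0 (x, c) = (x, if x = 0 then c + 1 else c) := by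
  by_cases h : x = 0 <;> simp [colouredPerm, h]

theorem colouredPerm_succ_apply (i x : ℕ) (c : ZMod d) :
    colouredPerm d (i + 1) (x, c) = (if x = i then i + 1 else if x = i + 1 then i else x, c) := by
  simp [colouredPerm, Equiv.swap_apply_def]

theorem colouredPerm_zero_pow_apply (p x : ℕ) (c : ZMod d) :
    (colouredPerm d 0 ^ p) (x, c) = (x, if x = 0 then c + p else c) := by
  induction p generalizing c with
  | zero => simp
  | succ p ih =>
    rw [pow_succ, Equiv.Perm.mul_apply, colouredPerm_zero_apply, ih]
    split_ifs
    · push_cast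
      ring_nf
    · rfl

theorem colouredPerm_apply_of_lt {j x : ℕ} (h : j < x) (c : ZMod d) :
    colouredPerm d j (x, c) = (x, c) := by
  rcases j with _ | j
  · rw [colouredPerm_zero_apply, if_neg (by omega)]
  · rw [colouredPerm_succ_apply, if_neg (by omega), if_neg (by omega)]

theorem colouredPerm_rels (w : FreeGroup (Fin n)) (hw : w ∈ {w | GRels d n w}) :
    FreeGroup.lift (fun i : Fin n => colouredPerm d i) w = 1 := by
  cases hw with
  | pow_zero h =>
    ext1 ⟨x, c⟩
    simp [colouredPerm_zero_pow_apply]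
  | sq i h1 h2 =>
    obtain ⟨i, rfl⟩ := Nat.exists_eq_add_of_le' h1
    rw [map_pow, FreeGroup.lift_apply_of, pow_two]
    ext1 ⟨x, c⟩
    simp only [Equiv.Perm.mul_apply, colouredPerm_succ_apply, Equiv.Perm.one_apply]
    grind
  | comm i j hij hi =>
    simp only [map_mul, map_inv, FreeGroup.lift_apply_of]
    rw [mul_inv_eq_one, mul_inv_eq_iff_eq_mul]
    obtain ⟨i, rfl⟩ := Nat.exists_eq_add_of_le' (show 1 ≤ i by omega)
    ext1 ⟨x, c⟩
    rcases j with _ | j <;>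
      simp only [Equiv.Perm.mul_apply, colouredPerm_succ_apply, colouredPerm_zero_apply] <;>
      grind
  | braid i h1 h2 =>
    obtain ⟨i, rfl⟩ := Nat.exists_eq_add_of_le' h1
    simp only [map_mul, map_inv, FreeGroup.lift_apply_of]
    rw [mul_inv_eq_one]
    ext1 ⟨x, c⟩
    simp only [Equiv.Perm.mul_apply, colouredPerm_succ_apply]
    grind
  | braid01 h =>
    simp only [map_mul, map_inv, FreeGroup.lift_apply_of]
    rw [mul_inv_eq_one]
    ext1 ⟨x, c⟩
    rw [show (1 : ℕ) = 0 + 1 from rfl]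
    simp only [Equiv.Perm.mul_apply, colouredPerm_succ_apply, colouredPerm_zero_apply]
    grind

/-- The action of `G(d,1,n)` on `ℕ × ZMod d` by coloured permutations. -/
def colouredHom (d n : ℕ) : GroupG d n →* Equiv.Perm (ℕ × ZMod d) :=
  PresentedGroup.toGroup (f := fun i : Fin n => colouredPerm d i) colouredPerm_rels

theorem colouredHom_sG {i : ℕ} (hi : i < n) : colouredHom d n (sG d n i) = colouredPerm d i := by
  rw [sG_of_lt hi, colouredHom, PresentedGroup.toGroup.of]

theorem colouredHom_decG_apply_zero {m : ℕ} (hm : m < n) (c : ZMod d) :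
    colouredHom d n (decG d n m) (0, c) = (m, c) := by
  induction m with
  | zero => simp [decG]
  | succ m ih =>
    rw [decG, map_mul, Equiv.Perm.mul_apply, ih (by omega), colouredHom_sG hm,
      colouredPerm_succ_apply, if_pos rfl]

theorem colouredHom_decG_apply_of_lt {m x : ℕ} (hm : m < n) (h : m < x) (c : ZMod d) :
    colouredHom d n (decG d n m) (x, c) = (x, c) := by
  induction m with
  | zero => simp [decG]
  | succ m ih =>
    rw [decG, map_mul, Equiv.Perm.mul_apply, ih (by omega) (by omega), colouredHom_sG hm,
      colouredPerm_apply_of_lt h]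

theorem colouredHom_blockElt_apply {m a k : ℕ} (hm : m < n) (h1 : 1 ≤ a) (h2 : a ≤ m + 1) :
    colouredHom d n (blockElt d n m a k) (a - 1, -(k : ZMod d)) = (m, 0) := by
  have h : (colouredHom d n (decG d n (a - 1)))⁻¹ (a - 1, -(k : ZMod d)) =
      (0, -(k : ZMod d)) := by
    rw [Equiv.Perm.inv_eq_iff_eq, colouredHom_decG_apply_zero (by omega)]
  rw [blockElt, map_mul, map_mul, map_pow, map_inv, Equiv.Perm.mul_apply, h,
    Equiv.Perm.mul_apply, colouredHom_sG (by omega), colouredPerm_zero_pow_apply, if_pos rfl,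
    neg_add_cancel, colouredHom_decG_apply_zero hm]

theorem colouredHom_blockElt_apply_of_lt {m a k x : ℕ} (hm : m < n) (h1 : 1 ≤ a)
    (h2 : a ≤ m + 1) (h : m < x) (c : ZMod d) :
    colouredHom d n (blockElt d n m a k) (x, c) = (x, c) := by
  have h' : (colouredHom d n (decG d n (a - 1)))⁻¹ (x, c) = (x, c) := by
    rw [Equiv.Perm.inv_eq_iff_eq, colouredHom_decG_apply_of_lt (by omega) (by omega)]
  rw [blockElt, map_mul, map_mul, map_pow, map_inv, Equiv.Perm.mul_apply, h',
    Equiv.Perm.mul_apply, colouredHom_sG (by omega), colouredPerm_zero_pow_apply,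
    if_neg (by omega), colouredHom_decG_apply_of_lt hm h]

theorem colouredHom_blockProd_apply_of_le {m x : ℕ} (hm : m ≤ n) {a k : ℕ → ℕ}
    (h : IsCanonical d m a k) (hx : m ≤ x) (c : ZMod d) :
    colouredHom d n (blockProd d n a k m) (x, c) = (x, c) := by
  induction m with
  | zero => simp [blockProd]
  | succ m ih =>
    obtain ⟨⟨h1, h2⟩, -⟩ := h m (by omega)
    rw [blockProd, map_mul, Equiv.Perm.mul_apply,
      colouredHom_blockElt_apply_of_lt (by omega) h1 h2 hx,
      ih (by omega) (fun i hi => h i (by omega)) (by omega)]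

theorem blockProd_injective {m : ℕ} (hm : m ≤ n) {a k a' k' : ℕ → ℕ}
    (h : IsCanonical d m a k) (h' : IsCanonical d m a' k')
    (e : blockProd d n a k m = blockProd d n a' k' m) :
    ∀ i < m, a i = a' i ∧ k i = k' i := by
  induction m with
  | zero => intro i hi; omega
  | succ m ih =>
    have image (b l : ℕ → ℕ) (hb : IsCanonical d (m + 1) b l) :
        colouredHom d n (blockProd d n b l (m + 1)) (b m - 1, -(l m : ZMod d)) = (m, 0) := by
      obtain ⟨⟨h1, h2⟩, -⟩ := hb m (by omega)
      rw [blockProd, map_mul, Equiv.Perm.mul_apply, colouredHom_blockElt_apply (by omega) h1 h2,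
        colouredHom_blockProd_apply_of_le (by omega) (fun i hi => hb i (by omega)) le_rfl]
    have hp := image a k h
    rw [e, ← image a' k' h', (Equiv.injective _).eq_iff, Prod.mk.injEq, neg_inj,
      ZMod.natCast_eq_natCast_iff'] at hp
    obtain ⟨⟨h1, h2⟩, h3⟩ := h m (by omega)
    obtain ⟨⟨h1', h2'⟩, h3'⟩ := h' m (by omega)
    rw [Nat.mod_eq_of_lt h3, Nat.mod_eq_of_lt h3'] at hp
    have hm' : a m = a' m ∧ k m = k' m := ⟨by omega, hp.2⟩
    rw [blockProd, blockProd, hm'.1, hm'.2, mul_left_inj] at e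
    intro i hi
    rcases Nat.lt_succ_iff_lt_or_eq.mp hi with hi | rfl
    · exact ih (by omega) (fun i hi => h i (by omega)) (fun i hi => h' i (by omega)) e i hi
    · exact hm'

end Action

theorem card_canonical_tuples (d n : ℕ) (hd : 0 < d) :
    Nat.card {ak : (Fin n → ℕ) × (Fin n → ℕ) //
      (∀ i, 1 ≤ ak.1 i ∧ ak.1 i ≤ (i : ℕ) + 1) ∧ (∀ i, ak.2 i ≤ d - 1)} =
      n.factorial * d ^ n := by
  rw [Nat.subtype_card
    (Fintype.piFinset (fun i : Fin n => Finset.Icc 1 ((i : ℕ) + 1)) ×ˢ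
      Fintype.piFinset (fun _ : Fin n => Finset.range d))]
  · rw [Finset.card_product, Fintype.card_piFinset, Fintype.card_piFinset]
    simp only [Nat.card_Icc, Nat.add_sub_cancel, Finset.card_range, Finset.prod_const,
      Finset.card_univ, Fintype.card_fin]
    rw [Fin.prod_univ_eq_prod_range (fun i => i + 1) n, Finset.prod_range_add_one_eq_factorial]
  · intro x
    simp [Fintype.mem_piFinset, Nat.le_sub_one_iff_lt hd]

/-- The canonical form for `G(d,1,n)`: the map sending each tuple
`((a_0,…,a_{n−1}), (k_0,…,k_{n−1}))` with `1 ≤ a_i ≤ i+1` and `0 ≤ k_i ≤ d−1` to the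
element of `G(d,1,n)` represented by the corresponding canonical word is a bijection
onto `G(d,1,n)`; in particular `G(d,1,n)` is a finite group of order `n!·d^n`. -/
theorem canonical_form_G (d n : ℕ) (hd : 2 ≤ d) (hn : 2 ≤ n) :
    Function.Bijective
      (fun t : {ak : (Fin n → ℕ) × (Fin n → ℕ) //
          (∀ i, 1 ≤ ak.1 i ∧ ak.1 i ≤ (i : ℕ) + 1) ∧ (∀ i, ak.2 i ≤ d - 1)} =>
        ((canonWordG n t.val.1 t.val.2).map (sG d n)).prod) ∧
    Finite (GroupG d n) ∧ Nat.card (GroupG d n) = n.factorial * d ^ n := by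
  have hinj : Function.Injective
      (fun t : {ak : (Fin n → ℕ) × (Fin n → ℕ) //
          (∀ i, 1 ≤ ak.1 i ∧ ak.1 i ≤ (i : ℕ) + 1) ∧ (∀ i, ak.2 i ≤ d - 1)} =>
        ((canonWordG n t.val.1 t.val.2).map (sG d n)).prod) := by
    rintro ⟨⟨a, k⟩, ha, hk⟩ ⟨⟨a', k'⟩, ha', hk'⟩ h
    simp only at ha hk ha' hk' h
    rw [canonWordG_prod ha, canonWordG_prod ha'] at h
    have key := blockProd_injective le_rfl
      (isCanonical_extendNat (by omega) ha hk) (isCanonical_extendNat (by omega) ha' hk') h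
    simp only [Subtype.mk.injEq, Prod.mk.injEq]
    constructor <;> funext i
    · simpa [extendNat] using (key i i.2).1
    · simpa [extendNat] using (key i i.2).2
  have hsurj : Function.Surjective
      (fun t : {ak : (Fin n → ℕ) × (Fin n → ℕ) //
          (∀ i, 1 ≤ ak.1 i ∧ ak.1 i ≤ (i : ℕ) + 1) ∧ (∀ i, ak.2 i ≤ d - 1)} =>
        ((canonWordG n t.val.1 t.val.2).map (sG d n)).prod) := by
    intro x
    obtain ⟨a, k, h, rfl⟩ := exists_blockProd_eq (by omega : 0 < d) x
    refine ⟨⟨(fun i => a i, fun i => k i), fun i => (h i i.2).1, fun i => ?_⟩, ?_⟩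
    · have := (h i i.2).2
      simp only
      omega
    · simp only
      rw [canonWordG_prod fun i => (h i i.2).1]
      apply blockProd_congr
      intro i hi
      simp [extendNat, hi]
  have hcard := card_canonical_tuples d n (by omega)
  have : Finite {ak : (Fin n → ℕ) × (Fin n → ℕ) //
      (∀ i, 1 ≤ ak.1 i ∧ ak.1 i ≤ (i : ℕ) + 1) ∧ (∀ i, ak.2 i ≤ d - 1)} := by
    apply Nat.finite_of_card_ne_zero
    rw [hcard]
    positivity
  exact ⟨⟨hinj, hsurj⟩, Finite.of_surjective _ hsurj,
    (Nat.card_eq_of_bijective _ ⟨hinj, hsurj⟩).symm.trans hcard⟩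
end

section
/- For every integer n ≥ 3, the identity C(n,0)·(2^{n−1} − 1) + Σ_{k=1}^{n−2} C(n,k)·2^{n−k−1} + 2·C(n,n−1) + C(n,n) = (n+2)·C_n − 1 holds, where C(n,k) = (n+k)!·(n−k+1)/(k!·(n+1)!) and C_n = binom(2n,n)/(n+1). -/
/-- The Catalan triangle entry `C(n,k) = (n+k)!·(n−k+1)/(k!·(n+1)!)`. -/
def catalanTri (n k : ℕ) : ℕ :=
  ((n + k).factorial * (n - k + 1)) / (k.factorial * (n + 1).factorial)

/-- The Catalan triangle polynomial `𝔉_{n,k}(x) = Σ_{s=0}^k C(n,s)·x^{k−s}`. -/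
def catalanTriPoly (n k x : ℕ) : ℕ :=
  ∑ s ∈ Finset.range (k + 1), catalanTri n s * x ^ (k - s)

theorem catalanTri_zero (n : ℕ) : catalanTri n 0 = 1 := by
  simp only [catalanTri, add_zero, Nat.sub_zero, Nat.factorial_zero, one_mul]
  rw [Nat.factorial_succ, mul_comm]
  exact Nat.div_self (by positivity)

theorem catalanTri_succ_add_choose {n k : ℕ} (hk : k < n) :
    catalanTri n (k + 1) + (n + k + 1).choose k = (n + k + 1).choose (k + 1) := by
  have h0 := Nat.choose_mul_factorial_mul_factorial (n := n + k + 1) (k := k) (by omega)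
  have h1 := Nat.choose_mul_factorial_mul_factorial (n := n + k + 1) (k := k + 1) (by omega)
  rw [show n + k + 1 - k = n + 1 by omega] at h0
  rw [show n + k + 1 - (k + 1) = n by omega] at h1
  have hle : (n + k + 1).choose k ≤ (n + k + 1).choose (k + 1) := by
    have h := Nat.choose_succ_right_eq (n + k + 1) k
    rw [show n + k + 1 - k = n + 1 by omega] at h
    nlinarith [Nat.zero_le ((n + k + 1).choose k)]
  obtain ⟨d, hd⟩ := Nat.exists_eq_add_of_le hle
  obtain ⟨m, rfl⟩ := Nat.exists_eq_add_of_lt hk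
  have key : catalanTri (k + m + 1) (k + 1) = d := by
    unfold catalanTri
    apply Nat.div_eq_of_eq_mul_right (by positivity)
    rw [show k + m + 1 - (k + 1) + 1 = m + 1 by omega, ← add_assoc]
    rw [hd] at h1
    generalize (k + m + 1 + k + 1).choose k = c at *
    generalize (k + m + 1 + k + 1).factorial = N at *
    rw [Nat.factorial_succ (k + m + 1)] at *
    rw [Nat.factorial_succ k] at *
    zify at *
    linear_combination (-(k + m + 2 : ℤ)) * h1 + (k + 1 : ℤ) * h0
  rw [key, hd, add_comm]

theorem catalanTriPoly_succ (n k x : ℕ) :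
    catalanTriPoly n (k + 1) x = x * catalanTriPoly n k x + catalanTri n (k + 1) := by
  simp only [catalanTriPoly]
  rw [Finset.sum_range_succ, Nat.sub_self, pow_zero, mul_one, Finset.mul_sum]
  congr 1
  refine Finset.sum_congr rfl fun s hs => ?_
  rw [Finset.mem_range] at hs
  rw [show k + 1 - s = k - s + 1 by omega, pow_succ]
  ring

theorem catalanTriPoly_two {n k : ℕ} (hk : k ≤ n) :
    catalanTriPoly n k 2 = (n + k + 1).choose k := by
  induction k with
  | zero => simp [catalanTriPoly, catalanTri_zero]
  | succ k ih =>
    have h := catalanTri_succ_add_choose (n := n) (k := k) (by omega)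
    have hp := Nat.choose_succ_succ (n + k + 1) k
    rw [catalanTriPoly_succ, ih (by omega), ← add_assoc n k 1]
    simp only [Nat.succ_eq_add_one] at hp
    omega

theorem succ_mul_catalanNum (n : ℕ) : (n + 1) * catalanNum n = (2 * n).choose n :=
  Nat.mul_div_cancel' (Nat.succ_dvd_centralBinom n)

theorem choose_two_mul_succ (m : ℕ) :
    (2 * (m + 1)).choose m = (m + 1) * catalanNum (m + 1) := by
  have h := Nat.choose_succ_right_eq (2 * (m + 1)) m
  rw [← succ_mul_catalanNum, show 2 * (m + 1) - m = m + 1 + 1 by omega] at h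
  apply Nat.eq_of_mul_eq_mul_right (Nat.succ_pos (m + 1))
  rw [Nat.succ_eq_add_one, ← h]
  ring

theorem catalanTri_self_succ (m : ℕ) :
    catalanTri (m + 1) (m + 1) = catalanNum (m + 1) := by
  have h := catalanTri_succ_add_choose (n := m + 1) (k := m) (by omega)
  rw [show m + 1 + m + 1 = 2 * (m + 1) by ring, choose_two_mul_succ,
    ← succ_mul_catalanNum] at h
  linarith

theorem catalanTri_succ_self (m : ℕ) :
    catalanTri (m + 1) m = catalanTri (m + 1) (m + 1) := by
  unfold catalanTri
  rw [← Nat.mul_div_mul_left _ _ (Nat.succ_pos m), show m + 1 - m + 1 = 2 by omega,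
    Nat.sub_self, ← add_assoc (m + 1) m 1, Nat.factorial_succ (m + 1 + m),
    Nat.factorial_succ m]
  congr 1 <;> rw [Nat.succ_eq_add_one] <;> ring

/-- For `n ≥ 3`,
`C(n,0)·(2^{n−1} − 1) + Σ_{k=1}^{n−2} C(n,k)·2^{n−k−1} + 2·C(n,n−1) + C(n,n) = (n+2)·C_n − 1`. -/
theorem packet_count_B (n : ℕ) (hn : 3 ≤ n) :
    catalanTri n 0 * (2 ^ (n - 1) - 1) +
      (∑ k ∈ Finset.Icc 1 (n - 2), catalanTri n k * 2 ^ (n - k - 1)) +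
      2 * catalanTri n (n - 1) + catalanTri n n = (n + 2) * catalanNum n - 1 := by
  obtain ⟨m, rfl⟩ := Nat.exists_eq_add_of_le' (show 2 ≤ n by omega)
  have hF := catalanTriPoly_two (n := m + 2) (k := m + 1) (by omega)
  rw [show m + 2 + (m + 1) + 1 = 2 * (m + 1 + 1) by ring, choose_two_mul_succ] at hF
  have hsum : ∑ k ∈ Finset.Icc 1 m, catalanTri (m + 2) k * 2 ^ (m + 2 - k - 1) =
      ∑ k ∈ Finset.range m, catalanTri (m + 2) (k + 1) * 2 ^ (m + 1 - (k + 1)) := by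
    rw [Finset.range_eq_Ico, Finset.sum_Ico_add'
      (fun k => catalanTri (m + 2) k * 2 ^ (m + 1 - k)) 0 m 1]
    refine Finset.sum_congr (by ext; simp) fun k _ => ?_
    rw [show m + 2 - k - 1 = m + 1 - k by omega]
  rw [catalanTriPoly, Finset.sum_range_succ, Finset.sum_range_succ', catalanTri_zero,
    Nat.sub_self, Nat.sub_zero, pow_zero, one_mul, mul_one, catalanTri_succ_self (m + 1),
    catalanTri_self_succ (m + 1)] at hF
  rw [show m + 2 - 2 = m by omega, show m + 2 - 1 = m + 1 by omega, hsum, catalanTri_zero,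
    catalanTri_succ_self (m + 1), catalanTri_self_succ (m + 1), one_mul]
  have hpow : 1 ≤ 2 ^ (m + 1) := Nat.one_le_two_pow
  rw [show (m + 2 + 2) * catalanNum (m + 1 + 1) =
    (m + 1 + 1) * catalanNum (m + 1 + 1) + 2 * catalanNum (m + 1 + 1) by ring, ← hF]
  omega
end

section
/- For all integers d ≥ 2 and n ≥ 3, the sizes of the packets of prefixes for G(d,1,n) are: |𝒫(n,0)| = (d−1)(d^{n−1} − 1); |𝒫(n,s)| = (d−1)·d^{n−1−s} for 1 ≤ s ≤ n−2; |𝒫(n,n−1)| = 2(d−1); |𝒫(n,n)| = 1. -/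
/-- A prefix for `G(d,1,n)`: a strictly increasing sequence
`0 ≤ i_1 < ⋯ < i_q ≤ n−1` together with exponents `k_1,…,k_q ∈ {1,…,d−1}`,
encoded as a pair of lists of common length `q`. -/
def IsPrefixG (d n : ℕ) (x : List ℕ × List ℕ) : Prop :=
  x.1.length = x.2.length ∧ x.1.Chain' (· < ·) ∧
    (∀ i ∈ x.1, i ≤ n - 1) ∧ (∀ k ∈ x.2, 1 ≤ k ∧ k ≤ d - 1)

/-- The prefixes all of whose indices are smaller than `m`. -/
def IsPrefixBelow (d m : ℕ) (x : List ℕ × List ℕ) : Prop :=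
  x.1.length = x.2.length ∧ x.1.Pairwise (· < ·) ∧
    (∀ i ∈ x.1, i < m) ∧ (∀ k ∈ x.2, 1 ≤ k ∧ k ≤ d - 1)

/-- Append the index `m` and an exponent to a prefix. -/
def snocPrefix (m : ℕ) (p : (List ℕ × List ℕ) × ℕ) : List ℕ × List ℕ :=
  (p.1.1 ++ [m], p.1.2 ++ [p.2])

lemma snocPrefix_injective (m : ℕ) : Function.Injective (snocPrefix m) := by
  rintro ⟨⟨a, b⟩, k⟩ ⟨⟨a', b'⟩, k'⟩ h
  simp only [snocPrefix, Prod.mk.injEq, List.append_cancel_right_eq] at h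
  obtain ⟨h₁, h₂⟩ := h
  obtain ⟨h₃, h₄⟩ := List.append_inj' h₂ rfl
  simp_all

lemma isPrefixG_iff_isPrefixBelow {d n : ℕ} (hn : 1 ≤ n) (x : List ℕ × List ℕ) :
    IsPrefixG d n x ↔ IsPrefixBelow d n x := by
  have h' : ∀ i, i ≤ n - 1 ↔ i < n := fun i => by omega
  simp only [IsPrefixG, IsPrefixBelow, h']
  exact and_congr_right fun _ => and_congr_left fun _ => List.isChain_iff_pairwise

lemma isPrefixBelow_snocPrefix {d m j : ℕ} (hj : j < m) (p : (List ℕ × List ℕ) × ℕ) :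
    IsPrefixBelow d m (snocPrefix j p) ↔
      IsPrefixBelow d j p.1 ∧ 1 ≤ p.2 ∧ p.2 ≤ d - 1 := by
  obtain ⟨⟨a, b⟩, k⟩ := p
  simp only [IsPrefixBelow, snocPrefix, List.pairwise_append, List.length_append, List.mem_append,
    List.mem_singleton, List.length_singleton, List.pairwise_singleton]
  constructor
  · rintro ⟨h₁, ⟨h₂, -, h₃⟩, -, h₄⟩
    exact ⟨⟨by omega, h₂, fun i hi => h₃ i hi j rfl, fun c hc => h₄ c (.inl hc)⟩, h₄ k (.inr rfl)⟩
  · rintro ⟨⟨h₁, h₂, h₃, h₄⟩, h₅⟩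
    refine ⟨by omega, ⟨h₂, trivial, ?_⟩, ?_, ?_⟩
    · rintro i hi _ rfl
      exact h₃ i hi
    · rintro i (hi | rfl)
      exacts [(h₃ i hi).trans hj, hj]
    · rintro c (hc | rfl)
      exacts [h₄ c hc, h₅]

lemma exists_eq_snocPrefix {x : List ℕ × List ℕ} {j : ℕ} (hx : x.1.length = x.2.length)
    (hj : x.1.getLast? = some j) : ∃ p, x = snocPrefix j p := by
  obtain ⟨a, b⟩ := x
  obtain ⟨a', rfl⟩ := List.getLast?_eq_some_iff.1 hj
  rcases List.eq_nil_or_concat b with rfl | ⟨b', k, rfl⟩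
  · simp at hx
  · exact ⟨((a', b'), k), by simp [snocPrefix]⟩

lemma IsPrefixBelow.of_succ {d m : ℕ} {x : List ℕ × List ℕ}
    (hx : IsPrefixBelow d (m + 1) x) (hm : x.1.getLast? ≠ some m) : IsPrefixBelow d m x := by
  obtain ⟨h₁, h₂, h₃, h₄⟩ := hx
  refine ⟨h₁, h₂, fun i hi => ?_, h₄⟩
  rcases List.eq_nil_or_concat x.1 with h | ⟨a, j, h⟩
  · simp [h] at hi
  · simp only [h, List.concat_eq_append, List.pairwise_append, List.mem_append,
      List.mem_singleton, List.getLast?_append, List.getLast?_singleton] at *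
    have hj := h₃ j (.inr rfl)
    have hjm : j ≠ m := fun e => hm (by simp [e])
    rcases hi with hi | rfl
    · have := h₂.2.2 i hi j rfl
      omega
    · omega

/-- Extensions by the index `m` of the members of `S`. -/
def extendPrefixes (d m : ℕ) (S : Finset (List ℕ × List ℕ)) : Finset (List ℕ × List ℕ) :=
  (S ×ˢ Finset.Icc 1 (d - 1)).map ⟨snocPrefix m, snocPrefix_injective m⟩

lemma card_extendPrefixes (d m : ℕ) (S : Finset (List ℕ × List ℕ)) :
    (extendPrefixes d m S).card = (d - 1) * S.card := by
  simp [extendPrefixes, mul_comm]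

/-- The finite set of prefixes with indices below `m`, built by recursion on `m`. -/
def prefixesBelow (d : ℕ) : ℕ → Finset (List ℕ × List ℕ)
  | 0 => {([], [])}
  | m + 1 => prefixesBelow d m ∪ extendPrefixes d m (prefixesBelow d m)

lemma mem_extendPrefixes {d m j : ℕ} (hj : j < m) {S : Finset (List ℕ × List ℕ)}
    {Q : List ℕ × List ℕ → Prop} (hS : ∀ y, y ∈ S ↔ IsPrefixBelow d j y ∧ Q y)
    (x : List ℕ × List ℕ) :
    x ∈ extendPrefixes d j S ↔ IsPrefixBelow d m x ∧ x.1.getLast? = some j ∧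
      Q (x.1.dropLast, x.2.dropLast) := by
  constructor
  · intro h
    obtain ⟨p, hp, rfl⟩ := Finset.mem_map.1 h
    rw [Finset.mem_product, hS, Finset.mem_Icc] at hp
    refine ⟨(isPrefixBelow_snocPrefix hj p).2 ⟨hp.1.1, hp.2⟩, ?_, ?_⟩
    · simp [snocPrefix]
    · simpa [snocPrefix] using hp.1.2
  · rintro ⟨hx, hlast, hQ⟩
    obtain ⟨p, rfl⟩ := exists_eq_snocPrefix hx.1 hlast
    obtain ⟨h₁, h₂⟩ := (isPrefixBelow_snocPrefix hj p).1 hx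
    refine Finset.mem_map.2 ⟨p, Finset.mem_product.2 ⟨(hS _).2 ⟨h₁, ?_⟩, Finset.mem_Icc.2 h₂⟩, rfl⟩
    simpa [snocPrefix] using hQ

lemma mem_prefixesBelow (d m : ℕ) (x : List ℕ × List ℕ) :
    x ∈ prefixesBelow d m ↔ IsPrefixBelow d m x := by
  induction m generalizing x with
  | zero =>
    obtain ⟨a, b⟩ := x
    simp only [prefixesBelow, Finset.mem_singleton, Prod.mk.injEq, IsPrefixBelow]
    constructor
    · rintro ⟨rfl, rfl⟩
      simp
    · rintro ⟨h₁, -, h₃, -⟩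
      have ha : a = [] := List.eq_nil_iff_forall_not_mem.2 fun i hi => by simpa using h₃ i hi
      subst ha
      exact ⟨rfl, List.length_eq_zero_iff.1 h₁.symm⟩
  | succ m ih =>
    rw [prefixesBelow, Finset.mem_union, ih,
      mem_extendPrefixes (Nat.lt_succ_self m) (Q := fun _ => True) (by simpa using ih)]
    constructor
    · rintro (⟨h₁, h₂, h₃, h₄⟩ | h)
      · exact ⟨h₁, h₂, fun i hi => (h₃ i hi).trans (Nat.lt_succ_self m), h₄⟩
      · exact h.1
    · intro h
      by_cases hm : x.1.getLast? = some m
      · exact .inr ⟨h, hm, trivial⟩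
      · exact .inl (h.of_succ hm)

lemma card_prefixesBelow {d : ℕ} (hd : 1 ≤ d) (m : ℕ) : (prefixesBelow d m).card = d ^ m := by
  induction m with
  | zero => simp [prefixesBelow]
  | succ m ih =>
    rw [prefixesBelow, Finset.card_union_of_disjoint, card_extendPrefixes, ih]
    · obtain ⟨e, rfl⟩ := Nat.exists_eq_add_of_le' hd
      rw [Nat.add_sub_cancel]
      ring
    · refine Finset.disjoint_left.2 fun x hx hx' => ?_
      obtain ⟨p, -, rfl⟩ := Finset.mem_map.1 hx'
      have := ((mem_prefixesBelow d m _).1 hx).2.2.1 m (by simp [snocPrefix])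
      omega

/-- The prefixes of length at least two with last index `j`. -/
def longPrefixes (d j : ℕ) : Finset (List ℕ × List ℕ) :=
  extendPrefixes d j ((prefixesBelow d j).erase ([], []))

lemma mem_longPrefixes {d m j : ℕ} (hj : j < m) (x : List ℕ × List ℕ) :
    x ∈ longPrefixes d j ↔
      IsPrefixBelow d m x ∧ 2 ≤ x.1.length ∧ x.1.getLast? = some j := by
  rw [longPrefixes, mem_extendPrefixes hj (Q := fun y => y ≠ ([], []))
    (fun y => by rw [Finset.mem_erase, mem_prefixesBelow, and_comm])]
  refine and_congr_right fun hx => ?_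
  rw [and_comm]
  refine and_congr_left fun _ => ?_
  have h := hx.1
  rw [Ne, Prod.mk.injEq, ← List.length_eq_zero_iff, ← List.length_eq_zero_iff,
    List.length_dropLast, List.length_dropLast]
  omega

lemma card_longPrefixes {d : ℕ} (hd : 1 ≤ d) (j : ℕ) :
    (longPrefixes d j).card = (d - 1) * (d ^ j - 1) := by
  rw [longPrefixes, card_extendPrefixes, Finset.card_erase_of_mem, card_prefixesBelow hd]
  exact (mem_prefixesBelow d j _).2 (by simp [IsPrefixBelow])

/-- The prefixes of length one with index `j`. -/
def singletonPrefixes (d j : ℕ) : Finset (List ℕ × List ℕ) :=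
  extendPrefixes d j {([], [])}

lemma mem_singletonPrefixes {d m j : ℕ} (hj : j < m) (x : List ℕ × List ℕ) :
    x ∈ singletonPrefixes d j ↔ IsPrefixBelow d m x ∧ x.1 = [j] := by
  rw [singletonPrefixes, mem_extendPrefixes hj (Q := fun y => y = ([], []))]
  · refine and_congr_right fun hx => ?_
    constructor
    · rintro ⟨h₁, h₂⟩
      obtain ⟨p, rfl⟩ := exists_eq_snocPrefix hx.1 h₁
      simp_all [snocPrefix]
    · intro h
      have h₁ := hx.1
      rw [h] at h₁
      simp only [h, List.getLast?_singleton, List.dropLast_singleton, Prod.mk.injEq, true_and]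
      rw [← List.length_eq_zero_iff, List.length_dropLast, ← h₁]
      rfl
  · intro y
    rw [Finset.mem_singleton, iff_and_self]
    rintro rfl
    simp [IsPrefixBelow]

lemma card_singletonPrefixes (d j : ℕ) : (singletonPrefixes d j).card = d - 1 := by
  rw [singletonPrefixes, card_extendPrefixes, Finset.card_singleton, mul_one]


/-- Packet sizes for `G(d,1,n)` (`d ≥ 2`, `n ≥ 3`):
`|𝒫(n,0)| = (d−1)(d^{n−1} − 1)`; `|𝒫(n,s)| = (d−1)·d^{n−1−s}` for `1 ≤ s ≤ n−2`;
`|𝒫(n,n−1)| = 2(d−1)`; `|𝒫(n,n)| = 1`. -/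
theorem packet_sizes_G (d n : ℕ) (hd : 2 ≤ d) (hn : 3 ≤ n) :
    (Nat.card {x : List ℕ × List ℕ // IsPrefixG d n x ∧
        2 ≤ x.1.length ∧ x.1.getLast? = some (n - 1)} = (d - 1) * (d ^ (n - 1) - 1)) ∧
    (∀ s, 1 ≤ s → s ≤ n - 2 →
      Nat.card {x : List ℕ × List ℕ // IsPrefixG d n x ∧
        ((x.1.length = 1 ∧ x.1 = [n - s]) ∨
          (2 ≤ x.1.length ∧ x.1.getLast? = some (n - s - 1)))} = (d - 1) * d ^ (n - 1 - s)) ∧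
    (Nat.card {x : List ℕ × List ℕ // IsPrefixG d n x ∧
        x.1.length = 1 ∧ (x.1 = [0] ∨ x.1 = [1])} = 2 * (d - 1)) ∧
    (Nat.card {x : List ℕ × List ℕ // IsPrefixG d n x ∧ x.1.length = 0} = 1) := by
  have hd' : 1 ≤ d := by omega
  simp only [isPrefixG_iff_isPrefixBelow (show 1 ≤ n by omega)]
  refine ⟨?_, fun s hs hsn => ?_, ?_, ?_⟩
  · rw [Nat.subtype_card _ (mem_longPrefixes (show n - 1 < n by omega)), card_longPrefixes hd']
  · rw [Nat.subtype_card (singletonPrefixes d (n - s) ∪ longPrefixes d (n - s - 1)),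
      Finset.card_union_of_disjoint, card_singletonPrefixes, card_longPrefixes hd',
      Nat.sub_right_comm n s 1]
    · have h : 1 ≤ d ^ (n - 1 - s) := Nat.one_le_pow _ _ hd'
      obtain ⟨e, he⟩ := Nat.exists_eq_add_of_le' h
      rw [he, Nat.add_sub_cancel]
      ring
    · refine Finset.disjoint_left.2 fun x hx hx' => ?_
      have h₁ := ((mem_singletonPrefixes (show n - s < n by omega) x).1 hx).2
      have h₂ := ((mem_longPrefixes (show n - s - 1 < n by omega) x).1 hx').2.1
      simp [h₁] at h₂
    · intro x
      rw [Finset.mem_union, mem_singletonPrefixes (show n - s < n by omega),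
        mem_longPrefixes (show n - s - 1 < n by omega), ← and_or_left]
      refine and_congr_right fun _ => or_congr_left ?_
      rw [iff_and_self]
      intro h
      simp [h]
  · rw [Nat.subtype_card (singletonPrefixes d 0 ∪ singletonPrefixes d 1),
      Finset.card_union_of_disjoint, card_singletonPrefixes, card_singletonPrefixes, two_mul]
    · refine Finset.disjoint_left.2 fun x hx hx' => ?_
      have h₁ := ((mem_singletonPrefixes (show 0 < n by omega) x).1 hx).2
      have h₂ := ((mem_singletonPrefixes (show 1 < n by omega) x).1 hx').2
      simp [h₁] at h₂
    · intro x
      rw [Finset.mem_union, mem_singletonPrefixes (show 0 < n by omega),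
        mem_singletonPrefixes (show 1 < n by omega), ← and_or_left]
      refine and_congr_right fun _ => ?_
      rw [iff_and_self]
      rintro (h | h) <;> simp [h]
  · rw [Nat.subtype_card {([], [])}, Finset.card_singleton]
    rintro ⟨a, b⟩
    rw [Finset.mem_singleton, Prod.mk.injEq]
    constructor
    · rintro ⟨rfl, rfl⟩
      simp [IsPrefixBelow]
    · rintro ⟨h, ha⟩
      exact ⟨List.length_eq_zero_iff.1 ha, List.length_eq_zero_iff.1 (h.1.symm.trans ha)⟩
end
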